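/- Let ρ₀ be a Borel probability measure on ℝ with finite second moment and v₀: ℝ → ℝ absolutely continuous, and let W satisfy the stated hypotheses with semiconvexity constant c > 0. Then there exists a locally Lipschitz continuous map X: [0,∞) → L²(ρ₀), admitting for each t ≥ 0 a continuous representative X(·,t): ℝ → ℝ, which satisfies X(0) = id_ℝ ρ₀-almost everywhere and the pressureless Euler flow equation, and which moreover has the following properties: (i) for Lebesgue-almost every s, t ∈ [0,∞) with s ≤ t, E(t) ≤ E(s), where E(τ) := ∫ ½ Ẋ(τ)² dρ₀ + ∫∫ ½ W(X(y,τ) − X(z,τ)) dρ₀(y) dρ₀(z); (ii) for every t ≥ 0 and all y, z ∈ supp(ρ₀) with y ≥ z, 0 ≤ X(y,t) − X(z,t) ≤ cosh(√c t)(y − z) + (1/√c) sinh(√c t) ∫_z^y |v₀'(x)| dx; (iii) for all 0 < s ≤ t and all y, z ∈ supp(ρ₀), |X(y,t) − X(z,t)|/sinh(√c t) ≤ |X(y,s) − X(z,s)|/sinh(√c s). -/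

import Mathlib

open MeasureTheory Real Filter Set Topology

noncomputable section

/-- The support of a measure, as defined in the paper:
`supp(ρ₀) = {y : ρ₀((y-δ, y+δ)) > 0 for all δ > 0}`. -/
def msupp (μ : Measure ℝ) : Set ℝ := {y | ∀ δ > 0, 0 < μ (Ioo (y - δ) (y + δ))}

/-- `X` has strong `L²(ρ)` derivative `V` at time `t`. -/
def HasL2DerivAt (ρ : Measure ℝ) (X : ℝ → ℝ → ℝ) (V : ℝ → ℝ) (t : ℝ) : Prop :=
  Tendsto (fun τ : ℝ => ∫ y, ((X (t + τ) y - X t y) / τ - V y) ^ 2 ∂ρ)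
    (𝓝[≠] 0) (𝓝 0)

/-- a.e. monotone functions -/
def AEMono (ρ : Measure ℝ) (f : ℝ → ℝ) : Prop := ∃ A : Set ℝ, (∀ᵐ x ∂ρ, x ∈ A) ∧ MonotoneOn f A

lemma AEMono.add {ρ : Measure ℝ} {f g : ℝ → ℝ} (hf : AEMono ρ f) (hg : AEMono ρ g) :
    AEMono ρ (fun x => f x + g x) := by
  obtain ⟨A, hA, h1⟩ := hf
  obtain ⟨B, hB, h2⟩ := hg
  refine ⟨A ∩ B, by filter_upwards [hA, hB] with x h h' using ⟨h, h'⟩, ?_⟩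
  intro x hx y hy hxy
  exact add_le_add (h1 hx.1 hy.1 hxy) (h2 hx.2 hy.2 hxy)

lemma AEMono.const_mul {ρ : Measure ℝ} {f : ℝ → ℝ} (hf : AEMono ρ f) {a : ℝ} (ha : 0 ≤ a) :
    AEMono ρ (fun x => a * f x) := by
  obtain ⟨A, hA, h1⟩ := hf
  exact ⟨A, hA, fun x hx y hy hxy => mul_le_mul_of_nonneg_left (h1 hx hy hxy) ha⟩

lemma AEMono.congr {ρ : Measure ℝ} {f g : ℝ → ℝ} (hf : AEMono ρ f) (h : f =ᵐ[ρ] g) :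
    AEMono ρ g := by
  obtain ⟨A, hA, h1⟩ := hf
  refine ⟨{x | x ∈ A ∧ f x = g x}, by filter_upwards [hA, h] with x h h' using ⟨h, h'⟩, ?_⟩
  intro x hx y hy hxy
  rw [← hx.2, ← hy.2]
  exact h1 hx.1 hy.1 hxy

lemma Monotone.aeMono {ρ : Measure ℝ} {f : ℝ → ℝ} (hf : Monotone f) : AEMono ρ f :=
  ⟨univ, by simp, fun _ _ _ _ h => hf h⟩

lemma AEMono.sum {ρ : Measure ℝ} {f : ℕ → ℝ → ℝ} (s : Finset ℕ) (hf : ∀ i ∈ s, AEMono ρ (f i)) :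
    AEMono ρ (fun x => ∑ i ∈ s, f i x) := by
  classical
  induction s using Finset.induction_on with
  | empty => simpa using (monotone_const : Monotone (fun _ : ℝ => (0:ℝ))).aeMono
  | insert a s ha ih =>
    simp only [Finset.sum_insert ha]
    exact (hf a (Finset.mem_insert_self _ _)).add
      (ih (fun i hi => hf i (Finset.mem_insert_of_mem hi)))

/-- Vitali-type lemma -/
lemma LV {α : Type*} [MeasurableSpace α] {μ : Measure α} {u : ℕ → α → ℝ} {ξ : α → ℝ} {M : ℝ}
    (hu : ∀ n, MemLp (u n) 2 μ) (hM : ∀ n, ∫ x, (u n x) ^ 2 ∂μ ≤ M) (hξ : MemLp ξ 2 μ)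
    (h0 : ∀ᵐ x ∂μ, Tendsto (fun n => u n x) atTop (𝓝 0)) :
    Tendsto (fun n => ∫ x, |u n x| * |ξ x| ∂μ) atTop (𝓝 0) := by
  have hM0 : 0 ≤ M := le_trans (integral_nonneg fun x => sq_nonneg _) (hM 0)
  have hint : ∀ n, Integrable (fun x => |u n x| * |ξ x|) μ := fun n =>
    (hu n).abs.integrable_mul hξ.abs
  have key : ∀ R : ℝ, 0 < R → Tendsto (fun n => ∫ x, min |u n x| (R * |ξ x|) * |ξ x| ∂μ) atTop (𝓝 0) := by
    intro R hR
    have : (0:ℝ) = ∫ x, (0:ℝ) ∂μ := by simp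
    rw [this]
    refine tendsto_integral_of_dominated_convergence (fun x => R * (ξ x)^2) ?_ ?_ ?_ ?_
    · intro n
      exact (((hu n).1.norm).inf ((hξ.1.norm).const_mul R)).mul hξ.1.norm
    · exact hξ.integrable_sq.const_mul R
    · intro n
      refine Eventually.of_forall fun x => ?_
      rw [Real.norm_eq_abs, abs_of_nonneg (by positivity)]
      calc _ ≤ (R * |ξ x|) * |ξ x| := by gcongr; exact min_le_right _ _
        _ = R * (ξ x)^2 := by rw [mul_assoc, ← sq, sq_abs]
    · filter_upwards [h0] with x hx
      have h1 : Tendsto (fun n => |u n x| * |ξ x|) atTop (𝓝 (|0| * |ξ x|)) := (hx.abs).mul_const _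
      simp only [abs_zero, zero_mul] at h1
      refine squeeze_zero (fun n => by positivity) (fun n => ?_) h1
      gcongr
      exact min_le_left _ _
  have bd : ∀ R : ℝ, 0 < R → ∀ n, ∫ x, |u n x| * |ξ x| ∂μ ≤
      (∫ x, min |u n x| (R * |ξ x|) * |ξ x| ∂μ) + M / R := by
    intro R hR n
    have hi1 : Integrable (fun x => min |u n x| (R * |ξ x|) * |ξ x|) μ := by
      refine (hint n).mono' ((((hu n).1.norm).inf ((hξ.1.norm).const_mul R)).mul hξ.1.norm) ?_
      refine Eventually.of_forall fun x => ?_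
      rw [Real.norm_eq_abs, abs_of_nonneg (by positivity)]
      gcongr
      exact min_le_left _ _
    have hi2 : Integrable (fun x => (u n x)^2 / R) μ := (hu n).integrable_sq.div_const R
    calc ∫ x, |u n x| * |ξ x| ∂μ ≤ ∫ x, (min |u n x| (R * |ξ x|) * |ξ x| + (u n x)^2 / R) ∂μ := by
          refine integral_mono (hint n) (hi1.add hi2) fun x => ?_
          simp only
          rcases le_total (|u n x|) (R * |ξ x|) with h | h
          · rw [min_eq_left h]
            have : 0 ≤ (u n x)^2 / R := by positivity
            linarith
          · rw [min_eq_right h]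
            have h3 : |u n x| * |ξ x| ≤ (u n x)^2 / R := by
              rw [le_div_iff₀ hR, ← sq_abs]
              nlinarith [abs_nonneg (u n x)]
            have : 0 ≤ R * |ξ x| * |ξ x| := by positivity
            linarith
      _ = (∫ x, min |u n x| (R * |ξ x|) * |ξ x| ∂μ) + (∫ x, (u n x)^2 ∂μ) / R := by
          rw [integral_add hi1 hi2, integral_div]
      _ ≤ _ := by gcongr; exact hM n
  rw [Metric.tendsto_atTop]
  intro ε hε
  set R := 2 * (M + 1) / ε with hRdef
  have hR : 0 < R := by positivity
  obtain ⟨N, hN⟩ := (Metric.tendsto_atTop.1 (key R hR)) (ε / 2) (by positivity)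
  refine ⟨N, fun n hn => ?_⟩
  have h1 := hN n hn
  rw [Real.dist_eq, sub_zero] at h1 ⊢
  rw [abs_of_nonneg (integral_nonneg fun x => by positivity)]
  have h2 := bd R hR n
  have h3 : M / R < ε / 2 := by
    rw [hRdef, div_lt_iff₀ (by positivity)]
    have : ε / 2 * (2 * (M + 1) / ε) = M + 1 := by field_simp
    rw [this]; linarith
  have := le_abs_self (∫ x, min |u n x| (R * |ξ x|) * |ξ x| ∂μ)
  linarith

/-- null sets from one-sided thin sets -/
lemma null_of_left {ρ : Measure ℝ} (B : Set ℝ) : ρ {x | x ∈ B ∧ ρ (B ∩ Iic x) = 0} = 0 := by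
  set N := {x | x ∈ B ∧ ρ (B ∩ Iic x) = 0} with hN
  by_cases hmax : ∃ x ∈ N, ∀ y ∈ N, y ≤ x
  · obtain ⟨x, hx, hy⟩ := hmax
    have hs : N ⊆ B ∩ Iic x := fun y hyN => ⟨hyN.1, hy y hyN⟩
    exact measure_mono_null hs hx.2
  · push Not at hmax
    refine measure_null_of_locally_null N fun x hx => ?_
    obtain ⟨y, hy, hxy⟩ := hmax x hx
    refine ⟨N ∩ Iic y, inter_mem_nhdsWithin _ (Iic_mem_nhds hxy), ?_⟩
    have hs : N ∩ Iic y ⊆ B ∩ Iic y := fun z hz => ⟨hz.1.1, hz.2⟩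
    exact measure_mono_null hs hy.2

lemma null_of_right {ρ : Measure ℝ} (B : Set ℝ) : ρ {x | x ∈ B ∧ ρ (B ∩ Ici x) = 0} = 0 := by
  set N := {x | x ∈ B ∧ ρ (B ∩ Ici x) = 0} with hN
  by_cases hmax : ∃ x ∈ N, ∀ y ∈ N, x ≤ y
  · obtain ⟨x, hx, hy⟩ := hmax
    have hs : N ⊆ B ∩ Ici x := fun y hyN => ⟨hyN.1, hy y hyN⟩
    exact measure_mono_null hs hx.2
  · push Not at hmax
    refine measure_null_of_locally_null N fun x hx => ?_
    obtain ⟨y, hy, hxy⟩ := hmax x hx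
    refine ⟨N ∩ Ici y, inter_mem_nhdsWithin _ (Ici_mem_nhds hxy), ?_⟩
    have hs : N ∩ Ici y ⊆ B ∩ Ici y := fun z hz => ⟨hz.1.1, hz.2⟩
    exact measure_mono_null hs hy.2


lemma rl1 {a a' d d' b : ℝ} (h1 : a ≤ a') (h2 : d ≤ d') :
    d + min (max (a-d-b) 0) 1 ≤ d' + min (max (a'-d'-b) 0) 1 := by grind
lemma rl2 {a a' d d' b : ℝ} (h1 : a ≤ a') (h2 : d ≤ d') :
    a - min (max (a-d-b) 0) 1 ≤ a' - min (max (a'-d'-b) 0) 1 := by grind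
lemma rl3 {a a' d d' b : ℝ} (h1 : a ≤ a') (h2 : d ≤ d') :
    d + -min (max (b-(a-d)) 0) 1 ≤ d' + -min (max (b-(a'-d')) 0) 1 := by grind
lemma rl4 {a a' d d' b : ℝ} (h1 : a ≤ a') (h2 : d ≤ d') :
    a - -min (max (b-(a-d)) 0) 1 ≤ a' - -min (max (b-(a'-d')) 0) 1 := by grind
lemma rl5 {a d d' b : ℝ} (h1 : a - b ≤ d') (h2 : d ≤ d') :
    d + min (max (a-d-b) 0) 1 ≤ d' + 0 := by grind
lemma rl6 {a a' d b : ℝ} (h1 : a ≤ a') : a - min (max (a-d-b) 0) 1 ≤ a' - 0 := by grind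
lemma rl7 {d a' d' b : ℝ} (h1 : d ≤ a' - b) (h2 : d ≤ d') :
    d + 0 ≤ d' + -min (max (b-(a'-d')) 0) 1 := by grind
lemma rl8 {a a' d' b : ℝ} (h1 : a ≤ a') : a - 0 ≤ a' - -min (max (b-(a'-d')) 0) 1 := by grind

/-- The comparison lemma. -/
lemma lemmaA {ρ : Measure ℝ} [IsProbabilityMeasure ρ] {X X' q : ℝ → ℝ}
    (hXm : AEMeasurable X ρ) (hX'm : AEMeasurable X' ρ) (hq : Integrable q ρ)
    (hX : AEMono ρ X) (hX' : AEMono ρ X') (hR : AEMono ρ (fun x => X x - X' x - q x))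
    (H : ∀ h : ℝ → ℝ, MemLp h 2 ρ → AEMono ρ (fun x => X' x + h x) →
      AEMono ρ (fun x => X x - h x) → ∫ x, q x * h x ∂ρ ≤ 0) :
    AEMono ρ (fun x => X x - X' x) := by
  obtain ⟨A1, hA1, m1⟩ := hX
  obtain ⟨A2, hA2, m2⟩ := hX'
  obtain ⟨A3, hA3, m3⟩ := hR
  set A := A1 ∩ A2 ∩ A3 with hAdef
  have hA : ∀ᵐ x ∂ρ, x ∈ A := by filter_upwards [hA1, hA2, hA3] with x h1 h2 h3 using ⟨⟨h1, h2⟩, h3⟩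
  replace m1 : MonotoneOn X A := m1.mono fun x hx => hx.1.1
  replace m2 : MonotoneOn X' A := m2.mono fun x hx => hx.1.2
  replace m3 : MonotoneOn (fun x => X x - X' x - q x) A := m3.mono fun x hx => hx.2
  set D : ℝ → ℝ := fun x => X x - X' x with hD
  have hDm : AEMeasurable D ρ := hXm.sub hX'm
  set A' : Set ℝ := {x | x ∈ A ∧ ∀ b : ℚ, (x ∈ {x | x ∈ A ∧ (b:ℝ) < D x} →
      ρ ({x | x ∈ A ∧ (b:ℝ) < D x} ∩ Iic x) ≠ 0) ∧ (x ∈ {x | x ∈ A ∧ D x < (b:ℝ)} →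
      ρ ({x | x ∈ A ∧ D x < (b:ℝ)} ∩ Ici x) ≠ 0)} with hA'
  refine ⟨A', ?_, ?_⟩
  · have h1 : ∀ᵐ x ∂ρ, ∀ b : ℚ, (x ∈ {x | x ∈ A ∧ (b:ℝ) < D x} →
      ρ ({x | x ∈ A ∧ (b:ℝ) < D x} ∩ Iic x) ≠ 0) ∧ (x ∈ {x | x ∈ A ∧ D x < (b:ℝ)} →
      ρ ({x | x ∈ A ∧ D x < (b:ℝ)} ∩ Ici x) ≠ 0) := by
      rw [ae_all_iff]
      intro b
      have e1 := measure_eq_zero_iff_ae_notMem.1 (null_of_left (ρ := ρ) {x | x ∈ A ∧ (b:ℝ) < D x})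
      have e2 := measure_eq_zero_iff_ae_notMem.1 (null_of_right (ρ := ρ) {x | x ∈ A ∧ D x < (b:ℝ)})
      filter_upwards [e1, e2] with x h1 h2
      exact ⟨fun h h' => h1 ⟨h, h'⟩, fun h h' => h2 ⟨h, h'⟩⟩
    filter_upwards [hA, h1] with x hx h2 using ⟨hx, h2⟩
  intro w hw p hp hwp
  by_contra hlt
  push Not at hlt
  obtain ⟨b, hpb, hbw⟩ := exists_rat_btwn hlt
  have pos1 := (hw.2 b).1 ⟨hw.1, hbw⟩
  have pos2 := (hp.2 b).2 ⟨hp.1, hpb⟩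
  set β : ℝ := (b:ℝ) with hβ
  set L : Set ℝ := {x | ∃ x1 ∈ A, x ≤ x1 ∧ x1 ≤ p ∧ β ≤ D x1} with hL
  have hLlow : ∀ x ∈ L, ∀ y, y ≤ x → y ∈ L := by
    rintro x ⟨x1, h1, h2, h3⟩ y hy
    exact ⟨x1, h1, hy.trans h2, h3⟩
  have hLm : MeasurableSet L := by
    apply Set.OrdConnected.measurableSet
    exact ⟨fun x hx y hy z hz => hLlow y hy z hz.2⟩
  have hwL : w ∈ L := ⟨w, hw.1, le_rfl, hwp, hbw.le⟩
  have hLp : ∀ x ∈ L, x ≤ p := by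
    rintro x ⟨x1, h1, h2, h3, h4⟩; exact h2.trans h3
  have hpL : p ∉ L := by
    rintro ⟨x1, h1, h2, h3, h4⟩
    have : x1 = p := le_antisymm h3 h2
    rw [this] at h4
    exact absurd hpb (not_lt.2 h4)
  -- crossing estimates
  have cross1 : ∀ x ∈ L, x ∈ A → ∀ y, y ∉ L → y ∈ A → X x - β ≤ X' y := by
    intro x hxL hx y hyL hy
    have hxy : x ≤ y := by
      by_contra hc; push Not at hc; exact hyL (hLlow x hxL y hc.le)
    rcases le_total y p with h | h
    · have : D y < β := by
        by_contra hc; push Not at hc; exact hyL ⟨y, hy, le_rfl, h, hc⟩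
      have h2 := m1 hx hy hxy
      simp only [hD] at this
      linarith
    · have h2 := m1 hx hp.1 (hLp x hxL)
      have h3 := m2 hp.1 hy h
      have h4 : D p < β := hpb
      simp only [hD] at h4
      linarith
  have cross2 : ∀ x ∈ L, x ∈ A → ∀ y, y ∉ L → y ∈ A → X' x ≤ X y - β := by
    rintro x ⟨x1, h1, h2, h3, h4⟩ hx y hyL hy
    have hxy : x1 ≤ y := by
      by_contra hc; push Not at hc; exact hyL (hLlow x1 ⟨x1, h1, le_rfl, h3, h4⟩ y hc.le)
    have e1 := m2 hx h1 h2
    have e2 := m1 h1 hy hxy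
    simp only [hD] at h4
    linarith
  have mL : ∀ x y, x ≤ y → y ∈ L → x ∈ L := fun x y h hy => hLlow y hy x h
  by_cases hcase : ∀ x ∈ L, x ∈ A → X x - X' x - q x ≤ β
  · set h1 : ℝ → ℝ := L.indicator (fun x => min (max (D x - β) 0) 1) with hh1
    have hmem : MemLp h1 2 ρ := by
      refine MemLp.of_bound (C := 1) ?_ ?_
      · refine (AEMeasurable.indicator ?_ hLm).aestronglyMeasurable
        exact ((hDm.sub_const β).max aemeasurable_const).min aemeasurable_const
      · refine Eventually.of_forall fun x => ?_
        rw [hh1]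
        by_cases hx : x ∈ L
        · rw [indicator_of_mem hx, Real.norm_eq_abs, abs_of_nonneg (by positivity)]
          exact min_le_right _ _
        · rw [indicator_of_notMem hx]; simp
    have g1 : AEMono ρ (fun x => X' x + h1 x) := by
      refine ⟨A, hA, fun x hx y hy hxy => ?_⟩
      have e1 := m1 hx hy hxy
      have e2 := m2 hx hy hxy
      by_cases hyL : y ∈ L
      · have hxL := mL x y hxy hyL
        simp only [hh1, indicator_of_mem hyL, indicator_of_mem hxL, hD]
        exact rl1 e1 e2
      · by_cases hxL : x ∈ L
        · have := cross1 x hxL hx y hyL hy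
          simp only [hh1, indicator_of_notMem hyL, indicator_of_mem hxL, hD]
          exact rl5 this e2
        · simp only [hh1, indicator_of_notMem hyL, indicator_of_notMem hxL]
          linarith
    have g2 : AEMono ρ (fun x => X x - h1 x) := by
      refine ⟨A, hA, fun x hx y hy hxy => ?_⟩
      have e1 := m1 hx hy hxy
      have e2 := m2 hx hy hxy
      by_cases hyL : y ∈ L
      · have hxL := mL x y hxy hyL
        simp only [hh1, indicator_of_mem hyL, indicator_of_mem hxL, hD]
        exact rl2 e1 e2
      · by_cases hxL : x ∈ L
        · simp only [hh1, indicator_of_notMem hyL, indicator_of_mem hxL, hD]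
          exact rl6 e1
        · simp only [hh1, indicator_of_notMem hyL, indicator_of_notMem hxL]
          linarith
    have hle := H h1 hmem g1 g2
    have hb : ∀ x, 0 ≤ h1 x ∧ h1 x ≤ 1 := by
      intro x
      by_cases hx : x ∈ L
      · rw [hh1, indicator_of_mem hx]; exact ⟨le_min (le_max_right _ _) zero_le_one, min_le_right _ _⟩
      · rw [hh1, indicator_of_notMem hx]; simp
    have hpos : ∀ᵐ x ∂ρ, 0 ≤ q x * h1 x := by
      filter_upwards [hA] with x hx
      by_cases hxL : x ∈ L
      · have := hcase x hxL hx
        rcases le_total (D x) β with h | h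
        · rw [hh1, indicator_of_mem hxL, max_eq_right (by linarith)]; simp
        · refine mul_nonneg ?_ (hb x).1
          simp only [hD] at h; linarith
      · rw [hh1, indicator_of_notMem hxL]; simp
    have hqint : Integrable (fun x => q x * h1 x) ρ := by
      refine hq.norm.mono' (hq.1.mul hmem.1) (Eventually.of_forall fun x => ?_)
      rw [norm_mul]
      have : ‖h1 x‖ ≤ 1 := by rw [Real.norm_eq_abs, abs_of_nonneg (hb x).1]; exact (hb x).2
      nlinarith [norm_nonneg (q x)]
    have hz : ∫ x, q x * h1 x ∂ρ = 0 := le_antisymm hle (integral_nonneg_of_ae hpos)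
    rw [integral_eq_zero_iff_of_nonneg_ae hpos hqint] at hz
    apply pos1
    have hsub : ∀ᵐ x ∂ρ, x ∉ ({x | x ∈ A ∧ β < D x} ∩ Iic w) := by
      filter_upwards [hz] with x hx hx2
      have hxL : x ∈ L := mL x w hx2.2 hwL
      have h2 : β < D x := hx2.1.2
      have h3 := hcase x hxL hx2.1.1
      have h4 : 0 < q x := by simp only [hD] at h2; linarith
      have h5 : 0 < h1 x := by
        rw [hh1, indicator_of_mem hxL]
        exact lt_min (lt_max_of_lt_left (by linarith)) one_pos
      exact absurd hx (mul_pos h4 h5).ne'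
    exact measure_eq_zero_iff_ae_notMem.2 hsub
  · push Not at hcase
    obtain ⟨x0, hx0L, hx0A, hx0⟩ := hcase
    have hcase' : ∀ x, x ∉ L → x ∈ A → β ≤ X x - X' x - q x := by
      intro x hxL hxA
      have : x0 ≤ x := by
        by_contra hc; push Not at hc; exact hxL (hLlow x0 hx0L x hc.le)
      exact hx0.le.trans (m3 hx0A hxA this)
    set h1 : ℝ → ℝ := Lᶜ.indicator (fun x => - min (max (β - D x) 0) 1) with hh1
    have iL : ∀ x, x ∉ L → h1 x = - min (max (β - D x) 0) 1 := fun x hx => by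
      rw [hh1, indicator_of_mem]; exact hx
    have iL' : ∀ x, x ∈ L → h1 x = 0 := fun x hx => by
      rw [hh1, indicator_of_notMem]; simpa using hx
    have hb : ∀ x, h1 x ≤ 0 ∧ -1 ≤ h1 x := by
      intro x
      by_cases hx : x ∈ L
      · rw [iL' x hx]; simp
      · rw [iL x hx]
        exact ⟨by simp, neg_le_neg (min_le_right _ _)⟩
    have hmem : MemLp h1 2 ρ := by
      refine MemLp.of_bound (C := 1) ?_ ?_
      · refine (AEMeasurable.indicator ?_ hLm.compl).aestronglyMeasurable
        exact (((hDm.const_sub β).max aemeasurable_const).min aemeasurable_const).neg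
      · refine Eventually.of_forall fun x => ?_
        rw [Real.norm_eq_abs, abs_le]
        exact ⟨(hb x).2, (hb x).1.trans zero_le_one⟩
    have g1 : AEMono ρ (fun x => X' x + h1 x) := by
      refine ⟨A, hA, fun x hx y hy hxy => ?_⟩
      have e1 := m1 hx hy hxy
      have e2 := m2 hx hy hxy
      by_cases hyL : y ∈ L
      · have hxL := mL x y hxy hyL
        simp only [iL' x hxL, iL' y hyL]
        linarith
      · by_cases hxL : x ∈ L
        · have := cross2 x hxL hx y hyL hy
          simp only [iL' x hxL, iL y hyL, hD]
          exact rl7 this e2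
        · simp only [iL x hxL, iL y hyL, hD]
          exact rl3 e1 e2
    have g2 : AEMono ρ (fun x => X x - h1 x) := by
      refine ⟨A, hA, fun x hx y hy hxy => ?_⟩
      have e1 := m1 hx hy hxy
      have e2 := m2 hx hy hxy
      by_cases hyL : y ∈ L
      · have hxL := mL x y hxy hyL
        simp only [iL' x hxL, iL' y hyL]
        linarith
      · by_cases hxL : x ∈ L
        · simp only [iL' x hxL, iL y hyL, hD]
          exact rl8 e1
        · simp only [iL x hxL, iL y hyL, hD]
          exact rl4 e1 e2
    have hle := H h1 hmem g1 g2
    have hpos : ∀ᵐ x ∂ρ, 0 ≤ q x * h1 x := by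
      filter_upwards [hA] with x hx
      by_cases hxL : x ∈ L
      · rw [iL' x hxL]; simp
      · have := hcase' x hxL hx
        rcases le_total β (D x) with h | h
        · rw [iL x hxL, max_eq_right (by linarith)]; simp
        · refine mul_nonneg_of_nonpos_of_nonpos ?_ (hb x).1
          simp only [hD] at h; linarith
    have hqint : Integrable (fun x => q x * h1 x) ρ := by
      refine hq.norm.mono' (hq.1.mul hmem.1) (Eventually.of_forall fun x => ?_)
      rw [norm_mul]
      have : ‖h1 x‖ ≤ 1 := by
        rw [Real.norm_eq_abs, abs_le]; exact ⟨(hb x).2, (hb x).1.trans zero_le_one⟩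
      nlinarith [norm_nonneg (q x)]
    have hz : ∫ x, q x * h1 x ∂ρ = 0 := le_antisymm hle (integral_nonneg_of_ae hpos)
    rw [integral_eq_zero_iff_of_nonneg_ae hpos hqint] at hz
    apply pos2
    have hsub : ∀ᵐ x ∂ρ, x ∉ ({x | x ∈ A ∧ D x < β} ∩ Ici p) := by
      filter_upwards [hz] with x hx hx2
      have hxL : x ∉ L := fun hxL => hpL (hLlow x hxL p hx2.2)
      have h2 : D x < β := hx2.1.2
      have h3 := hcase' x hxL hx2.1.1
      have h4 : q x < 0 := by simp only [hD] at h2; linarith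
      have h5 : h1 x < 0 := by
        rw [iL x hxL, neg_lt_zero]
        exact lt_min (lt_max_of_lt_left (by linarith)) one_pos
      exact absurd hx (mul_pos_of_neg_of_neg h4 h5).ne'
    exact measure_eq_zero_iff_ae_notMem.2 hsub

/-- cone of monotone maps -/
def KK (ρ : Measure ℝ) : Set (Lp ℝ 2 ρ) := {f | AEMono ρ f}

lemma inner_Lp {ρ : Measure ℝ} (f g : Lp ℝ 2 ρ) : inner ℝ f g = ∫ x, f x * g x ∂ρ := by
  rw [L2.inner_def]
  congr 1; ext x
  simp [mul_comm]

lemma inner_toLp {ρ : Measure ℝ} {f g : ℝ → ℝ} (hf : MemLp f 2 ρ) (hg : MemLp g 2 ρ) :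
    inner ℝ (hf.toLp f) (hg.toLp g) = ∫ x, f x * g x ∂ρ := by
  rw [inner_Lp]
  refine integral_congr_ae ?_
  filter_upwards [hf.coeFn_toLp, hg.coeFn_toLp] with x h1 h2
  rw [h1, h2]

lemma normsq_toLp {ρ : Measure ℝ} {f : ℝ → ℝ} (hf : MemLp f 2 ρ) :
    ‖hf.toLp f‖ ^ 2 = ∫ x, (f x) ^ 2 ∂ρ := by
  rw [← real_inner_self_eq_norm_sq, inner_toLp]
  simp [sq]

lemma normsq_Lp {ρ : Measure ℝ} (f : Lp ℝ 2 ρ) :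
    ‖f‖ ^ 2 = ∫ x, (f x) ^ 2 ∂ρ := by
  rw [← real_inner_self_eq_norm_sq, inner_Lp]
  simp [sq]

lemma KK_closed (ρ : Measure ℝ) : IsClosed (KK ρ) := by
  rw [← isSeqClosed_iff_isClosed]
  intro f F hf hF
  have h1 : TendstoInMeasure ρ (fun n => (f n : ℝ → ℝ)) atTop F :=
    tendstoInMeasure_of_tendsto_Lp hF
  obtain ⟨ns, hns, hae⟩ := h1.exists_seq_tendsto_ae
  choose A hA hm using hf
  refine ⟨{x | (∀ n, x ∈ A n) ∧ Tendsto (fun i => f (ns i) x) atTop (𝓝 (F x))}, ?_, ?_⟩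
  · filter_upwards [ae_all_iff.2 hA, hae] with x h1 h2 using ⟨h1, h2⟩
  · intro x hx y hy hxy
    exact le_of_tendsto_of_tendsto' hx.2 hy.2 fun i => hm (ns i) (hx.1 _) (hy.1 _) hxy

lemma KK_add {ρ : Measure ℝ} {f g : Lp ℝ 2 ρ} (hf : f ∈ KK ρ) (hg : g ∈ KK ρ) : f + g ∈ KK ρ := by
  refine AEMono.congr (AEMono.add hf hg) ?_
  filter_upwards [Lp.coeFn_add f g] with x hx
  rw [hx]; rfl

lemma KK_smul {ρ : Measure ℝ} {f : Lp ℝ 2 ρ} (hf : f ∈ KK ρ) {a : ℝ} (ha : 0 ≤ a) : a • f ∈ KK ρ := by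
  refine AEMono.congr (AEMono.const_mul hf ha) ?_
  filter_upwards [Lp.coeFn_smul a f] with x hx
  rw [hx]; rfl

lemma KK_zero {ρ : Measure ℝ} : (0 : Lp ℝ 2 ρ) ∈ KK ρ := by
  refine AEMono.congr (monotone_const (c := (0:ℝ))).aeMono ?_
  filter_upwards [Lp.coeFn_zero ℝ 2 ρ] with x hx
  rw [hx]; rfl

lemma exists_proj {ρ : Measure ℝ} (y : Lp ℝ 2 ρ) :
    ∃ x ∈ KK ρ, ∀ w ∈ KK ρ, inner ℝ (y - x) (w - x) ≤ 0 := by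
  have hconv : Convex ℝ (KK ρ) := by
    intro f hf g hg a b ha hb _
    exact KK_add (KK_smul hf ha) (KK_smul hg hb)
  obtain ⟨x, hx, h⟩ := exists_norm_eq_iInf_of_complete_convex ⟨0, KK_zero⟩
    (KK_closed ρ).isComplete hconv y
  exact ⟨x, hx, (norm_eq_iInf_iff_real_inner_le_zero hconv hx).1 h⟩

/-- projection on the cone -/
def PK {ρ : Measure ℝ} (y : Lp ℝ 2 ρ) : Lp ℝ 2 ρ := (exists_proj y).choose

lemma PK_mem {ρ : Measure ℝ} (y : Lp ℝ 2 ρ) : PK y ∈ KK ρ := (exists_proj y).choose_spec.1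

lemma PK_inner {ρ : Measure ℝ} (y : Lp ℝ 2 ρ) {w} (hw : w ∈ KK ρ) : inner ℝ (y - PK y) (w - PK y) ≤ 0 :=
  (exists_proj y).choose_spec.2 w hw

lemma PK_contr {ρ : Measure ℝ} (y y' : Lp ℝ 2 ρ) : ‖PK y - PK y'‖ ≤ ‖y - y'‖ := by
  have h1 := PK_inner y (PK_mem y')
  have h2 := PK_inner y' (PK_mem y)
  have h3 : ‖PK y - PK y'‖ ^ 2 ≤ inner ℝ (y - y') (PK y - PK y') := by
    rw [← real_inner_self_eq_norm_sq]
    simp only [inner_sub_left, inner_sub_right] at *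
    linarith
  have h4 := real_inner_le_norm (y - y') (PK y - PK y')
  rcases eq_or_lt_of_le (norm_nonneg (PK y - PK y')) with h | h
  · rw [← h]; exact norm_nonneg _
  · nlinarith

lemma PK_self {ρ : Measure ℝ} {y : Lp ℝ 2 ρ} (hy : y ∈ KK ρ) : PK y = y := by
  have h1 := PK_inner y hy
  have : y - PK y = 0 := by
    rw [real_inner_self_eq_norm_sq] at h1
    exact norm_eq_zero.1 (pow_eq_zero_iff two_ne_zero |>.1 (le_antisymm h1 (sq_nonneg _)))
  exact (sub_eq_zero.1 this).symm

lemma PK_test {ρ : Measure ℝ} (y : Lp ℝ 2 ρ) {h : ℝ → ℝ} (hh : MemLp h 2 ρ)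
    (hm : AEMono ρ (fun x => PK y x + h x)) : ∫ x, (y x - PK y x) * h x ∂ρ ≤ 0 := by
  have hw : PK y + hh.toLp h ∈ KK ρ := by
    refine AEMono.congr hm ?_
    filter_upwards [Lp.coeFn_add (PK y) (hh.toLp h), hh.coeFn_toLp] with x h1 h2
    rw [h1, Pi.add_apply, h2]
  have h1 := PK_inner y hw
  rw [add_sub_cancel_left, inner_Lp] at h1
  refine le_of_eq_of_le (integral_congr_ae ?_) h1
  filter_upwards [Lp.coeFn_sub y (PK y), hh.coeFn_toLp] with x h1 h2
  rw [h1, h2]; rfl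

lemma Lp_int {ρ : Measure ℝ} [IsProbabilityMeasure ρ] (f : Lp ℝ 2 ρ) : Integrable f ρ :=
  (Lp.memLp f).integrable (by norm_num)

lemma PK_comp {ρ : Measure ℝ} [IsProbabilityMeasure ρ] (y y' : Lp ℝ 2 ρ) {a a' : ℝ} (ha : 0 < a) (ha' : 0 < a')
    (h : AEMono ρ (fun x => a * y x - a' * y' x)) : AEMono ρ (fun x => a * PK y x - a' * PK y' x) := by
  have i1 := Lp_int y
  have i2 := Lp_int y'
  have i3 := Lp_int (PK y)
  have i4 := Lp_int (PK y')
  refine lemmaA (q := fun x => a * PK y x - a' * PK y' x - (a * y x - a' * y' x))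
    (i3.1.aemeasurable.const_mul a) (i4.1.aemeasurable.const_mul a') ?_
    (AEMono.const_mul (PK_mem y) ha.le) (AEMono.const_mul (PK_mem y') ha'.le) ?_ ?_
  · exact ((i3.const_mul a).sub (i4.const_mul a')).sub ((i1.const_mul a).sub (i2.const_mul a'))
  · simpa using h
  · intro h hh h1 h2
    have t1 := PK_test y (h := fun x => -(a⁻¹ * h x)) (hh.const_mul a⁻¹).neg (by
      refine AEMono.congr (h2.const_mul (inv_nonneg.2 ha.le)) (Eventually.of_forall fun x => ?_)
      simp only; field_simp; ring)
    have t2 := PK_test y' (h := fun x => a'⁻¹ * h x) (hh.const_mul a'⁻¹) (by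
      refine AEMono.congr (h1.const_mul (inv_nonneg.2 ha'.le)) (Eventually.of_forall fun x => ?_)
      simp only; field_simp)
    have e : ∀ x, (a * PK y x - a' * PK y' x - (a * y x - a' * y' x)) * h x =
        a ^ 2 * ((y x - PK y x) * -(a⁻¹ * h x)) + a' ^ 2 * ((y' x - PK y' x) * (a'⁻¹ * h x)) := by
      intro x; field_simp; ring
    simp_rw [e]
    rw [integral_add, integral_const_mul, integral_const_mul]
    · nlinarith [sq_nonneg a, sq_nonneg a']
    · exact (MemLp.integrable_mul ((Lp.memLp y).sub (Lp.memLp (PK y))) (hh.const_mul a⁻¹).neg).const_mul _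
    · exact (MemLp.integrable_mul ((Lp.memLp y').sub (Lp.memLp (PK y'))) (hh.const_mul a'⁻¹)).const_mul _

lemma PK_comp_mono {ρ : Measure ℝ} [IsProbabilityMeasure ρ] (y : Lp ℝ 2 ρ) {ω : ℝ → ℝ} (hω : Monotone ω)
    (h : AEMono ρ (fun x => ω x - y x)) : AEMono ρ (fun x => ω x - PK y x) := by
  have i1 := Lp_int y
  have i3 := Lp_int (PK y)
  refine lemmaA (q := fun x => y x - PK y x)
    hω.measurable.aemeasurable i3.1.aemeasurable (i1.sub i3) hω.aeMono (PK_mem y) ?_ ?_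
  · simpa using h
  · intro h hh h1 _
    exact PK_test y hh h1

lemma PK_orth {ρ : Measure ℝ} [IsProbabilityMeasure ρ] (y : Lp ℝ 2 ρ) {φ : ℝ → ℝ} {L M : ℝ}
    (hL : ∀ a b, |φ a - φ b| ≤ L * |a - b|) (hM : ∀ a, |φ a| ≤ M) :
    ∫ x, (y x - PK y x) * φ (PK y x) ∂ρ = 0 := by
  have hL0 : 0 ≤ L := by
    have := hL 1 0
    have h2 := abs_nonneg (φ 1 - φ 0)
    norm_num at this; linarith
  have hφc : Continuous φ := by
    have : LipschitzWith L.toNNReal φ := LipschitzWith.of_dist_le_mul fun a b => by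
      rw [Real.dist_eq, Real.dist_eq, Real.coe_toNNReal _ hL0]; exact hL a b
    exact this.continuous
  have hφ : MemLp (fun x => φ (PK y x)) 2 ρ :=
    MemLp.of_bound (hφc.comp_aestronglyMeasurable (Lp.memLp (PK y)).1) M
      (Eventually.of_forall fun x => hM _)
  obtain ⟨A, hA, hm⟩ := PK_mem y
  set ε := (L + 1)⁻¹ with hε
  have hε0 : 0 < ε := by positivity
  have hεL : ε * L ≤ 1 := by rw [hε, inv_mul_le_iff₀ (by positivity)]; linarith
  have t : ∀ σ : ℝ, |σ| = ε → ∫ x, (y x - PK y x) * (σ * φ (PK y x)) ∂ρ ≤ 0 := by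
    intro σ hσ
    refine PK_test y (hφ.const_mul σ) ⟨A, hA, fun x hx z hz hxz => ?_⟩
    have h1 := hm hx hz hxz
    have h2 := hL (PK y x) (PK y z)
    have h3 : |σ * (φ (PK y x) - φ (PK y z))| ≤ PK y z - PK y x := by
      rw [abs_mul, hσ]
      rw [abs_sub_comm (PK y x), abs_of_nonneg (sub_nonneg.2 h1)] at h2
      calc _ ≤ ε * (L * (PK y z - PK y x)) := by gcongr
        _ = ε * L * (PK y z - PK y x) := by ring
        _ ≤ 1 * (PK y z - PK y x) := by gcongr
        _ = _ := one_mul _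
    have := (abs_le.1 h3).2
    simp only
    nlinarith
  have t1 := t ε (abs_of_pos hε0)
  have t2 := t (-ε) (by rw [abs_neg, abs_of_pos hε0])
  simp_rw [mul_left_comm] at t1 t2
  rw [integral_const_mul] at t1 t2
  nlinarith

/-- bundled data -/
structure Dat where
  ρ : Measure ℝ
  prob : IsProbabilityMeasure ρ
  idL : MemLp (fun y : ℝ => y) 2 ρ
  v : ℝ → ℝ
  vL : MemLp v 2 ρ
  v' : ℝ → ℝ
  v'loc : LocallyIntegrable v' volume
  hv : ∀ a b : ℝ, v b - v a = ∫ x in a..b, v' x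
  W : ℝ → ℝ
  g : ℝ → ℝ
  hW : ∀ x, HasDerivAt W (g x) x
  gc : Continuous g
  godd : ∀ x, g (-x) = - g x
  K : ℝ
  gK : ∀ x, |g x| ≤ K * (1 + |x|)
  c : ℝ
  hc : 0 < c
  gm : Monotone (fun x => g x + c * x)

namespace Dat
variable (D : Dat)

instance : IsProbabilityMeasure D.ρ := D.prob

lemma K0 : 0 ≤ D.K := by
  have h := D.gK 0
  have h2 := abs_nonneg (D.g 0)
  simp at h; linarith

/-- averaged force -/
def psi (X : ℝ → ℝ) (a : ℝ) : ℝ := ∫ z, D.g (a - X z) ∂D.ρ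

variable {D} {X : ℝ → ℝ}

lemma g_bd (a x : ℝ) : |D.g (a - x)| ≤ D.K * (1 + |a| + |x|) := by
  refine (D.gK _).trans ?_
  have h := abs_sub a x
  have := D.K0
  rw [add_assoc]
  gcongr

lemma psi_int (hX : Integrable X D.ρ) (a : ℝ) : Integrable (fun z => D.g (a - X z)) D.ρ := by
  refine Integrable.mono' (g := fun z => D.K * (1 + |a| + |X z|)) ?_ ?_ ?_
  · exact ((integrable_const (1 + |a|)).add hX.abs).const_mul _
  · exact D.gc.comp_aestronglyMeasurable (aestronglyMeasurable_const.sub hX.1)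
  · exact Eventually.of_forall fun z => g_bd _ _

lemma psi_bd (hX : Integrable X D.ρ) (a : ℝ) : |D.psi X a| ≤ D.K * (1 + |a| + ∫ z, |X z| ∂D.ρ) := by
  calc |D.psi X a| ≤ ∫ z, |D.g (a - X z)| ∂D.ρ := abs_integral_le_integral_abs
    _ ≤ ∫ z, D.K * (1 + |a| + |X z|) ∂D.ρ := by
        refine integral_mono (psi_int hX a).abs
          (((integrable_const (1 + |a|)).add hX.abs).const_mul _) fun z => g_bd _ _
    _ = _ := by
        rw [integral_const_mul, integral_add (integrable_const _) hX.abs]; simp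

lemma psi_cont (hX : Integrable X D.ρ) : Continuous (D.psi X) := by
  rw [continuous_iff_continuousAt]
  intro a
  refine continuousAt_of_dominated (bound := fun z => D.K * (1 + (|a| + 1) + |X z|)) ?_ ?_ ?_ ?_
  · exact Eventually.of_forall fun b => (psi_int hX b).1
  · have : ∀ᶠ b in 𝓝 a, |b| < |a| + 1 := continuous_abs.continuousAt.eventually_lt_const (by linarith)
    filter_upwards [this] with b hb
    refine Eventually.of_forall fun z => (g_bd _ _).trans ?_
    have := D.K0
    gcongr
  · exact ((integrable_const _).add hX.abs).const_mul _
  · exact Eventually.of_forall fun z => (D.gc.comp (continuous_id.sub continuous_const)).continuousAt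

lemma psi_mono (hX : Integrable X D.ρ) : Monotone (fun a => D.psi X a + D.c * a) := by
  intro a b hab
  have h : D.c * (a - b) ≤ D.psi X b - D.psi X a := by
    rw [psi, psi, ← integral_sub (psi_int hX b) (psi_int hX a)]
    have : D.c * (a - b) = ∫ z, D.c * (a - b) ∂D.ρ := by simp
    rw [this]
    refine integral_mono (integrable_const _) ((psi_int hX b).sub (psi_int hX a)) fun z => ?_
    have := D.gm (show a - X z ≤ b - X z by linarith)
    simp only at this ⊢
    linarith
  simp only; linarith

/-- force along the flow -/
def ff (D : Dat) (X : ℝ → ℝ) (y : ℝ) : ℝ := D.psi X (X y)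

lemma L1_le (hX : MemLp X 2 D.ρ) : (∫ z, |X z| ∂D.ρ) ≤ ‖hX.toLp X‖ := by
  have h1 := inner_toLp (memLp_const (1:ℝ) : MemLp (fun _ : ℝ => (1:ℝ)) 2 D.ρ) hX.abs
  have h2 := real_inner_le_norm ((memLp_const (1:ℝ) : MemLp (fun _ : ℝ => (1:ℝ)) 2 D.ρ).toLp _) (hX.abs.toLp _)
  rw [h1] at h2
  simp only [one_mul] at h2
  refine h2.trans ?_
  have h3 : ‖(memLp_const (1:ℝ) : MemLp (fun _ : ℝ => (1:ℝ)) 2 D.ρ).toLp _‖ ^ 2 = 1 := by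
    rw [normsq_toLp]; simp
  have h4 : ‖hX.abs.toLp _‖ ^ 2 = ‖hX.toLp X‖ ^ 2 := by
    rw [normsq_toLp, normsq_toLp]; simp [sq_abs]
  have h5 : ‖(memLp_const (1:ℝ) : MemLp (fun _ : ℝ => (1:ℝ)) 2 D.ρ).toLp _‖ = 1 := by
    nlinarith [norm_nonneg ((memLp_const (1:ℝ) : MemLp (fun _ : ℝ => (1:ℝ)) 2 D.ρ).toLp _)]
  rw [h5, one_mul]
  exact ((sq_eq_sq₀ (norm_nonneg _) (norm_nonneg _)).1 h4).le

lemma ff_bd (hX : MemLp X 2 D.ρ) (y : ℝ) : |D.ff X y| ≤ D.K * (1 + |X y| + ‖hX.toLp X‖) := by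
  refine (psi_bd (hX.integrable (by norm_num)) _).trans ?_
  have := D.K0
  gcongr
  exact L1_le hX

lemma ff_L (hX : MemLp X 2 D.ρ) : MemLp (D.ff X) 2 D.ρ := by
  have hb := ff_bd hX
  generalize ‖hX.toLp X‖ = r at hb
  have h1 : MemLp (fun y => |X y|) 2 D.ρ := hX.abs
  have h2 : MemLp (fun y => (1 + r) + |X y|) 2 D.ρ := (memLp_const (1 + r)).add h1
  have h3 : MemLp (fun y => D.K * ((1 + r) + |X y|)) 2 D.ρ := h2.const_mul _
  refine MemLp.of_le h3 ((psi_cont (hX.integrable (by norm_num))).comp_aestronglyMeasurable hX.1)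
    (Eventually.of_forall fun y => ?_)
  rw [Real.norm_eq_abs]
  refine ((hb y).trans (le_of_eq ?_)).trans (le_abs_self _)
  ring

lemma ff_norm (hX : MemLp X 2 D.ρ) : ‖(ff_L hX).toLp _‖ ≤ 3 * D.K * (1 + ‖hX.toLp X‖) := by
  have hK := D.K0
  set r := ‖hX.toLp X‖ with hr
  have hr0 : 0 ≤ r := norm_nonneg _
  refine le_of_sq_le_sq ?_ (by positivity)
  rw [normsq_toLp]
  have h1 : ∫ x, D.ff X x ^ 2 ∂D.ρ ≤ ∫ x, 3 * D.K ^ 2 * (1 + r ^ 2 + (X x) ^ 2) ∂D.ρ := by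
    refine integral_mono (ff_L hX).integrable_sq
      (((integrable_const _).add hX.integrable_sq).const_mul _) fun x => ?_
    have h := ff_bd hX x
    rw [← hr] at h
    simp only
    rw [← sq_abs (D.ff X x), ← sq_abs (X x)]
    have h' : |D.ff X x| ^ 2 ≤ (D.K * (1 + |X x| + r)) ^ 2 := by gcongr
    refine h'.trans ?_
    have e : (D.K * (1 + |X x| + r)) ^ 2 = D.K ^ 2 * (1 + |X x| + r) ^ 2 := by ring
    rw [e, mul_comm 3, mul_assoc]
    refine mul_le_mul_of_nonneg_left ?_ (sq_nonneg _)
    nlinarith [sq_nonneg (1 - |X x|), sq_nonneg (1 - r), sq_nonneg (|X x| - r)]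
  refine h1.trans ?_
  rw [integral_const_mul, integral_add (integrable_const _) hX.integrable_sq, ← normsq_toLp hX, ← hr]
  simp
  nlinarith [mul_nonneg (sq_nonneg D.K) hr0, mul_nonneg (sq_nonneg D.K) (sq_nonneg r), sq_nonneg D.K]

/-- the monotone operator on Lp -/
def Fm (D : Dat) (x : Lp ℝ 2 D.ρ) : Lp ℝ 2 D.ρ := (ff_L (Lp.memLp x)).toLp _ + D.c • x

lemma Fm_coe (x : Lp ℝ 2 D.ρ) : D.Fm x =ᵐ[D.ρ] fun y => D.ff x y + D.c * x y := by
  filter_upwards [Lp.coeFn_add ((ff_L (Lp.memLp x)).toLp _) (D.c • x), Lp.coeFn_smul D.c x,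
    (ff_L (Lp.memLp x)).coeFn_toLp] with y h1 h2 h3
  rw [Fm, h1, Pi.add_apply, h2, h3]; rfl

lemma Fm_mem {x : Lp ℝ 2 D.ρ} (hx : x ∈ KK D.ρ) : D.Fm x ∈ KK D.ρ := by
  refine AEMono.congr ?_ (Fm_coe x).symm
  obtain ⟨A, hA, hm⟩ := hx
  exact ⟨A, hA, fun a ha b hb hab => psi_mono (Lp_int x) (hm ha hb hab)⟩

lemma Fm_norm (x : Lp ℝ 2 D.ρ) : ‖D.Fm x‖ ≤ (3 * D.K + D.c) * (1 + ‖x‖) := by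
  have h := ff_norm (Lp.memLp x)
  rw [Lp.toLp_coeFn] at h
  calc ‖D.Fm x‖ ≤ _ + ‖D.c • x‖ := norm_add_le _ _
    _ ≤ 3 * D.K * (1 + ‖x‖) + D.c * ‖x‖ := by
      rw [norm_smul, Real.norm_eq_abs, abs_of_pos D.hc]; gcongr
    _ ≤ _ := by nlinarith [D.hc, norm_nonneg x]

/-- C -/
def Ch (D : Dat) (t : ℝ) : ℝ := Real.cosh (√D.c * t)
/-- S plus -/
def Sp (D : Dat) (t : ℝ) : ℝ := Real.sinh (√D.c * max t 0) / √D.c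

lemma k0 : 0 < √D.c := Real.sqrt_pos.2 D.hc

lemma Sp_nonneg (t : ℝ) : 0 ≤ D.Sp t := by
  refine div_nonneg (Real.sinh_nonneg_iff.2 (by positivity)) (k0.le)

lemma Sp_of_nonneg {t : ℝ} (ht : 0 ≤ t) : D.Sp t = Real.sinh (√D.c * t) / √D.c := by
  rw [Sp, max_eq_left ht]

lemma Sp_of_nonpos {t : ℝ} (ht : t ≤ 0) : D.Sp t = 0 := by
  rw [Sp, max_eq_right ht]; simp

lemma Sp_pos {t : ℝ} (ht : 0 < t) : 0 < D.Sp t := by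
  rw [Sp_of_nonneg ht.le]
  have := k0 (D := D)
  exact div_pos (Real.sinh_pos_iff.2 (by positivity)) this

lemma Sp_mono : Monotone D.Sp := by
  intro a b hab
  have := k0 (D := D)
  unfold Sp
  gcongr
  exact Real.sinh_le_sinh.2 (by gcongr)

lemma sinh_lip {a b : ℝ} (h0 : 0 ≤ a) (hab : a ≤ b) : Real.sinh b - Real.sinh a ≤ Real.cosh b * (b - a) := by
  have := Convex.image_sub_le_mul_sub_of_deriv_le (convex_Icc a b) (f := Real.sinh)
    Real.continuous_sinh.continuousOn Real.differentiable_sinh.differentiableOn (C := Real.cosh b)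
    (fun x hx => by
      rw [interior_Icc] at hx
      rw [Real.deriv_sinh, Real.cosh_le_cosh, abs_of_nonneg (h0.trans hx.1.le), abs_of_nonneg (h0.trans hab)]
      exact hx.2.le) a (left_mem_Icc.2 hab) b (right_mem_Icc.2 hab) hab
  exact this

lemma cosh_lip {a b : ℝ} (_h0 : 0 ≤ a) (hab : a ≤ b) : Real.cosh b - Real.cosh a ≤ Real.cosh b * (b - a) := by
  have := Convex.image_sub_le_mul_sub_of_deriv_le (convex_Icc a b) (f := Real.cosh)
    Real.continuous_cosh.continuousOn Real.differentiable_cosh.differentiableOn (C := Real.cosh b)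
    (fun x hx => by
      rw [interior_Icc] at hx
      rw [Real.deriv_cosh]
      exact (Real.sinh_le_sinh.2 hx.2.le).trans (Real.sinh_lt_cosh b).le) a (left_mem_Icc.2 hab) b (right_mem_Icc.2 hab) hab
  exact this

lemma Sp_lip {a b T : ℝ} (hab : a ≤ b) (hbT : b ≤ T) : D.Sp b - D.Sp a ≤ D.Ch T * (b - a) := by
  have hk := k0 (D := D)
  rcases le_total b 0 with hb | hb
  · rw [Sp_of_nonpos hb, Sp_of_nonpos (hab.trans hb)]
    have : 0 ≤ D.Ch T * (b - a) := mul_nonneg (Real.cosh_pos _).le (by linarith)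
    linarith
  · have h1 : max a 0 ≤ b := max_le hab hb
    have := sinh_lip (a := √D.c * max a 0) (b := √D.c * b) (by positivity) (by gcongr)
    rw [Sp_of_nonneg hb, Sp, ← sub_div, div_le_iff₀ hk]
    refine this.trans ?_
    have h2 : Real.cosh (√D.c * b) ≤ D.Ch T := by
      rw [Ch, Real.cosh_le_cosh, abs_of_nonneg (by positivity), abs_of_nonneg]
      · gcongr
      · have : 0 ≤ T := hb.trans hbT
        positivity
    have h3 : √D.c * b - √D.c * max a 0 ≤ √D.c * (b - a) := by
      have := le_max_left a 0
      nlinarith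
    calc _ ≤ D.Ch T * (√D.c * b - √D.c * max a 0) := by
          have : 0 ≤ √D.c * b - √D.c * max a 0 := by nlinarith
          gcongr
      _ ≤ D.Ch T * (√D.c * (b - a)) := by
          have : 0 ≤ D.Ch T := (Real.cosh_pos _).le
          gcongr
      _ = _ := by ring

lemma Ch_lip {a b T : ℝ} (h0 : 0 ≤ a) (hab : a ≤ b) (hbT : b ≤ T) :
    |D.Ch b - D.Ch a| ≤ √D.c * D.Ch T * (b - a) := by
  have hk := k0 (D := D)
  have h1 := cosh_lip (a := √D.c * a) (b := √D.c * b) (by positivity) (by gcongr)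
  have hb := h0.trans hab
  have h2 : Real.cosh (√D.c * b) ≤ D.Ch T := by
    rw [Ch, Real.cosh_le_cosh, abs_of_nonneg (by positivity), abs_of_nonneg]
    · gcongr
    · have : 0 ≤ T := hb.trans hbT
      positivity
  have h3 : Real.cosh (√D.c * a) ≤ Real.cosh (√D.c * b) := by
    rw [Real.cosh_le_cosh, abs_of_nonneg (by positivity), abs_of_nonneg (by positivity)]
    gcongr
  have h4 : |D.Ch b - D.Ch a| = cosh (√D.c * b) - cosh (√D.c * a) := abs_of_nonneg (sub_nonneg.2 h3)
  rw [h4]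
  refine h1.trans ?_
  have h5 : 0 ≤ √D.c * (b - a) := mul_nonneg hk.le (by linarith)
  rw [← mul_sub]
  nlinarith

lemma Sp_ineq {i l j : ℝ} (hi : 0 ≤ i) (hlj : l ≤ j) (hl : 0 ≤ l) :
    D.Sp j * D.Sp (l - i) ≤ D.Sp l * D.Sp (j - i) := by
  have hk := k0 (D := D)
  rcases le_total l i with h | h
  · rw [Sp_of_nonpos (by linarith : l - i ≤ 0), mul_zero]
    exact mul_nonneg (Sp_nonneg _) (Sp_nonneg _)
  · have h1 : 0 ≤ D.Sp i * D.Sp (j - l) := mul_nonneg (Sp_nonneg _) (Sp_nonneg _)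
    rw [Sp_of_nonneg hi, Sp_of_nonneg (by linarith)] at h1
    rw [Sp_of_nonneg (by linarith), Sp_of_nonneg (by linarith), Sp_of_nonneg (by linarith), Sp_of_nonneg (by linarith)]
    simp only [mul_sub, Real.sinh_sub] at *
    have e : Real.sinh (√D.c * l) / √D.c * ((Real.sinh (√D.c * j) * Real.cosh (√D.c * i) - Real.cosh (√D.c * j) * Real.sinh (√D.c * i)) / √D.c) -
      Real.sinh (√D.c * j) / √D.c * ((Real.sinh (√D.c * l) * Real.cosh (√D.c * i) - Real.cosh (√D.c * l) * Real.sinh (√D.c * i)) / √D.c) =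
      Real.sinh (√D.c * i) / √D.c * ((Real.sinh (√D.c * j) * Real.cosh (√D.c * l) - Real.cosh (√D.c * j) * Real.sinh (√D.c * l)) / √D.c) := by
      field_simp; ring
    linarith

lemma SC_ineq {l j : ℝ} (hlj : l ≤ j) (hl : 0 ≤ l) : 0 ≤ D.Sp j * D.Ch l - D.Sp l * D.Ch j := by
  have h1 : 0 ≤ D.Sp (j - l) := Sp_nonneg _
  rw [Sp_of_nonneg (by linarith)] at h1
  rw [Sp_of_nonneg (by linarith), Sp_of_nonneg (by linarith), Ch, Ch]
  rw [mul_sub, Real.sinh_sub, sub_div] at h1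
  convert h1 using 2 <;> ring

end Dat

namespace Dat
variable {D : Dat}

/-- identity in Lp -/
def iL (D : Dat) : Lp ℝ 2 D.ρ := D.idL.toLp _
/-- velocity in Lp -/
def wL (D : Dat) : Lp ℝ 2 D.ρ := D.vL.toLp _

/-- discrete scheme -/
def xs (D : Dat) (h : ℝ) (j : ℕ) : Lp ℝ 2 D.ρ :=
  PK (D.Ch (j * h) • D.iL + D.Sp (j * h) • D.wL
    - ∑ i : Fin j, (h * D.Sp (j * h - i.1 * h)) • D.Fm (xs D h i.1))
termination_by j
decreasing_by exact i.2

/-- free data -/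
def zs (D : Dat) (h : ℝ) (j : ℕ) : Lp ℝ 2 D.ρ :=
  D.Ch (j * h) • D.iL + D.Sp (j * h) • D.wL
    - ∑ i ∈ Finset.range j, (h * D.Sp (j * h - i * h)) • D.Fm (xs D h i)

lemma xs_eq (h : ℝ) (j : ℕ) : D.xs h j = PK (D.zs h j) := by
  rw [xs, zs, Finset.sum_range (fun i => (h * D.Sp (j * h - i * h)) • D.Fm (xs D h i))]

lemma zs_eq {h : ℝ} (hh : 0 ≤ h) {j N : ℕ} (hjN : j ≤ N) : D.zs h j = 
  D.Ch (j * h) • D.iL + D.Sp (j * h) • D.wL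
    - ∑ i ∈ Finset.range N, (h * D.Sp (j * h - i * h)) • D.Fm (xs D h i) := by
  rw [zs]
  congr 1
  refine Finset.sum_subset (Finset.range_mono hjN) fun i _ hi => ?_
  have : (j:ℝ) ≤ i := by simpa using hi
  rw [Sp_of_nonpos, mul_zero, zero_smul]
  nlinarith

lemma PK_norm (y : Lp ℝ 2 D.ρ) : ‖PK y‖ ≤ ‖y‖ := by
  have := PK_contr y 0
  rwa [PK_self KK_zero, sub_zero, sub_zero] at this

lemma Ch_mono {a b : ℝ} (ha : 0 ≤ a) (hab : a ≤ b) : D.Ch a ≤ D.Ch b := by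
  have hk := k0 (D := D)
  rw [Ch, Ch, Real.cosh_le_cosh, abs_of_nonneg (by positivity), abs_of_nonneg (by nlinarith)]
  gcongr

lemma Ch_pos (a : ℝ) : 0 < D.Ch a := Real.cosh_pos _

lemma kap0 : 0 ≤ 3 * D.K + D.c := by linarith [D.K0, D.hc]

lemma xs_bd (D : Dat) (T : ℝ) : ∃ R, 0 ≤ R ∧ ∀ h, 0 < h → ∀ j : ℕ, j * h ≤ T → ‖D.xs h j‖ ≤ R := by
  rcases lt_or_ge T 0 with hT | hT
  · exact ⟨0, le_rfl, fun h hh j hj => by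
      have : (0:ℝ) ≤ j * h := by positivity
      linarith⟩
  set B := D.Sp T * (3 * D.K + D.c) with hB
  have hk := kap0 (D := D)
  have hS := Sp_nonneg (D := D) T
  have hC := Ch_pos (D := D) T
  have hB0 : 0 ≤ B := mul_nonneg hS hk
  set A := D.Ch T * ‖D.iL‖ + D.Sp T * ‖D.wL‖ + B * T with hA
  have hA0 : 0 ≤ A := by positivity
  refine ⟨A * Real.exp (B * T), by positivity, fun h hh j hj => ?_⟩
  have key : ∀ j : ℕ, j * h ≤ T → ‖D.xs h j‖ ≤ A * (1 + B * h) ^ j := by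
    intro j
    induction j using Nat.strong_induction_on with
    | _ j ih =>
      intro hj
      have hj0 : (0:ℝ) ≤ j * h := by positivity
      rw [xs_eq]
      refine (PK_norm _).trans ?_
      have s1 : ‖∑ i ∈ Finset.range j, (h * D.Sp (j * h - i * h)) • D.Fm (xs D h i)‖ ≤
          ∑ i ∈ Finset.range j, (h * B + h * B * (A * (1 + B * h) ^ i)) := by
        refine norm_sum_le_of_le _ fun i hi => ?_
        have hij : i < j := Finset.mem_range.1 hi
        have hij' : (i:ℝ) ≤ j := by exact_mod_cast hij.le
        have hiT : (i:ℝ) * h ≤ T := le_trans (by gcongr) hj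
        have h2 := ih i hij hiT
        have h3 := Sp_nonneg (D := D) (j * h - i * h)
        rw [norm_smul, Real.norm_eq_abs, abs_of_nonneg (by positivity)]
        have h4 : D.Sp (j * h - i * h) ≤ D.Sp T := Sp_mono (by
          have : (0:ℝ) ≤ i * h := by positivity
          linarith)
        calc _ ≤ (h * D.Sp T) * ((3 * D.K + D.c) * (1 + A * (1 + B * h) ^ i)) := by
              gcongr
              exact (Fm_norm _).trans (by gcongr)
          _ = _ := by rw [hB]; ring
      have s2 : ∑ i ∈ Finset.range j, (h * B + h * B * (A * (1 + B * h) ^ i)) =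
          j * h * B + A * ((1 + B * h) ^ j - 1) := by
        rw [Finset.sum_add_distrib, Finset.sum_const, Finset.card_range, nsmul_eq_mul]
        have := geom_sum_mul (1 + B * h) j
        rw [← this, ← Finset.mul_sum, ← Finset.mul_sum]; ring
      calc ‖D.zs h j‖ ≤ ‖D.Ch (j * h) • D.iL‖ + ‖D.Sp (j * h) • D.wL‖ +
            ‖∑ i ∈ Finset.range j, (h * D.Sp (j * h - i * h)) • D.Fm (xs D h i)‖ := by
              rw [zs]; exact (norm_sub_le _ _).trans (by gcongr; exact norm_add_le _ _)
        _ ≤ D.Ch T * ‖D.iL‖ + D.Sp T * ‖D.wL‖ + (j * h * B + A * ((1 + B * h) ^ j - 1)) := by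
              rw [norm_smul, norm_smul, Real.norm_eq_abs, Real.norm_eq_abs,
                abs_of_pos (Ch_pos _), abs_of_nonneg (Sp_nonneg _)]
              gcongr
              · exact Ch_mono hj0 hj
              · exact Sp_mono hj
              · exact s1.trans s2.le
        _ ≤ A * (1 + B * h) ^ j := by
              have : j * h * B ≤ B * T := by rw [mul_comm]; gcongr
              rw [hA] at *; linarith
  refine (key j hj).trans ?_
  gcongr
  calc (1 + B * h) ^ j ≤ (Real.exp (B * h)) ^ j := by
        gcongr
        rw [add_comm]; exact Real.add_one_le_exp _
    _ = Real.exp (j * (B * h)) := (Real.exp_nat_mul _ _).symm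
    _ ≤ Real.exp (B * T) := by
        apply Real.exp_le_exp.2
        calc _ = B * (j * h) := by ring
          _ ≤ _ := by gcongr

lemma xs_lip (D : Dat) (T : ℝ) : ∃ L, 0 ≤ L ∧ ∀ h, 0 < h → ∀ l j : ℕ, l ≤ j → j * h ≤ T →
    ‖D.xs h j - D.xs h l‖ ≤ L * (j * h - l * h) := by
  rcases lt_or_ge T 0 with hT | hT
  · exact ⟨0, le_rfl, fun h hh l j hlj hj => by
      have : (0:ℝ) ≤ j * h := by positivity
      linarith⟩
  obtain ⟨R, hR0, hR⟩ := xs_bd D T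
  have hk := kap0 (D := D)
  have hC := Ch_pos (D := D) T
  refine ⟨√D.c * D.Ch T * ‖D.iL‖ + D.Ch T * ‖D.wL‖ + T * (D.Ch T * ((3 * D.K + D.c) * (1 + R))),
    by positivity, fun h hh l j hlj hj => ?_⟩
  have hlj' : (l:ℝ) ≤ j := by exact_mod_cast hlj
  have hd : (l:ℝ) * h ≤ j * h := by gcongr
  rw [xs_eq, xs_eq]
  refine (PK_contr _ _).trans ?_
  rw [zs_eq hh.le (le_refl j), zs_eq hh.le hlj]
  have e : D.Ch (j * h) • D.iL + D.Sp (j * h) • D.wL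
    - ∑ i ∈ Finset.range j, (h * D.Sp (j * h - i * h)) • D.Fm (xs D h i) - 
    (D.Ch (l * h) • D.iL + D.Sp (l * h) • D.wL
    - ∑ i ∈ Finset.range j, (h * D.Sp (l * h - i * h)) • D.Fm (xs D h i)) =
    (D.Ch (j * h) - D.Ch (l * h)) • D.iL + (D.Sp (j * h) - D.Sp (l * h)) • D.wL -
    ∑ i ∈ Finset.range j, (h * (D.Sp (j * h - i * h) - D.Sp (l * h - i * h))) • D.Fm (xs D h i) := by
    simp only [mul_sub, sub_smul, Finset.sum_sub_distrib]
    abel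
  rw [e]
  have s1 : ‖∑ i ∈ Finset.range j, (h * (D.Sp (j * h - i * h) - D.Sp (l * h - i * h))) • D.Fm (xs D h i)‖ ≤
      ∑ i ∈ Finset.range j, (h * (D.Ch T * (j * h - l * h)) * ((3 * D.K + D.c) * (1 + R))) := by
    refine norm_sum_le_of_le _ fun i hi => ?_
    have hij : i < j := Finset.mem_range.1 hi
    have hij' : (i:ℝ) ≤ j := by exact_mod_cast hij.le
    have hi0 : (0:ℝ) ≤ i * h := by positivity
    have hiT : (i:ℝ) * h ≤ T := le_trans (by gcongr) hj
    have h3 : 0 ≤ D.Sp (j * h - i * h) - D.Sp (l * h - i * h) := sub_nonneg.2 (Sp_mono (by linarith))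
    rw [norm_smul, Real.norm_eq_abs, abs_of_nonneg (by positivity)]
    gcongr
    · have := Sp_lip (D := D) (a := l * h - i * h) (b := j * h - i * h) (T := T) (by linarith) (by linarith)
      linarith
    · exact (Fm_norm _).trans (by gcongr; exact hR h hh i hiT)
  rw [Finset.sum_const, Finset.card_range, nsmul_eq_mul] at s1
  have l0 : (0:ℝ) ≤ l * h := by positivity
  have a1 := Ch_lip (D := D) l0 hd hj
  have a2 := Sp_lip (D := D) hd hj
  have a3 : 0 ≤ D.Sp (j * h) - D.Sp (l * h) := sub_nonneg.2 (Sp_mono hd)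
  calc _ ≤ √D.c * D.Ch T * (j * h - l * h) * ‖D.iL‖ + D.Ch T * (j * h - l * h) * ‖D.wL‖ +
      j * (h * (D.Ch T * (j * h - l * h)) * ((3 * D.K + D.c) * (1 + R))) := by
        refine (norm_sub_le _ _).trans (add_le_add ((norm_add_le _ _).trans ?_) s1)
        rw [norm_smul, norm_smul, Real.norm_eq_abs, Real.norm_eq_abs, abs_of_nonneg a3]
        gcongr
    _ = (j * h - l * h) * (√D.c * D.Ch T * ‖D.iL‖ + D.Ch T * ‖D.wL‖ + (j * h) * (D.Ch T * ((3 * D.K + D.c) * (1 + R)))) := by ring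
    _ ≤ (j * h - l * h) * (√D.c * D.Ch T * ‖D.iL‖ + D.Ch T * ‖D.wL‖ + T * (D.Ch T * ((3 * D.K + D.c) * (1 + R)))) := by
        have : 0 ≤ j * h - l * h := by linarith
        gcongr
    _ = _ := by ring

lemma zs_coe {h : ℝ} (hh : 0 ≤ h) {j N : ℕ} (hjN : j ≤ N) : D.zs h j =ᵐ[D.ρ] fun y =>
  D.Ch (j * h) * y + D.Sp (j * h) * D.v y
    - ∑ i ∈ Finset.range N, (h * D.Sp (j * h - i * h)) * D.Fm (xs D h i) y := by
  rw [zs_eq hh hjN]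
  have hs : ∀ i : ℕ, ((h * D.Sp (j * h - i * h)) • D.Fm (xs D h i) : Lp ℝ 2 D.ρ) =ᵐ[D.ρ]
      fun y => (h * D.Sp (j * h - i * h)) * D.Fm (xs D h i) y := fun i =>
    Lp.coeFn_smul _ _
  have hsum := Lp.coeFn_finsetSum (p := 2) (μ := D.ρ) (Finset.range N) (fun i => (h * D.Sp (j * h - i * h)) • D.Fm (xs D h i))
  filter_upwards [Lp.coeFn_sub (D.Ch (j * h) • D.iL + D.Sp (j * h) • D.wL) (∑ i ∈ Finset.range N, (h * D.Sp (j * h - i * h)) • D.Fm (xs D h i)),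
    Lp.coeFn_add (D.Ch (j * h) • D.iL) (D.Sp (j * h) • D.wL), Lp.coeFn_smul (D.Ch (j * h)) D.iL,
    Lp.coeFn_smul (D.Sp (j * h)) D.wL, hsum, D.idL.coeFn_toLp, D.vL.coeFn_toLp, ae_all_iff.2 hs] with y h1 h2 h3 h4 h5 h6 h7 h8
  rw [h1, Pi.sub_apply, h2, Pi.add_apply, h3, h4, h5, Finset.sum_apply]
  simp only [Pi.smul_apply, smul_eq_mul, iL, wL, h6, h7]
  congr 1
  exact Finset.sum_congr rfl fun i _ => h8 i

lemma xs_mem (h : ℝ) (j : ℕ) : D.xs h j ∈ KK D.ρ := by rw [xs_eq]; exact PK_mem _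

/-- total variation of v -/
def tv (D : Dat) (y : ℝ) : ℝ := ∫ x in (0:ℝ)..y, |D.v' x|

lemma v'int (a b : ℝ) : IntervalIntegrable D.v' volume a b :=
  (D.v'loc.integrableOn_isCompact isCompact_uIcc).intervalIntegrable

lemma tv_sub (a b : ℝ) : D.tv b - D.tv a = ∫ x in a..b, |D.v' x| :=
  intervalIntegral.integral_interval_sub_left (v'int _ _).abs (v'int _ _).abs

lemma tv_mono : Monotone D.tv := by
  intro a b hab
  rw [← sub_nonneg, tv_sub]
  exact intervalIntegral.integral_nonneg hab fun _ _ => abs_nonneg _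

lemma tv_sub_v : Monotone (fun y => D.tv y - D.v y) := by
  intro a b hab
  have h1 := tv_sub (D := D) a b
  have h2 := D.hv a b
  have h3 : D.v b - D.v a ≤ D.tv b - D.tv a := by
    rw [h1, h2]
    exact intervalIntegral.integral_mono_on hab (v'int _ _) (v'int _ _).abs fun x _ => le_abs_self _
  simp only; linarith

lemma xs_ii {h : ℝ} (hh : 0 < h) (j : ℕ) :
    AEMono D.ρ (fun y => (D.Ch (j * h) * y + D.Sp (j * h) * D.tv y) - D.xs h j y) := by
  rw [xs_eq]
  refine PK_comp_mono _ ?_ ?_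
  · intro a b hab
    have := tv_mono (D := D) hab
    have h1 := Ch_pos (D := D) (j * h)
    have h2 := Sp_nonneg (D := D) (j * h)
    simp only
    gcongr
  · have h1 : AEMono D.ρ (fun y => D.Sp (j * h) * (D.tv y - D.v y) +
      ∑ i ∈ Finset.range j, (h * D.Sp (j * h - i * h)) * D.Fm (xs D h i) y) :=
      ((tv_sub_v (D := D)).aeMono.const_mul (Sp_nonneg _)).add (AEMono.sum _ fun i _ =>
        AEMono.const_mul (Fm_mem (xs_mem h i)) (mul_nonneg hh.le (Sp_nonneg _)))
    refine h1.congr ?_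
    filter_upwards [zs_coe hh.le (le_refl j)] with y hy
    rw [hy]; ring

lemma xs_iii {h : ℝ} (hh : 0 < h) {l j : ℕ} (hl : 0 < l) (hlj : l ≤ j) :
    AEMono D.ρ (fun y => D.Sp (j * h) * D.xs h l y - D.Sp (l * h) * D.xs h j y) := by
  have hl' : (0:ℝ) < l * h := by positivity
  have hj' : (l:ℝ) * h ≤ j * h := by gcongr
  rw [xs_eq, xs_eq]
  refine PK_comp _ _ (Sp_pos (by linarith)) (Sp_pos hl') ?_
  have h1 : AEMono D.ρ (fun y => (D.Sp (j * h) * D.Ch (l * h) - D.Sp (l * h) * D.Ch (j * h)) * y +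
      ∑ i ∈ Finset.range j, (h * (D.Sp (l * h) * D.Sp (j * h - i * h) - D.Sp (j * h) * D.Sp (l * h - i * h)))
        * D.Fm (xs D h i) y) := by
    refine (AEMono.const_mul (monotone_id.aeMono) (SC_ineq hj' hl'.le)).add (AEMono.sum _ fun i _ =>
        AEMono.const_mul (Fm_mem (xs_mem h i)) (mul_nonneg hh.le (sub_nonneg.2 ?_)))
    exact Sp_ineq (by positivity) hj' hl'.le
  refine h1.congr ?_
  filter_upwards [zs_coe hh.le (le_refl j), zs_coe hh.le hlj] with y hy hy'
  rw [hy, hy']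
  have e : ∑ i ∈ Finset.range j, (h * (D.Sp (l * h) * D.Sp (j * h - i * h) - D.Sp (j * h) * D.Sp (l * h - i * h)))
        * D.Fm (xs D h i) y = D.Sp (l * h) * (∑ i ∈ Finset.range j, (h * D.Sp (j * h - i * h)) * D.Fm (xs D h i) y)
        - D.Sp (j * h) * (∑ i ∈ Finset.range j, (h * D.Sp (l * h - i * h)) * D.Fm (xs D h i) y) := by
    rw [Finset.mul_sum, Finset.mul_sum, ← Finset.sum_sub_distrib]
    exact Finset.sum_congr rfl fun i _ => by ring
  rw [e]
  ring

end Dat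

namespace Dat
variable {D : Dat}

/-- time step -/
def hh (n : ℕ) : ℝ := 1 / ((n:ℝ) + 1)
lemma hh_pos (n : ℕ) : 0 < hh n := by unfold hh; positivity
lemma hh_tendsto : Tendsto hh atTop (𝓝 0) := tendsto_one_div_add_atTop_nhds_zero_nat

/-- dominating monotone map -/
def om (D : Dat) (t y : ℝ) : ℝ := D.Ch t * y + D.Sp t * D.tv y

/-- a good full measure set -/
structure GoodSet (D : Dat) (A : Set ℝ) : Prop where
  meas : MeasurableSet A
  ae : ∀ᵐ y ∂D.ρ, y ∈ A
  supp : ∀ y ∈ A, ∀ δ > 0, 0 < D.ρ (Ioo (y - δ) (y + δ))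
  mono : ∀ n j, MonotoneOn (D.xs (hh n) j) A
  ii : ∀ n (j : ℕ), MonotoneOn (fun y => D.om (j * hh n) y - D.xs (hh n) j y) A
  iii : ∀ n (l j : ℕ), 0 < l → l ≤ j → MonotoneOn
    (fun y => D.Sp (j * hh n) * D.xs (hh n) l y - D.Sp (l * hh n) * D.xs (hh n) j y) A
  zf : ∀ n (j : ℕ), ∀ y ∈ A, D.zs (hh n) j y = D.Ch (j * hh n) * y + D.Sp (j * hh n) * D.v y
    - ∑ i ∈ Finset.range j, (hh n * D.Sp (j * hh n - i * hh n)) *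
      (D.ff (xs D (hh n) i) y + D.c * xs D (hh n) i y)
  init : ∀ n, ∀ y ∈ A, D.xs (hh n) 0 y = y

lemma xs_zero (h : ℝ) : D.xs h 0 = D.iL := by
  rw [xs_eq, zs]
  have : D.Ch 0 = 1 := by simp [Ch]
  simp [this, Sp_of_nonpos (le_refl (0:ℝ))]
  refine PK_self ?_
  exact AEMono.congr monotone_id.aeMono D.idL.coeFn_toLp.symm

lemma exists_good (D : Dat) : ∃ A, GoodSet D A := by
  have h1 : ∀ n j, ∃ A : Set ℝ, (∀ᵐ y ∂D.ρ, y ∈ A) ∧ MonotoneOn (D.xs (hh n) j) A :=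
    fun n j => xs_mem (hh n) j
  have h2 : ∀ n (j : ℕ), ∃ A : Set ℝ, (∀ᵐ y ∂D.ρ, y ∈ A) ∧
      MonotoneOn (fun y => D.om (j * hh n) y - D.xs (hh n) j y) A :=
    fun n j => xs_ii (hh_pos n) j
  have h3 : ∀ n (l j : ℕ), ∃ A : Set ℝ, (∀ᵐ y ∂D.ρ, y ∈ A) ∧ (0 < l → l ≤ j → MonotoneOn
    (fun y => D.Sp (j * hh n) * D.xs (hh n) l y - D.Sp (l * hh n) * D.xs (hh n) j y) A) := by
    intro n l j
    by_cases h : 0 < l ∧ l ≤ j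
    · obtain ⟨A, hA, hm⟩ := xs_iii (D := D) (hh_pos n) h.1 h.2
      exact ⟨A, hA, fun _ _ => hm⟩
    · exact ⟨univ, by simp, fun a b => absurd ⟨a, b⟩ h⟩
  choose A1 a1 m1 using h1
  choose A2 a2 m2 using h2
  choose A3 a3 m3 using h3
  have h4 : ∀ n (j : ℕ), ∀ᵐ y ∂D.ρ, D.zs (hh n) j y = D.Ch (j * hh n) * y + D.Sp (j * hh n) * D.v y
    - ∑ i ∈ Finset.range j, (hh n * D.Sp (j * hh n - i * hh n)) *
      (D.ff (xs D (hh n) i) y + D.c * xs D (hh n) i y) := by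
    intro n j
    filter_upwards [zs_coe (D := D) (hh_pos n).le (le_refl j),
      ae_all_iff.2 fun i => Fm_coe (D.xs (hh n) i)] with y e1 e2
    rw [e1]
    simp only [e2]
  have h5 : ∀ᵐ y ∂D.ρ, ∀ n, D.xs (hh n) 0 y = y := by
    filter_upwards [D.idL.coeFn_toLp] with y hy n
    rw [xs_zero, iL, hy]
  have h6 : ∀ᵐ y ∂D.ρ, ∀ δ > 0, 0 < D.ρ (Ioo (y - δ) (y + δ)) := by
    filter_upwards [Measure.support_mem_ae (μ := D.ρ)] with y hy δ hδ
    rw [Measure.mem_support_iff_forall] at hy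
    exact hy _ (Ioo_mem_nhds (by linarith) (by linarith))
  have hall : ∀ᵐ y ∂D.ρ, (∀ n j, y ∈ A1 n j) ∧ (∀ n j, y ∈ A2 n j) ∧ (∀ n l j, y ∈ A3 n l j) ∧
    (∀ n (j : ℕ), D.zs (hh n) j y = D.Ch (j * hh n) * y + D.Sp (j * hh n) * D.v y
    - ∑ i ∈ Finset.range j, (hh n * D.Sp (j * hh n - i * hh n)) *
      (D.ff (xs D (hh n) i) y + D.c * xs D (hh n) i y)) ∧ (∀ n, D.xs (hh n) 0 y = y) ∧
      ∀ δ > 0, 0 < D.ρ (Ioo (y - δ) (y + δ)) := by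
    filter_upwards [ae_all_iff.2 fun n => ae_all_iff.2 fun j => a1 n j,
      ae_all_iff.2 fun n => ae_all_iff.2 fun j => a2 n j,
      ae_all_iff.2 fun n => ae_all_iff.2 fun l => ae_all_iff.2 fun j => a3 n l j,
      ae_all_iff.2 fun n => ae_all_iff.2 fun j => h4 n j, h5, h6] with y b1 b2 b3 b4 b5 b6
      using ⟨b1, b2, b3, b4, b5, b6⟩
  obtain ⟨N, hN, hNm, hN0⟩ := exists_measurable_superset_of_null (mem_ae_iff.1 hall)
  have sub : ∀ y ∈ Nᶜ, _ := fun y hy => by_contra (fun h => hy (hN h))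
  exact ⟨Nᶜ, hNm.compl, measure_eq_zero_iff_ae_notMem.1 hN0,
    fun y hy => (sub y hy).2.2.2.2.2,
    fun n j => (m1 n j).mono fun y hy => (sub y hy).1 n j,
    fun n j => (m2 n j).mono fun y hy => (sub y hy).2.1 n j,
    fun n l j h h' => (m3 n l j h h').mono fun y hy => (sub y hy).2.2.1 n l j,
    fun n j y hy => (sub y hy).2.2.2.1 n j, fun n y hy => (sub y hy).2.2.2.2.1 n⟩

lemma tv_cont : Continuous D.tv :=
  intervalIntegral.continuous_primitive (fun a b => (v'int a b).abs) 0

lemma om_cont (t : ℝ) : Continuous (D.om t) := by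
  unfold om
  exact (continuous_const.mul continuous_id).add (continuous_const.mul tv_cont)

lemma om_mono (t : ℝ) : Monotone (D.om t) := by
  intro a b hab
  have := tv_mono (D := D) hab
  have h1 := Ch_pos (D := D) t
  have h2 := Sp_nonneg (D := D) t
  unfold om
  gcongr

lemma om_incr {s t a b : ℝ} (hs : 0 ≤ s) (hst : s ≤ t) (hab : a ≤ b) :
    D.om s b - D.om s a ≤ D.om t b - D.om t a := by
  have h1 := tv_mono (D := D) hab
  have h2 := Ch_mono (D := D) hs hst
  have h3 := Sp_mono (D := D) hst
  unfold om
  nlinarith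

/-- point estimate -/
lemma point_est {A : Set ℝ} (hA : ∀ᵐ y ∂D.ρ, y ∈ A) {y δ η R : ℝ} (f : Lp ℝ 2 D.ρ) {p : ℝ}
    (hpos : 0 < D.ρ (Ioo (y - δ) (y + δ))) (hf : ‖f‖ ≤ R)
    (hη : ∀ z ∈ A, z ∈ Ioo (y - δ) (y + δ) → |p| - η ≤ |f z|) :
    |p| ≤ R / D.ρ.real (Ioo (y - δ) (y + δ)) + η := by
  have hpos' : 0 < D.ρ.real (Ioo (y - δ) (y + δ)) := by
    rw [measureReal_def]; exact ENNReal.toReal_pos hpos.ne' (measure_ne_top _ _)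
  have hR : ∫ z, |f z| ∂D.ρ ≤ R := by
    have := L1_le (Lp.memLp f)
    rw [Lp.toLp_coeFn] at this
    exact this.trans hf
  have h1 : D.ρ.real (Ioo (y - δ) (y + δ)) * (|p| - η) ≤ ∫ z, |f z| ∂D.ρ := by
    calc _ = ∫ z in Ioo (y - δ) (y + δ), (|p| - η) ∂D.ρ := by
          rw [setIntegral_const, smul_eq_mul]
      _ ≤ ∫ z in Ioo (y - δ) (y + δ), |f z| ∂D.ρ := by
          refine setIntegral_mono_on_ae (integrable_const _).integrableOn (Lp_int f).abs.integrableOn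
            measurableSet_Ioo ?_
          filter_upwards [hA] with z hz hz2 using hη z hz hz2
      _ ≤ _ := setIntegral_le_integral (Lp_int f).abs (Eventually.of_forall fun z => abs_nonneg _)
  have : |p| - η ≤ R / D.ρ.real (Ioo (y - δ) (y + δ)) := by
    rw [le_div_iff₀ hpos', mul_comm]; linarith
  linarith

lemma xs_osc {A : Set ℝ} (hA : GoodSet D A) {n j : ℕ} {T : ℝ} (hj : j * hh n ≤ T) {y δ : ℝ}
    (hy : y ∈ A) {z} (hz : z ∈ A) (hzy : z ∈ Ioo (y - δ) (y + δ)) :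
    |D.xs (hh n) j y - D.xs (hh n) j z| ≤ D.om T (y + δ) - D.om T (y - δ) := by
  have hj0 : 0 ≤ j * hh n := mul_nonneg (Nat.cast_nonneg _) (hh_pos n).le
  have b1 := om_mono (D := D) T hzy.1.le
  have b2 := om_mono (D := D) T hzy.2.le
  have b3 := om_mono (D := D) T (show y - δ ≤ y by linarith [hzy.1, hzy.2])
  have b4 := om_mono (D := D) T (show y ≤ y + δ by linarith [hzy.1, hzy.2])
  rcases le_total y z with h | h
  · have h1 := hA.mono n j hy hz h
    have h2 := hA.ii n j hy hz h
    have h3 := om_incr (D := D) hj0 hj h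
    rw [abs_le]; simp only at h2; constructor <;> linarith
  · have h1 := hA.mono n j hz hy h
    have h2 := hA.ii n j hz hy h
    have h3 := om_incr (D := D) hj0 hj h
    rw [abs_le]; simp only at h2; constructor <;> linarith

/-- discrete flow in continuous time -/
def Xn (D : Dat) (n : ℕ) (t : ℝ) : Lp ℝ 2 D.ρ := D.xs (hh n) ⌊t / hh n⌋₊

lemma fl_le {n : ℕ} {t : ℝ} (ht : 0 ≤ t) : (⌊t / hh n⌋₊ : ℝ) * hh n ≤ t := by
  have := Nat.floor_le (div_nonneg ht (hh_pos n).le)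
  rwa [le_div_iff₀ (hh_pos n)] at this

lemma le_fl (n : ℕ) (t : ℝ) : t ≤ (⌊t / hh n⌋₊ : ℝ) * hh n + hh n := by
  have := (Nat.lt_floor_add_one (t / hh n)).le
  rw [div_le_iff₀ (hh_pos n)] at this
  linarith

lemma Xn_bd (D : Dat) (T : ℝ) : ∃ R, 0 ≤ R ∧ ∀ n t, 0 ≤ t → t ≤ T → ‖D.Xn n t‖ ≤ R := by
  obtain ⟨R, h0, h⟩ := xs_bd D T
  exact ⟨R, h0, fun n t ht htT => h _ (hh_pos n) _ ((fl_le ht).trans htT)⟩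

lemma Xn_lip (D : Dat) (T : ℝ) : ∃ L, 0 ≤ L ∧ ∀ n s t, 0 ≤ s → s ≤ T → 0 ≤ t → t ≤ T →
    ‖D.Xn n t - D.Xn n s‖ ≤ L * (|t - s| + hh n) := by
  obtain ⟨L, h0, h⟩ := xs_lip D T
  have key : ∀ n s t, 0 ≤ s → s ≤ t → t ≤ T → ‖D.Xn n t - D.Xn n s‖ ≤ L * (|t - s| + hh n) := by
    intro n s t hs hst ht
    refine (h _ (hh_pos n) _ _ (Nat.floor_mono ?_) ((fl_le (hs.trans hst)).trans ht)).trans ?_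
    · have := hh_pos n; gcongr
    · have := fl_le (n := n) (hs.trans hst)
      have := le_fl n s
      gcongr
      rw [abs_of_nonneg (by linarith)]
      linarith
  refine ⟨L, h0, fun n s t hs hsT ht htT => ?_⟩
  rcases le_total s t with h | h
  · exact key n s t hs h htT
  · rw [norm_sub_rev, abs_sub_comm]; exact key n t s ht h hsT

lemma Xn_meas (n : ℕ) : Measurable (fun p : ℝ × ℝ => D.Xn n p.1 p.2) := by
  have h1 : Measurable (fun p : ℕ × ℝ => D.xs (hh n) p.1 p.2) :=
    measurable_from_prod_countable_right fun j => (Lp.stronglyMeasurable (D.xs (hh n) j)).measurable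
  have h2 : Measurable (fun p : ℝ × ℝ => ((⌊p.1 / hh n⌋₊ : ℕ), p.2)) :=
    (Nat.measurable_floor.comp (measurable_fst.div_const _)).prodMk measurable_snd
  exact h1.comp h2

lemma Xn_ptbd {A : Set ℝ} (hA : GoodSet D A) {y : ℝ} (hy : y ∈ A) (T : ℝ) :
    ∃ R, ∀ n t, 0 ≤ t → t ≤ T → |D.Xn n t y| ≤ R := by
  obtain ⟨R, h0, h⟩ := Xn_bd D T
  refine ⟨_, fun n t ht htT => point_est hA.ae (D.Xn n t) (hA.supp y hy 1 one_pos) (h n t ht htT)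
    (η := D.om T (y + 1) - D.om T (y - 1)) fun z hz hz1 => ?_⟩
  have := xs_osc hA ((fl_le (n := n) ht).trans htT) hy hz hz1
  have h2 := abs_sub_abs_le_abs_sub (D.Xn n t y) (D.Xn n t z)
  rw [Xn] at *
  linarith

lemma Xn_ptlip {A : Set ℝ} (hA : GoodSet D A) {y : ℝ} (hy : y ∈ A) (T : ℝ) :
    ∃ L, 0 ≤ L ∧ ∀ δ > 0, ∀ n s t, 0 ≤ s → s ≤ T → 0 ≤ t → t ≤ T → |D.Xn n t y - D.Xn n s y| ≤
      L * (|t - s| + hh n) / D.ρ.real (Ioo (y - δ) (y + δ)) + 2 * (D.om T (y + δ) - D.om T (y - δ)) := by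
  obtain ⟨L, h0, h⟩ := Xn_lip D T
  refine ⟨L, h0, fun δ hδ n s t hs hsT ht htT => ?_⟩
  have hco := Lp.coeFn_sub (D.Xn n t) (D.Xn n s)
  have hA' : ∀ᵐ z ∂D.ρ, z ∈ {z | z ∈ A ∧ (D.Xn n t - D.Xn n s : Lp ℝ 2 D.ρ) z = D.Xn n t z - D.Xn n s z} := by
    filter_upwards [hA.ae, hco] with z h1 h2 using ⟨h1, h2⟩
  refine point_est hA' (D.Xn n t - D.Xn n s) (hA.supp y hy δ hδ) (h n s t hs hsT ht htT) fun z hz hz1 => ?_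
  have h1 := xs_osc hA ((fl_le (n := n) ht).trans htT) hy hz.1 hz1
  have h3 := xs_osc hA ((fl_le (n := n) hs).trans hsT) hy hz.1 hz1
  rw [hz.2]
  rw [abs_le] at h1 h3
  rw [sub_le_iff_le_add, abs_le]
  have h4 := le_abs_self (D.Xn n t z - D.Xn n s z)
  have h5 := neg_abs_le (D.Xn n t z - D.Xn n s z)
  rw [Xn, Xn] at *
  constructor <;> linarith

end Dat

namespace Dat
variable {D : Dat}

lemma osc_small (T y : ℝ) {ε : ℝ} (hε : 0 < ε) :
    ∃ δ > 0, D.om T (y + δ) - D.om T (y - δ) < ε := by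
  have h : Tendsto (fun δ => D.om T (y + δ) - D.om T (y - δ)) (𝓝[>] 0) (𝓝 0) := by
    have h1 : Continuous (fun δ => D.om T (y + δ) - D.om T (y - δ)) :=
      ((om_cont T).comp (continuous_const.add continuous_id)).sub
        ((om_cont T).comp (continuous_const.sub continuous_id))
    have := h1.tendsto 0
    simp only [add_zero, sub_zero, sub_self] at this
    exact this.mono_left nhdsWithin_le_nhds
  obtain ⟨δ, h1, h2⟩ := ((h.eventually_lt_const hε).and self_mem_nhdsWithin).exists
  exact ⟨δ, h2, h1⟩

lemma exists_subseq {A : Set ℝ} (hA : GoodSet D A) : ∃ Q : Set ℝ, Q ⊆ A ∧ A ⊆ closure Q ∧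
    ∃ σ : ℕ → ℕ, StrictMono σ ∧ ∀ q : ℚ, 0 ≤ q → ∀ y ∈ Q, ∃ l,
      Tendsto (fun n => D.Xn (σ n) q y) atTop (𝓝 l) := by
  obtain ⟨Q, hQA, hQc, hQd⟩ := (TopologicalSpace.IsSeparable.of_separableSpace A).exists_countable_dense_subset
  refine ⟨Q, hQA, hQd, ?_⟩
  have := hQc.to_subtype
  have hR : ∀ p : ℚ × Q, ∃ R, ∀ n, |D.Xn n (max (p.1:ℝ) 0) p.2| ≤ R := by
    intro p
    obtain ⟨R, hR⟩ := Xn_ptbd hA (hQA p.2.2) (max (p.1:ℝ) 0)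
    exact ⟨R, fun n => hR n _ (le_max_right _ _) le_rfl⟩
  choose R hR using hR
  have hc : IsCompact (Set.pi univ fun p : ℚ × Q => Icc (-(R p)) (R p)) :=
    isCompact_univ_pi fun p => isCompact_Icc
  obtain ⟨l, -, σ, hσ, hl⟩ := hc.tendsto_subseq (x := fun n => fun p : ℚ × Q => D.Xn n (max (p.1:ℝ) 0) p.2)
    (fun n p _ => abs_le.1 (hR p n))
  refine ⟨σ, hσ, fun q hq y hy => ⟨l (q, ⟨y, hy⟩), ?_⟩⟩
  have := (tendsto_pi_nhds.1 hl) (q, ⟨y, hy⟩)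
  simpa [Function.comp_def, max_eq_left (show (0:ℝ) ≤ q by exact_mod_cast hq)] using this

lemma exists_limit {A : Set ℝ} (hA : GoodSet D A) : ∃ σ : ℕ → ℕ, StrictMono σ ∧ ∃ X : ℝ → ℝ → ℝ,
    Measurable (fun p : ℝ × ℝ => X p.1 p.2) ∧
    (∀ t, 0 ≤ t → ∀ y ∈ A, Tendsto (fun n => D.Xn (σ n) t y) atTop (𝓝 (X t y))) := by
  obtain ⟨Q, hQA, hQd, σ, hσ, hlim⟩ := exists_subseq hA
  have hhσ : Tendsto (fun n => hh (σ n)) atTop (𝓝 0) := hh_tendsto.comp hσ.tendsto_atTop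
  have hcau : ∀ t, 0 ≤ t → ∀ y ∈ A, ∃ x, Tendsto (fun n => D.Xn (σ n) t y) atTop (𝓝 x) := by
    intro t ht y hy
    apply cauchySeq_tendsto_of_complete
    rw [Metric.cauchySeq_iff']
    intro ε hε
    obtain ⟨δ, hδ, hosc⟩ := osc_small (D := D) (t + 1) y (ε := ε / 20) (by positivity)
    obtain ⟨L, hL0, hL⟩ := Xn_ptlip hA hy (t + 1)
    obtain ⟨z, hz1, hzQ⟩ : ∃ z, z ∈ Ioo (y - δ) (y + δ) ∧ z ∈ Q :=
      mem_closure_iff_nhds.1 (hQd hy) _ (Ioo_mem_nhds (by linarith) (by linarith))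
    set m := D.ρ.real (Ioo (y - δ) (y + δ)) with hm
    have hm0 : 0 < m := by
      rw [hm, measureReal_def]; exact ENNReal.toReal_pos (hA.supp y hy δ hδ).ne' (measure_ne_top _ _)
    set κ := min 1 (ε * m / (20 * (L + 1))) with hκ
    have hκ0 : 0 < κ := by positivity
    obtain ⟨q, hq1, hq2⟩ := exists_rat_btwn (show t < t + κ by linarith)
    have hκ1 : κ ≤ 1 := min_le_left _ _
    have hκ2 : L * κ / m ≤ ε / 20 := by
      have : κ ≤ ε * m / (20 * (L + 1)) := min_le_right _ _
      rw [le_div_iff₀ (by positivity)] at this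
      rw [div_le_div_iff₀ hm0 (by norm_num)]
      nlinarith
    have hq0 : (0:ℝ) ≤ q := by linarith
    obtain ⟨l, hl⟩ := hlim q (by exact_mod_cast hq0) z hzQ
    have hev : ∀ᶠ n in atTop, |D.Xn (σ n) t y - l| < ε / 2 := by
      filter_upwards [hhσ.eventually_lt_const hκ0, (Metric.tendsto_nhds.1 hl) (ε / 20) (by positivity)] with n hn1 hn2
      rw [Real.dist_eq] at hn2
      have e1 := hL δ hδ (σ n) q t hq0 (by linarith) ht (by linarith)
      have e2 := xs_osc hA ((fl_le (n := σ n) hq0).trans (show (q:ℝ) ≤ t + 1 by linarith)) hy (hQA hzQ) hz1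
      have e3 : L * (|t - q| + hh (σ n)) / m ≤ 2 * (ε / 20) := by
        have : |t - q| ≤ κ := by rw [abs_sub_comm, abs_of_nonneg] <;> linarith
        calc _ ≤ L * (κ + κ) / m := by gcongr
          _ = 2 * (L * κ / m) := by ring
          _ ≤ _ := by gcongr
      change |D.Xn (σ n) q y - D.Xn (σ n) q z| ≤ _ at e2
      rw [abs_lt] at *
      rw [abs_le] at *
      constructor <;> linarith
    obtain ⟨N, hN⟩ := eventually_atTop.1 hev
    refine ⟨N, fun n hn => ?_⟩
    have a1 := hN n hn
    have a2 := hN N le_rfl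
    rw [Real.dist_eq]
    rw [abs_lt] at *
    constructor <;> linarith
  have hall : ∀ t y, ∃ x, Tendsto (fun n => A.indicator (D.Xn (σ n) (max t 0)) y) atTop (𝓝 x) := by
    intro t y
    by_cases hy : y ∈ A
    · simpa [indicator_of_mem hy] using hcau (max t 0) (le_max_right _ _) y hy
    · exact ⟨0, by simp [indicator_of_notMem hy]⟩
  choose X hX using hall
  refine ⟨σ, hσ, X, ?_, ?_⟩
  · have hT : Tendsto (fun n (p : ℝ × ℝ) => A.indicator (D.Xn (σ n) (max p.1 0)) p.2) atTop
        (𝓝 (fun p : ℝ × ℝ => X p.1 p.2)) := by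
      rw [tendsto_pi_nhds]
      exact fun p => hX p.1 p.2
    refine measurable_of_tendsto_metrizable (fun n => ?_) hT
    have h1 : Measurable (fun p : ℝ × ℝ => D.Xn (σ n) (max p.1 0) p.2) :=
      (Xn_meas (σ n)).comp ((measurable_fst.max measurable_const).prodMk measurable_snd)
    have h2 : (fun p : ℝ × ℝ => A.indicator (D.Xn (σ n) (max p.1 0)) p.2) =
        (Prod.snd ⁻¹' A).indicator (fun p : ℝ × ℝ => D.Xn (σ n) (max p.1 0) p.2) := by
      ext p; rfl
    rw [h2]
    exact h1.indicator (measurable_snd hA.meas)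
  · intro t ht y hy
    have := hX t y
    simpa [indicator_of_mem hy, max_eq_left ht] using this

end Dat

lemma fatou2 {ρ : Measure ℝ} {u : ℕ → ℝ → ℝ} (hu : ∀ n, MemLp (u n) 2 ρ) {M : ℕ → ℝ} {M0 : ℝ}
    (hM : ∀ n, ‖(hu n).toLp _‖ ≤ M n) (hM0 : Tendsto M atTop (𝓝 M0)) {w : ℝ → ℝ}
    (hw : ∀ᵐ x ∂ρ, Tendsto (fun n => u n x) atTop (𝓝 (w x))) :
    ∃ h : MemLp w 2 ρ, ‖h.toLp w‖ ≤ M0 := by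
  have hm : AEStronglyMeasurable w ρ :=
    aestronglyMeasurable_of_tendsto_ae atTop (fun n => (hu n).1) hw
  have h1 := Lp.eLpNorm_lim_le_liminf_eLpNorm (p := 2) (fun n => (hu n).1) w hw
  have h0 : 0 ≤ M0 := ge_of_tendsto' hM0 fun n => (norm_nonneg _).trans (hM n)
  have h2 : eLpNorm w 2 ρ ≤ ENNReal.ofReal M0 := by
    refine h1.trans ?_
    have h3 : Tendsto (fun n => ENNReal.ofReal (M n)) atTop (𝓝 (ENNReal.ofReal M0)) :=
      (ENNReal.continuous_ofReal.tendsto _).comp hM0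
    rw [← h3.liminf_eq]
    refine liminf_le_liminf (Eventually.of_forall fun n => ?_)
    have h4 := hM n
    rw [Lp.norm_toLp] at h4
    exact (ENNReal.le_ofReal_iff_toReal_le (hu n).2.ne ((ENNReal.toReal_nonneg).trans h4)).2 h4
  have hL : MemLp w 2 ρ := ⟨hm, h2.trans_lt ENNReal.ofReal_lt_top⟩
  refine ⟨hL, ?_⟩
  rw [Lp.norm_toLp]
  exact ENNReal.toReal_le_of_le_ofReal h0 h2

lemma LV1 {ρ : Measure ℝ} [IsProbabilityMeasure ρ] {u : ℕ → ℝ → ℝ} (hu : ∀ n, MemLp (u n) 2 ρ) {M : ℝ}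
    (hM : ∀ n, ‖(hu n).toLp _‖ ≤ M) {w : ℝ → ℝ}
    (hw : ∀ᵐ x ∂ρ, Tendsto (fun n => u n x) atTop (𝓝 (w x))) :
    Tendsto (fun n => ∫ x, u n x ∂ρ) atTop (𝓝 (∫ x, w x ∂ρ)) := by
  obtain ⟨hL, hn⟩ := fatou2 hu hM tendsto_const_nhds hw
  have hb : ∀ n, ∫ x, (u n x - w x) ^ 2 ∂ρ ≤ (M + M) ^ 2 := fun n => by
    have e := normsq_toLp ((hu n).sub hL)
    simp only [Pi.sub_apply] at e
    rw [← e, MemLp.toLp_sub (hu n) hL]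
    have h5 := norm_sub_le ((hu n).toLp _) (hL.toLp _)
    have h6 := hM n
    have h7 : ‖(hu n).toLp _ - hL.toLp _‖ ≤ M + M := by linarith
    gcongr
  have hL' : ∀ n, MemLp (fun x => u n x - w x) 2 ρ := fun n => (hu n).sub hL
  have h0 : ∀ᵐ x ∂ρ, Tendsto (fun n => u n x - w x) atTop (𝓝 0) := by
    filter_upwards [hw] with x hx
    have := hx.sub_const (w x)
    rwa [sub_self] at this
  have h1 := LV (ξ := fun _ => (1:ℝ)) hL' hb (memLp_const _) h0
  rw [tendsto_iff_norm_sub_tendsto_zero]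
  refine squeeze_zero (fun n => norm_nonneg _) (fun n => ?_) h1
  rw [← integral_sub ((hu n).integrable (by norm_num)) (hL.integrable (by norm_num))]
  refine (norm_integral_le_integral_norm _).trans (le_of_eq ?_)
  simp

lemma step_int {h : ℝ} (hh : 0 < h) (H : ℕ → ℝ) (j : ℕ) :
    IntervalIntegrable (fun τ => H ⌊τ / h⌋₊) volume 0 (j * h) ∧
    ∫ τ in (0:ℝ)..(j * h), H ⌊τ / h⌋₊ = ∑ i ∈ Finset.range j, h * H i := by
  induction j with
  | zero => simp
  | succ j ih =>
    have hle : (j:ℝ) * h ≤ (j + 1 : ℕ) * h := by push_cast; nlinarith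
    have hae : ∀ᵐ τ ∂(volume : Measure ℝ), τ ∈ Set.uIoc ((j:ℝ) * h) ((j + 1 : ℕ) * h) → H j = H ⌊τ / h⌋₊ := by
      have : ∀ᵐ τ ∂(volume : Measure ℝ), τ ≠ (j + 1 : ℕ) * h := by
        simp [ae_iff]
      filter_upwards [this] with τ h1 h2
      rw [uIoc_of_le hle] at h2
      congr 1
      symm
      rw [Nat.floor_eq_iff (div_nonneg (le_trans (by positivity) h2.1.le) hh.le)]
      rw [le_div_iff₀ hh, div_lt_iff₀ hh]
      refine ⟨h2.1.le, ?_⟩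
      have := lt_of_le_of_ne h2.2 h1
      push_cast at this
      exact this
    have i2 : IntervalIntegrable (fun τ => H ⌊τ / h⌋₊) volume (j * h) ((j + 1 : ℕ) * h) := by
      refine (intervalIntegrable_const (c := H j)).congr_ae ?_
      rw [EventuallyEq, ae_restrict_iff' measurableSet_uIoc]
      exact hae
    refine ⟨ih.1.trans i2, ?_⟩
    rw [← intervalIntegral.integral_add_adjacent_intervals ih.1 i2, ih.2, Finset.sum_range_succ,
      ← intervalIntegral.integral_congr_ae hae]
    simp
    left; ring

namespace Dat
variable {D : Dat}

lemma zs_bd (D : Dat) (T : ℝ) : ∃ R, 0 ≤ R ∧ ∀ h, 0 < h → ∀ j : ℕ, j * h ≤ T → ‖D.zs h j‖ ≤ R := by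
  rcases lt_or_ge T 0 with hT | hT
  · exact ⟨0, le_rfl, fun h hh j hj => by
      have : (0:ℝ) ≤ j * h := by positivity
      linarith⟩
  obtain ⟨R, hR0, hR⟩ := xs_bd D T
  have hk := kap0 (D := D)
  have hS := Sp_nonneg (D := D) T
  have hC := Ch_pos (D := D) T
  refine ⟨D.Ch T * ‖D.iL‖ + D.Sp T * ‖D.wL‖ + T * (D.Sp T * ((3 * D.K + D.c) * (1 + R))), by positivity,
    fun h hh j hj => ?_⟩
  have hj0 : (0:ℝ) ≤ j * h := by positivity
  have s1 : ‖∑ i ∈ Finset.range j, (h * D.Sp (j * h - i * h)) • D.Fm (xs D h i)‖ ≤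
      ∑ i ∈ Finset.range j, (h * D.Sp T) * ((3 * D.K + D.c) * (1 + R)) := by
    refine norm_sum_le_of_le _ fun i hi => ?_
    have hij : i < j := Finset.mem_range.1 hi
    have hij' : (i:ℝ) ≤ j := by exact_mod_cast hij.le
    have hiT : (i:ℝ) * h ≤ T := le_trans (by gcongr) hj
    have h3 := Sp_nonneg (D := D) (j * h - i * h)
    rw [norm_smul, Real.norm_eq_abs, abs_of_nonneg (by positivity)]
    have h4 : D.Sp (j * h - i * h) ≤ D.Sp T := Sp_mono (by
      have : (0:ℝ) ≤ i * h := by positivity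
      linarith)
    gcongr
    exact (Fm_norm _).trans (by gcongr; exact hR h hh i hiT)
  rw [Finset.sum_const, Finset.card_range, nsmul_eq_mul] at s1
  calc ‖D.zs h j‖ ≤ ‖D.Ch (j * h) • D.iL‖ + ‖D.Sp (j * h) • D.wL‖ +
        ‖∑ i ∈ Finset.range j, (h * D.Sp (j * h - i * h)) • D.Fm (xs D h i)‖ := by
          rw [zs]; exact (norm_sub_le _ _).trans (by gcongr; exact norm_add_le _ _)
    _ ≤ D.Ch T * ‖D.iL‖ + D.Sp T * ‖D.wL‖ + T * (D.Sp T * ((3 * D.K + D.c) * (1 + R))) := by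
          rw [norm_smul, norm_smul, Real.norm_eq_abs, Real.norm_eq_abs,
            abs_of_pos (Ch_pos _), abs_of_nonneg (Sp_nonneg _)]
          gcongr
          · exact Ch_mono hj0 hj
          · exact Sp_mono hj
          · refine s1.trans ?_
            calc _ = (j * h) * (D.Sp T * ((3 * D.K + D.c) * (1 + R))) := by ring
              _ ≤ _ := by gcongr

/-- limiting free flow -/
def ZZ (D : Dat) (X : ℝ → ℝ → ℝ) (t y : ℝ) : ℝ :=
  D.Ch t * y + D.Sp t * D.v y - ∫ τ in (0:ℝ)..t, D.Sp (t - τ) * (D.ff (X τ) y + D.c * X τ y)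

/-- limit flow -/
structure Flow (D : Dat) (A : Set ℝ) (X : ℝ → ℝ → ℝ) : Prop where
  meas : Measurable (fun p : ℝ × ℝ => X p.1 p.2)
  Am : MeasurableSet A
  Aae : ∀ᵐ y ∂D.ρ, y ∈ A
  supp : ∀ y ∈ A, ∀ δ > 0, 0 < D.ρ (Ioo (y - δ) (y + δ))
  L2 : ∀ t, 0 ≤ t → MemLp (X t) 2 D.ρ
  bd : ∀ T, ∃ R, 0 ≤ R ∧ ∀ t (ht : 0 ≤ t), t ≤ T → ‖(L2 t ht).toLp _‖ ≤ R
  lip : ∀ T, ∃ L, 0 ≤ L ∧ ∀ s t (hs : 0 ≤ s) (ht : 0 ≤ t), s ≤ T → t ≤ T →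
    ‖(L2 t ht).toLp _ - (L2 s hs).toLp _‖ ≤ L * |t - s|
  init : ∀ y ∈ A, X 0 y = y
  mono : ∀ t, 0 ≤ t → MonotoneOn (X t) A
  ii : ∀ t, 0 ≤ t → MonotoneOn (fun y => D.om t y - X t y) A
  iii : ∀ s t, 0 < s → s ≤ t → MonotoneOn (fun y => D.Sp t * X s y - D.Sp s * X t y) A
  cont : ∀ y ∈ A, ContinuousOn (fun t => X t y) (Ici 0)
  ZL : ∀ t, 0 ≤ t → MemLp (D.ZZ X t) 2 D.ρ
  orth : ∀ t, 0 ≤ t → ∀ φ : ℝ → ℝ, (∃ L, ∀ a b, |φ a - φ b| ≤ L * |a - b|) → (∃ M, ∀ a, |φ a| ≤ M) →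
    ∫ y, (D.ZZ X t y - X t y) * φ (X t y) ∂D.ρ = 0

lemma Sp_cont : Continuous D.Sp := by
  unfold Sp
  exact (Real.continuous_sinh.comp (continuous_const.mul (continuous_id.max continuous_const))).div_const _

lemma Ch_cont : Continuous D.Ch := by
  unfold Ch
  exact Real.continuous_cosh.comp (continuous_const.mul continuous_id)

lemma fl_tendsto {σ : ℕ → ℕ} (hσ : StrictMono σ) {t : ℝ} (ht : 0 ≤ t) :
    Tendsto (fun n => (⌊t / hh (σ n)⌋₊ : ℝ) * hh (σ n)) atTop (𝓝 t) := by
  have h1 : Tendsto (fun n => t - hh (σ n)) atTop (𝓝 t) := by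
    have := (hh_tendsto.comp hσ.tendsto_atTop).const_sub t
    simpa using this
  refine tendsto_of_tendsto_of_tendsto_of_le_of_le h1 tendsto_const_nhds (fun n => ?_) (fun n => fl_le ht)
  have := le_fl (σ n) t
  simp only; linarith

lemma g_memLp {X : ℝ → ℝ} (hX : MemLp X 2 D.ρ) (a : ℝ) : MemLp (fun z => D.g (a - X z)) 2 D.ρ := by
  have h3 : MemLp (fun z => D.K * ((1 + |a|) + |X z|)) 2 D.ρ :=
    ((memLp_const (1 + |a|)).add hX.abs).const_mul _
  refine MemLp.of_le h3 (psi_int (hX.integrable (by norm_num)) _).1 (Eventually.of_forall fun z => ?_)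
  rw [Real.norm_eq_abs]
  exact (g_bd _ _).trans (le_abs_self _)

section
variable {A : Set ℝ} (hA : GoodSet D A) {σ : ℕ → ℕ} (hσ : StrictMono σ) {X : ℝ → ℝ → ℝ}
  (hX : ∀ t, 0 ≤ t → ∀ y ∈ A, Tendsto (fun n => D.Xn (σ n) t y) atTop (𝓝 (X t y)))

lemma ff_tendsto' {Y : ℕ → ℝ → ℝ} {Y0 : ℝ → ℝ} (hY : ∀ n, MemLp (Y n) 2 D.ρ) {R : ℝ}
    (hR : ∀ n, ‖(hY n).toLp _‖ ≤ R) (hl : ∀ᵐ z ∂D.ρ, Tendsto (fun n => Y n z) atTop (𝓝 (Y0 z)))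
    {y : ℝ} (hy : Tendsto (fun n => Y n y) atTop (𝓝 (Y0 y))) :
    Tendsto (fun n => D.ff (Y n) y) atTop (𝓝 (D.ff Y0 y)) := by
  obtain ⟨R', hR'⟩ := hy.abs.bddAbove_range
  have hR'' : ∀ n, |Y n y| ≤ |R'| := fun n => (hR' (mem_range_self n)).trans (le_abs_self R')
  have hR0 : 0 ≤ R := (norm_nonneg _).trans (hR 0)
  have hK := D.K0
  have hu : ∀ n, MemLp (fun z => D.g (Y n y - Y n z)) 2 D.ρ := fun n => g_memLp (hY n) _
  refine LV1 hu (M := 3 * D.K * (1 + |R'| + R)) (fun n => ?_) ?_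
  · refine le_of_sq_le_sq ?_ (by positivity)
    rw [normsq_toLp]
    have i2 : Integrable (fun z => (Y n z) ^ 2) D.ρ := (hY n).integrable_sq
    have h1 : ∫ z, D.g (Y n y - Y n z) ^ 2 ∂D.ρ ≤
        ∫ z, 3 * D.K ^ 2 * (1 + |R'| ^ 2 + (Y n z) ^ 2) ∂D.ρ := by
      refine integral_mono (hu n).integrable_sq (((integrable_const _).add i2).const_mul _) fun z => ?_
      simp only
      have h := g_bd (D := D) (Y n y) (Y n z)
      have h5 := hR'' n
      rw [← sq_abs (D.g _), ← sq_abs (Y n z)]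
      have h' : |D.g (Y n y - Y n z)| ^ 2 ≤ (D.K * (1 + |R'| + |Y n z|)) ^ 2 := by
        gcongr
        exact h.trans (by gcongr)
      refine h'.trans ?_
      rw [mul_pow, mul_comm 3, mul_assoc]
      refine mul_le_mul_of_nonneg_left ?_ (sq_nonneg _)
      nlinarith [sq_nonneg (1 - |Y n z|), sq_nonneg (1 - |R'|), sq_nonneg (|Y n z| - |R'|)]
    refine h1.trans ?_
    rw [integral_const_mul, integral_add (integrable_const _) i2, ← normsq_toLp (hY n)]
    have h6 := hR n
    have h7 : ‖(hY n).toLp _‖ ^ 2 ≤ R ^ 2 := by gcongr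
    simp only [integral_const, probReal_univ, smul_eq_mul, one_mul]
    have h8 : 3 * (1 + |R'| ^ 2 + ‖(hY n).toLp _‖ ^ 2) ≤ 9 * (1 + |R'| + R) ^ 2 := by
      have := abs_nonneg R'
      nlinarith [mul_nonneg this hR0]
    nlinarith [sq_nonneg D.K]
  · filter_upwards [hl] with z hz
    exact (D.gc.tendsto _).comp (hy.sub hz)

lemma ff_tendsto (hA : GoodSet D A) (hX : ∀ t, 0 ≤ t → ∀ y ∈ A, Tendsto (fun n => D.Xn (σ n) t y) atTop (𝓝 (X t y)))
    {t : ℝ} (ht : 0 ≤ t) {y : ℝ} (hy : y ∈ A) :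
    Tendsto (fun n => D.ff (D.Xn (σ n) t) y) atTop (𝓝 (D.ff (X t) y)) := by
  obtain ⟨R, hR0, hR⟩ := Xn_bd D t
  refine ff_tendsto' (Y := fun n => D.Xn (σ n) t) (fun n => Lp.memLp _) (R := R)
    (fun n => by rw [Lp.toLp_coeFn]; exact hR _ t ht le_rfl) ?_ (hX t ht y hy)
  filter_upwards [hA.ae] with z hz using hX t ht z hz

lemma zs_tendsto (hA : GoodSet D A) (hσ : StrictMono σ) (hX : ∀ t, 0 ≤ t → ∀ y ∈ A, Tendsto (fun n => D.Xn (σ n) t y) atTop (𝓝 (X t y)))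
    {t : ℝ} (ht : 0 ≤ t) {y : ℝ} (hy : y ∈ A) :
    Tendsto (fun n => D.zs (hh (σ n)) ⌊t / hh (σ n)⌋₊ y) atTop (𝓝 (D.ZZ X t y)) := by
  have hfl := fl_tendsto hσ ht
  have e : ∀ n, D.zs (hh (σ n)) ⌊t / hh (σ n)⌋₊ y =
      D.Ch (⌊t / hh (σ n)⌋₊ * hh (σ n)) * y + D.Sp (⌊t / hh (σ n)⌋₊ * hh (σ n)) * D.v y -
      ∫ τ in (0:ℝ)..t, D.Sp (⌊t / hh (σ n)⌋₊ * hh (σ n) - ⌊τ / hh (σ n)⌋₊ * hh (σ n)) *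
        (D.ff (D.Xn (σ n) τ) y + D.c * D.Xn (σ n) τ y) := by
    intro n
    rw [hA.zf (σ n) _ y hy]
    congr 1
    set h := hh (σ n) with hh'
    have hp : 0 < h := hh_pos _
    set j := ⌊t / h⌋₊ with hj
    set H : ℕ → ℝ := fun i => D.Sp (j * h - i * h) * (D.ff (D.xs h i) y + D.c * D.xs h i y) with hH
    have hst := step_int hp H j
    have e1 : ∀ τ, D.Sp (j * h - ⌊τ / h⌋₊ * h) * (D.ff (D.Xn (σ n) τ) y + D.c * D.Xn (σ n) τ y) = H ⌊τ / h⌋₊ := by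
      intro τ; rw [hH, Xn]
    simp_rw [e1]
    have hjt : j * h ≤ t := fl_le (n := σ n) ht
    have hz : ∀ τ ∈ uIcc (j * h) t, (0:ℝ) = H ⌊τ / h⌋₊ := by
      intro τ hτ
      rw [uIcc_of_le hjt] at hτ
      have : j ≤ ⌊τ / h⌋₊ := Nat.le_floor (by rw [le_div_iff₀ hp]; exact hτ.1)
      have h2 : (j:ℝ) * h ≤ ⌊τ / h⌋₊ * h := by gcongr
      rw [hH]
      simp only
      rw [Sp_of_nonpos (by linarith), zero_mul]
    have i2 : IntervalIntegrable (fun τ => H ⌊τ / h⌋₊) volume (j * h) t := by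
      refine (intervalIntegrable_const (c := (0:ℝ))).congr ?_
      intro τ hτ
      exact hz τ (uIoc_subset_uIcc hτ)
    rw [← intervalIntegral.integral_add_adjacent_intervals hst.1 i2, hst.2,
      ← intervalIntegral.integral_congr hz]
    simp only [intervalIntegral.integral_zero, add_zero, hH]
    exact Finset.sum_congr rfl fun i _ => by ring
  simp_rw [e]
  unfold ZZ
  refine Tendsto.sub (Tendsto.add (((Ch_cont.tendsto _).comp hfl).mul_const _)
    (((Sp_cont.tendsto _).comp hfl).mul_const _)) ?_
  obtain ⟨R, hR0, hR⟩ := Xn_bd D t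
  obtain ⟨R', hR'⟩ := Xn_ptbd hA hy t
  have hK := D.K0
  refine intervalIntegral.tendsto_integral_filter_of_dominated_convergence
    (fun _ => D.Sp t * (D.K * (1 + R' + R) + D.c * R')) ?_ ?_ intervalIntegrable_const ?_
  · refine Eventually.of_forall fun n => Measurable.aestronglyMeasurable ?_
    exact (measurable_from_nat (f := fun i : ℕ => D.Sp (⌊t / hh (σ n)⌋₊ * hh (σ n) - i * hh (σ n)) *
        (D.ff (D.xs (hh (σ n)) i) y + D.c * D.xs (hh (σ n)) i y))).comp
        (Nat.measurable_floor.comp (measurable_id.div_const _))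
  · refine Eventually.of_forall fun n => Eventually.of_forall fun τ hτ => ?_
    rw [uIoc_of_le ht] at hτ
    have h1 := hR (σ n) τ hτ.1.le hτ.2
    have h2 := hR' (σ n) τ hτ.1.le hτ.2
    have h3 := ff_bd (Lp.memLp (D.Xn (σ n) τ)) y
    rw [Lp.toLp_coeFn] at h3
    have h4 := Sp_nonneg (D := D) (⌊t / hh (σ n)⌋₊ * hh (σ n) - ⌊τ / hh (σ n)⌋₊ * hh (σ n))
    rw [norm_mul, Real.norm_eq_abs, Real.norm_eq_abs, abs_of_nonneg h4]
    have h5 : D.Sp (⌊t / hh (σ n)⌋₊ * hh (σ n) - ⌊τ / hh (σ n)⌋₊ * hh (σ n)) ≤ D.Sp t := Sp_mono (by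
      have := fl_le (n := σ n) ht
      have : (0:ℝ) ≤ ⌊τ / hh (σ n)⌋₊ * hh (σ n) := mul_nonneg (Nat.cast_nonneg _) (hh_pos _).le
      linarith)
    have := D.hc
    have := Sp_nonneg (D := D) t
    gcongr
    refine (abs_add_le _ _).trans ?_
    rw [abs_mul, abs_of_pos D.hc]
    gcongr
    exact h3.trans (by gcongr)
  · refine Eventually.of_forall fun τ hτ => ?_
    rw [uIoc_of_le ht] at hτ
    exact ((Sp_cont.tendsto _).comp (hfl.sub (fl_tendsto hσ hτ.1.le))).mul
      ((ff_tendsto hA hX hτ.1.le hy).add ((hX τ hτ.1.le y hy).const_mul _))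
end

end Dat

namespace Dat
variable {D : Dat}

lemma lipc {φ : ℝ → ℝ} {L : ℝ} (hL : ∀ a b, |φ a - φ b| ≤ L * |a - b|) : Continuous φ := by
  refine (LipschitzWith.of_dist_le_mul (K := ⟨|L|, abs_nonneg L⟩) fun a b => ?_).continuous
  rw [Real.dist_eq, Real.dist_eq]
  exact (hL a b).trans (mul_le_mul_of_nonneg_right (le_abs_self L) (abs_nonneg _))

lemma exists_flow (D : Dat) : ∃ A X, Flow D A X := by
  obtain ⟨A, hA⟩ := exists_good D
  obtain ⟨σ, hσ, X, hXm, hX⟩ := exists_limit hA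
  have hX' : ∀ t, 0 ≤ t → ∀ᵐ y ∂D.ρ, Tendsto (fun n => D.Xn (σ n) t y) atTop (𝓝 (X t y)) :=
    fun t ht => by filter_upwards [hA.ae] with y hy using hX t ht y hy
  have hbd : ∀ T, ∃ R, 0 ≤ R ∧ ∀ t, 0 ≤ t → t ≤ T → ∃ h : MemLp (X t) 2 D.ρ, ‖h.toLp _‖ ≤ R := by
    intro T
    obtain ⟨R, hR0, hR⟩ := Xn_bd D T
    exact ⟨R, hR0, fun t ht htT => fatou2 (u := fun n => D.Xn (σ n) t) (fun n => Lp.memLp _)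
      (M := fun _ => R) (fun n => by rw [Lp.toLp_coeFn]; exact hR _ t ht htT) tendsto_const_nhds (hX' t ht)⟩
  have L2 : ∀ t, 0 ≤ t → MemLp (X t) 2 D.ρ := fun t ht => by
    obtain ⟨R, -, h⟩ := hbd t
    exact (h t ht le_rfl).1
  have hh0 : Tendsto (fun n => hh (σ n)) atTop (𝓝 0) := hh_tendsto.comp hσ.tendsto_atTop
  have hlip : ∀ T, ∃ L, 0 ≤ L ∧ ∀ s t (hs : 0 ≤ s) (ht : 0 ≤ t), s ≤ T → t ≤ T →
    ‖(L2 t ht).toLp _ - (L2 s hs).toLp _‖ ≤ L * |t - s| := by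
    intro T
    obtain ⟨L, hL0, hL⟩ := Xn_lip D T
    refine ⟨L, hL0, fun s t hs ht hsT htT => ?_⟩
    have hc : ∀ᵐ y ∂D.ρ, ∀ n, (D.Xn (σ n) t - D.Xn (σ n) s : Lp ℝ 2 D.ρ) y = D.Xn (σ n) t y - D.Xn (σ n) s y :=
      ae_all_iff.2 fun n => Lp.coeFn_sub _ _
    have hw : ∀ᵐ y ∂D.ρ, Tendsto (fun n => (D.Xn (σ n) t - D.Xn (σ n) s : Lp ℝ 2 D.ρ) y) atTop
        (𝓝 (X t y - X s y)) := by
      filter_upwards [hc, hX' t ht, hX' s hs] with y h1 h2 h3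
      simp_rw [h1]
      exact h2.sub h3
    have hM0 : Tendsto (fun n => L * (|t - s| + hh (σ n))) atTop (𝓝 (L * |t - s|)) := by
      have := (hh0.const_add |t - s|).const_mul L
      rwa [add_zero] at this
    obtain ⟨h, hn⟩ := fatou2 (u := fun n => (D.Xn (σ n) t - D.Xn (σ n) s : Lp ℝ 2 D.ρ)) (fun n => Lp.memLp _)
      (fun n => by rw [Lp.toLp_coeFn]; exact hL (σ n) s t hs hsT ht htT) hM0 hw
    have e : (L2 t ht).toLp _ - (L2 s hs).toLp _ = h.toLp _ := (MemLp.toLp_sub (L2 t ht) (L2 s hs)).symm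
    rw [e]; exact hn
  have hzw : ∀ t, 0 ≤ t → ∀ᵐ y ∂D.ρ, Tendsto (fun n => D.zs (hh (σ n)) ⌊t / hh (σ n)⌋₊ y) atTop (𝓝 (D.ZZ X t y)) :=
    fun t ht => by filter_upwards [hA.ae] with y hy using zs_tendsto hA hσ hX ht hy
  refine ⟨A, X, hXm, hA.meas, hA.ae, hA.supp, L2, fun T => ?_, hlip, fun y hy => ?_, fun t ht => ?_,
    fun t ht => ?_, fun s t hs hst => ?_, fun y hy => ?_, fun t ht => ?_, fun t ht φ hφL hφM => ?_⟩
  · obtain ⟨R, hR0, h⟩ := hbd T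
    exact ⟨R, hR0, fun t ht htT => (h t ht htT).2⟩
  · refine tendsto_nhds_unique (hX 0 le_rfl y hy) (tendsto_const_nhds.congr fun n => ?_)
    rw [Xn]; simp only [zero_div, Nat.floor_zero]
    exact (hA.init (σ n) y hy).symm
  · intro y hy z hz hyz
    exact le_of_tendsto_of_tendsto' (hX t ht y hy) (hX t ht z hz) fun n => hA.mono _ _ hy hz hyz
  · intro y hy z hz hyz
    have hom : ∀ y, Tendsto (fun n => D.om (⌊t / hh (σ n)⌋₊ * hh (σ n)) y) atTop (𝓝 (D.om t y)) := fun y => by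
      unfold om
      exact (((Ch_cont.tendsto _).comp (fl_tendsto hσ ht)).mul_const _).add
        (((Sp_cont.tendsto _).comp (fl_tendsto hσ ht)).mul_const _)
    exact le_of_tendsto_of_tendsto' ((hom y).sub (hX t ht y hy)) ((hom z).sub (hX t ht z hz))
      fun n => hA.ii _ _ hy hz hyz
  · intro y hy z hz hyz
    have ht := hs.le.trans hst
    have hS : ∀ {t}, 0 ≤ t → Tendsto (fun n => D.Sp (⌊t / hh (σ n)⌋₊ * hh (σ n))) atTop (𝓝 (D.Sp t)) :=
      fun ht => (Sp_cont.tendsto _).comp (fl_tendsto hσ ht)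
    have hT : ∀ y ∈ A, Tendsto (fun n => D.Sp (⌊t / hh (σ n)⌋₊ * hh (σ n)) * D.Xn (σ n) s y -
      D.Sp (⌊s / hh (σ n)⌋₊ * hh (σ n)) * D.Xn (σ n) t y) atTop (𝓝 (D.Sp t * X s y - D.Sp s * X t y)) :=
      fun y hy => ((hS ht).mul (hX s hs.le y hy)).sub ((hS hs.le).mul (hX t ht y hy))
    refine le_of_tendsto_of_tendsto (hT y hy) (hT z hz) ?_
    have hev := (fl_tendsto hσ hs.le).eventually (lt_mem_nhds hs)
    filter_upwards [hev] with n hn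
    refine hA.iii _ _ _ ?_ (Nat.floor_mono (by have := hh_pos (σ n); gcongr)) hy hz hyz
    rcases Nat.eq_zero_or_pos ⌊s / hh (σ n)⌋₊ with h | h
    · rw [h] at hn; simp at hn
    · exact h
  · intro t ht
    rw [Metric.continuousWithinAt_iff]
    intro ε hε
    obtain ⟨L, hL0, hL⟩ := Xn_ptlip hA hy (t + 1)
    obtain ⟨δ, hδ, hom⟩ := osc_small (D := D) (t + 1) y (half_pos (half_pos hε))
    have hp : 0 < D.ρ.real (Ioo (y - δ) (y + δ)) :=
      ENNReal.toReal_pos (hA.supp y hy δ hδ).ne' (measure_ne_top _ _)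
    set p := D.ρ.real (Ioo (y - δ) (y + δ)) with hpd
    refine ⟨min 1 (ε * p / 2 / (L + 1)), by positivity, fun s hs hst => ?_⟩
    rw [Real.dist_eq] at hst ⊢
    have hst1 := hst.trans_le (min_le_left _ _)
    have hst2 := hst.trans_le (min_le_right _ _)
    have ht : 0 ≤ t := ht
    have hs : 0 ≤ s := hs
    have hlim : Tendsto (fun n => |D.Xn (σ n) s y - D.Xn (σ n) t y|) atTop (𝓝 |X s y - X t y|) :=
      ((hX s hs y hy).sub (hX t ht y hy)).abs
    have hlim2 : Tendsto (fun n => L * (|s - t| + hh (σ n)) / p + 2 * (D.om (t+1) (y + δ) - D.om (t+1) (y - δ))) atTop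
        (𝓝 (L * (|s - t| + 0) / p + 2 * (D.om (t+1) (y + δ) - D.om (t+1) (y - δ)))) :=
      (((hh0.const_add _).const_mul L).div_const p).add_const _
    have hle := le_of_tendsto_of_tendsto' hlim hlim2 fun n =>
      hL δ hδ (σ n) t s ht (by linarith) hs (by linarith [(abs_lt.1 hst1).2])
    rw [lt_div_iff₀ (by positivity)] at hst2
    have : L * (|s - t| + 0) / p ≤ ε / 2 := by
      rw [div_le_iff₀ hp]
      nlinarith [abs_nonneg (s - t)]
    linarith
  · obtain ⟨R, hR0, hR⟩ := zs_bd D t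
    exact (fatou2 (u := fun n => D.zs (hh (σ n)) ⌊t / hh (σ n)⌋₊) (fun n => Lp.memLp _)
      (M := fun _ => R) (fun n => by rw [Lp.toLp_coeFn]; exact hR _ (hh_pos _) _ (fl_le ht))
      tendsto_const_nhds (hzw t ht)).1
  · obtain ⟨L, hL⟩ := hφL
    obtain ⟨M, hM⟩ := hφM
    obtain ⟨R, hR0, hR⟩ := zs_bd D t
    obtain ⟨R', hR0', hR'⟩ := Xn_bd D t
    have hφc := lipc hL
    have hM0 : 0 ≤ M := (abs_nonneg _).trans (hM 0)
    have hd : ∀ n, MemLp (fun y => D.zs (hh (σ n)) ⌊t / hh (σ n)⌋₊ y - D.Xn (σ n) t y) 2 D.ρ :=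
      fun n => (Lp.memLp _).sub (Lp.memLp _)
    have hu : ∀ n, MemLp (fun y => (D.zs (hh (σ n)) ⌊t / hh (σ n)⌋₊ y - D.Xn (σ n) t y) * φ (D.Xn (σ n) t y)) 2 D.ρ := by
      intro n
      refine MemLp.of_le_mul (c := M) (hd n) ((hd n).1.mul (hφc.comp_aestronglyMeasurable (Lp.aestronglyMeasurable _))) ?_
      refine Eventually.of_forall fun y => ?_
      rw [norm_mul, mul_comm]
      gcongr
      exact hM _
    have hlim := LV1 hu (M := M * (R + R')) (fun n => ?_) (w := fun y => (D.ZZ X t y - X t y) * φ (X t y)) ?_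
    · refine tendsto_nhds_unique hlim (tendsto_const_nhds.congr fun n => ?_)
      have := PK_orth (D.zs (hh (σ n)) ⌊t / hh (σ n)⌋₊) hL hM
      rw [← xs_eq] at this
      exact this.symm
    · have h1 : ‖(hu n).toLp _‖ ≤ M * ‖(hd n).toLp _‖ := by
        refine Lp.norm_le_mul_norm_of_ae_le_mul ?_
        filter_upwards [(hu n).coeFn_toLp, (hd n).coeFn_toLp] with y e1 e2
        rw [e1, e2, norm_mul, mul_comm]
        gcongr
        exact hM _
      refine h1.trans ?_
      gcongr
      have e : (hd n).toLp _ = D.zs (hh (σ n)) ⌊t / hh (σ n)⌋₊ - D.Xn (σ n) t := by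
        refine (MemLp.toLp_sub (Lp.memLp _) (Lp.memLp _)).trans ?_
        rw [Lp.toLp_coeFn, Lp.toLp_coeFn]
      rw [e]
      exact (norm_sub_le _ _).trans (add_le_add (hR _ (hh_pos _) _ (fl_le ht)) (hR' _ t ht le_rfl))
    · filter_upwards [hX' t ht, hzw t ht] with y h1 h2
      exact (h2.sub h1).mul ((hφc.tendsto _).comp h1)

end Dat

/-- abstract sticky evolution in a Hilbert space -/
structure HF (H : Type*) [NormedAddCommGroup H] [InnerProductSpace ℝ H] where
  P : ℝ → H →L[ℝ] H
  x : ℝ → H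
  f : ℝ → H
  v : H
  Pn : ∀ t a, ‖P t a‖ ≤ ‖a‖
  sym : ∀ t a b, inner ℝ (P t a) b = inner ℝ a (P t b)
  c1 : ∀ s t a, s ≤ t → P t (P s a) = P t a
  c2 : ∀ s t a, s ≤ t → P s (P t a) = P t a
  xP : ∀ t, P t (x t) = x t
  lip : ∀ T, ∃ L, 0 ≤ L ∧ ∀ s t, s ≤ T → t ≤ T → ‖x t - x s‖ ≤ L * |t - s|
  fc : Continuous f
  star : ∀ s r γ, 0 ≤ s → s ≤ r → inner ℝ (x r - x s) (P r γ) =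
    ∫ σ in s..r, inner ℝ (v - ∫ τ in (0:ℝ)..σ, f τ) (P r γ)

namespace HF
variable {H : Type*} [NormedAddCommGroup H] [InnerProductSpace ℝ H] (E : HF H)

/-- free velocity -/
def u (t : ℝ) : H := E.v - ∫ τ in (0:ℝ)..t, E.f τ
/-- velocity -/
def V (t : ℝ) : H := E.P t (E.u t)

lemma Pdiff (s t : ℝ) (a : H) : ‖E.P s a - E.P t a‖ ^ 2 = |‖E.P s a‖ ^ 2 - ‖E.P t a‖ ^ 2| := by
  have key : ∀ s t, s ≤ t → ‖E.P s a - E.P t a‖ ^ 2 = ‖E.P s a‖ ^ 2 - ‖E.P t a‖ ^ 2 := by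
    intro s t h
    have e1 : inner ℝ (E.P s a) (E.P t a) = ‖E.P t a‖ ^ 2 := by
      rw [E.sym, E.c2 s t a h, ← real_inner_self_eq_norm_sq, E.sym, E.c2 t t a le_rfl]
    rw [norm_sub_sq_real, e1]; ring
  rcases le_total s t with h | h
  · rw [key s t h, abs_of_nonneg]; rw [← key s t h]; positivity
  · rw [norm_sub_rev, key t s h, abs_sub_comm, abs_of_nonneg]; rw [← key t s h]; positivity

lemma Pmono (a : H) : Antitone fun t => ‖E.P t a‖ ^ 2 := by
  intro s t h
  have : ‖E.P t a‖ ≤ ‖E.P s a‖ := by rw [← E.c1 s t a h]; exact E.Pn _ _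
  simp only; gcongr

lemma Pcont [SecondCountableTopology H] : ∃ N : Set ℝ, N.Countable ∧ ∀ t ∉ N, ∀ ξ, ContinuousAt (fun r => E.P r ξ) t := by
  let d := TopologicalSpace.denseSeq H
  refine ⟨⋃ n, {t | ¬ ContinuousAt (fun r => ‖E.P r (d n)‖ ^ 2) t},
    countable_iUnion fun n => (E.Pmono (d n)).countable_not_continuousAt, fun t ht ξ => ?_⟩
  simp only [mem_iUnion, mem_ofPred_eq, not_exists, not_not] at ht
  have hd : ∀ n, Tendsto (fun r => ‖E.P r (d n) - E.P t (d n)‖) (𝓝 t) (𝓝 0) := by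
    intro n
    have h1 : Tendsto (fun r => ‖E.P r (d n) - E.P t (d n)‖ ^ 2) (𝓝 t) (𝓝 0) := by
      simp_rw [E.Pdiff]
      have := ((ht n).sub_const (‖E.P t (d n)‖ ^ 2)).abs
      simpa using this
    have := h1.sqrt
    simpa using this
  rw [Metric.continuousAt_iff']
  intro ε hε
  obtain ⟨n, hn⟩ := (TopologicalSpace.denseRange_denseSeq H).exists_dist_lt ξ (show 0 < ε / 3 by positivity)
  filter_upwards [(hd n).eventually (gt_mem_nhds (show 0 < ε / 3 by positivity))] with r hr
  rw [dist_eq_norm] at hn ⊢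
  have e : E.P r ξ - E.P t ξ = E.P r (ξ - d n) + (E.P r (d n) - E.P t (d n)) - E.P t (ξ - d n) := by
    simp only [map_sub]; abel
  rw [e]
  have h1 := E.Pn r (ξ - d n)
  have h2 := E.Pn t (ξ - d n)
  have h3 := norm_sub_le (E.P r (ξ - d n) + (E.P r (d n) - E.P t (d n))) (E.P t (ξ - d n))
  have h4 := norm_add_le (E.P r (ξ - d n)) (E.P r (d n) - E.P t (d n))
  linarith

lemma u_cont [CompleteSpace H] : Continuous E.u := by
  unfold u
  exact continuous_const.sub (intervalIntegral.continuous_primitive (fun a b => E.fc.intervalIntegrable a b) 0)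

lemma V_cont [CompleteSpace H] {t : ℝ} (h : ∀ ξ, ContinuousAt (fun r => E.P r ξ) t) : ContinuousAt E.V t := by
  have h1 : Tendsto (fun r => E.P r (E.u r - E.u t)) (𝓝 t) (𝓝 0) := by
    refine squeeze_zero_norm (fun r => E.Pn r _) ?_
    have := ((E.u_cont.tendsto t).sub_const (E.u t)).norm
    simpa using this
  have h2 := h1.add (h (E.u t))
  rw [zero_add] at h2
  refine h2.congr fun r => ?_
  rw [V, ← map_add]; congr 1; abel

lemma star' (s r : ℝ) (ξ : H) (hs : 0 ≤ s) (hr : s ≤ r) : inner ℝ (E.x r - E.x s) ξ =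
    (∫ σ in s..r, inner ℝ (E.u σ) (E.P r ξ)) + inner ℝ (E.x r - E.x s) (E.P s ξ - E.P r ξ) := by
  have h1 : E.P s (E.x r - E.x s) = E.x r - E.x s := by
    rw [map_sub, E.xP s]; congr 1
    rw [← E.xP r, E.c2 s r _ hr]
  have h2 := E.star s r ξ hs hr
  have h3 : inner ℝ (E.x r - E.x s) ξ = inner ℝ (E.x r - E.x s) (E.P s ξ) := by
    rw [← E.sym, h1]
  rw [h3, inner_sub_right, h2]; unfold u; ring

/-- one estimate for the weak derivative -/
lemma weak_est [CompleteSpace H] {t : ℝ} (h : ∀ ξ, ContinuousAt (fun r => E.P r ξ) t) (ξ : H)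
    {ε : ℝ} (hε : 0 < ε) : ∃ δ > 0, ∀ s r, 0 ≤ s → t - δ < s → s ≤ t → t ≤ r → r < t + δ →
      |inner ℝ (E.x r - E.x s) ξ - (r - s) * inner ℝ (E.V t) ξ| ≤ ε * (r - s) := by
  obtain ⟨L, hL0, hL⟩ := E.lip (t + 1)
  have h1 : Tendsto (fun p : ℝ × ℝ => inner ℝ (E.u p.1) (E.P p.2 ξ)) (𝓝 (t, t)) (𝓝 (inner ℝ (E.V t) ξ)) := by
    rw [V, E.sym]
    have a1 : Tendsto (fun p : ℝ × ℝ => E.u p.1) (𝓝 (t, t)) (𝓝 (E.u t)) :=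
      (E.u_cont.tendsto t).comp (continuous_fst.tendsto (t, t))
    have a2 : Tendsto (fun p : ℝ × ℝ => E.P p.2 ξ) (𝓝 (t, t)) (𝓝 (E.P t ξ)) :=
      (h ξ).tendsto.comp (continuous_snd.tendsto (t, t))
    exact a1.inner a2
  obtain ⟨δ1, hd1, h1⟩ := Metric.eventually_nhds_iff.1 (Metric.tendsto_nhds.1 h1 (ε / 2) (half_pos hε))
  have hp : 0 < ε / 4 / (L + 1) := by positivity
  obtain ⟨δ2, hd2, h2⟩ := Metric.continuousAt_iff.1 (h ξ) _ hp
  refine ⟨min (min δ1 δ2) 1, by positivity, fun s r hs hs1 hst htr hr1 => ?_⟩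
  have m1 : min (min δ1 δ2) 1 ≤ δ1 := (min_le_left _ _).trans (min_le_left _ _)
  have m2 : min (min δ1 δ2) 1 ≤ δ2 := (min_le_left _ _).trans (min_le_right _ _)
  have m3 : min (min δ1 δ2) 1 ≤ 1 := min_le_right _ _
  have hsr := hst.trans htr
  rw [E.star' s r ξ hs hsr]
  have b1 : |(∫ σ in s..r, inner ℝ (E.u σ) (E.P r ξ)) - (r - s) * inner ℝ (E.V t) ξ| ≤ ε / 2 * (r - s) := by
    have hi : IntervalIntegrable (fun σ => inner ℝ (E.u σ) (E.P r ξ)) volume s r :=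
      (E.u_cont.inner continuous_const).intervalIntegrable _ _
    have e : (r - s) * inner ℝ (E.V t) ξ = ∫ σ in s..r, inner ℝ (E.V t) ξ := by simp
    rw [e, ← intervalIntegral.integral_sub hi intervalIntegrable_const]
    have := intervalIntegral.norm_integral_le_of_norm_le_const (a := s) (b := r) (C := ε / 2)
      (f := fun σ => inner ℝ (E.u σ) (E.P r ξ) - inner ℝ (E.V t) ξ) (fun σ hσ => by
        rw [uIoc_of_le hsr] at hσ
        have := h1 (y := (σ, r)) (by
          rw [Prod.dist_eq, Real.dist_eq, Real.dist_eq]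
          refine max_lt (abs_lt.2 ⟨?_, ?_⟩) (abs_lt.2 ⟨?_, ?_⟩) <;> linarith [hσ.1, hσ.2])
        rw [Real.dist_eq] at this
        exact this.le)
    rwa [abs_of_nonneg (by linarith : 0 ≤ r - s)] at this
  have b2 : |inner ℝ (E.x r - E.x s) (E.P s ξ - E.P r ξ)| ≤ ε / 2 * (r - s) := by
    refine (abs_real_inner_le_norm _ _).trans ?_
    have c1 := hL s r (by linarith) (by linarith)
    rw [abs_of_nonneg (by linarith : 0 ≤ r - s)] at c1
    have c2 := (h2 (x := s) (by rw [Real.dist_eq]; exact abs_lt.2 ⟨by linarith, by linarith⟩)).le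
    have c3 := (h2 (x := r) (by rw [Real.dist_eq]; exact abs_lt.2 ⟨by linarith, by linarith⟩)).le
    have c4 := dist_triangle_right (E.P s ξ) (E.P r ξ) (E.P t ξ)
    rw [dist_eq_norm (E.P s ξ) (E.P r ξ)] at c4
    have c5 : ‖E.P s ξ - E.P r ξ‖ ≤ ε / 2 / (L + 1) := by
      have : ε / 2 / (L + 1) = ε / 4 / (L + 1) + ε / 4 / (L + 1) := by ring
      linarith
    calc _ ≤ (L * (r - s)) * (ε / 2 / (L + 1)) := by gcongr
      _ = (L / (L + 1)) * (ε / 2 * (r - s)) := by ring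
      _ ≤ 1 * (ε / 2 * (r - s)) := by
        have : 0 ≤ r - s := by linarith
        gcongr
        rw [div_le_one (by positivity)]; linarith
      _ = _ := one_mul _
  have := abs_add_le ((∫ σ in s..r, inner ℝ (E.u σ) (E.P r ξ)) - (r - s) * inner ℝ (E.V t) ξ)
    (inner ℝ (E.x r - E.x s) (E.P s ξ - E.P r ξ))
  calc _ = |((∫ σ in s..r, inner ℝ (E.u σ) (E.P r ξ)) - (r - s) * inner ℝ (E.V t) ξ) +
    (inner ℝ (E.x r - E.x s) (E.P s ξ - E.P r ξ))| := by congr 1; ring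
    _ ≤ _ := by linarith

lemma weak_deriv [CompleteSpace H] {t : ℝ} (ht : 0 < t) (h : ∀ ξ, ContinuousAt (fun r => E.P r ξ) t) (ξ : H) :
    HasDerivAt (fun r => inner ℝ (E.x r) ξ) (inner ℝ (E.V t) ξ) t := by
  rw [hasDerivAt_iff_isLittleO, Asymptotics.isLittleO_iff]
  intro ε hε
  obtain ⟨δ, hδ, hd⟩ := E.weak_est h ξ hε
  have : Ioo (max 0 (t - δ)) (t + δ) ∈ 𝓝 t := Ioo_mem_nhds (max_lt ht (by linarith)) (by linarith)
  filter_upwards [this] with r hr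
  have hr0 := (le_max_left _ _).trans_lt hr.1
  have hr1 := (le_max_right _ _).trans_lt hr.1
  rw [smul_eq_mul, Real.norm_eq_abs, Real.norm_eq_abs]
  rcases le_total t r with htr | htr
  · have := hd t r ht.le (by linarith) le_rfl htr hr.2
    rw [inner_sub_left] at this
    rwa [abs_of_nonneg (by linarith : 0 ≤ r - t)]
  · have := hd r t hr0.le hr1 htr le_rfl (by linarith)
    rw [inner_sub_left] at this
    rw [abs_of_nonpos (by linarith : r - t ≤ 0), ← abs_neg, neg_sub]
    convert this using 2 <;> ring

lemma int_est [CompleteSpace H] {N : Set ℝ} (hN : N.Countable)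
    (hP : ∀ t ∉ N, ∀ ξ, ContinuousAt (fun r => E.P r ξ) t) {a b : ℝ} (ha : 0 ≤ a) (hab : a ≤ b) {w : H} {ε : ℝ}
    (hw : ∀ σ, a < σ → σ < b → ‖E.V σ - w‖ ≤ ε) : ‖E.x b - E.x a - (b - a) • w‖ ≤ ε * (b - a) := by
  obtain ⟨L, hL0, hL⟩ := E.lip b
  set ξ := E.x b - E.x a - (b - a) • w with hξ
  set φ : ℝ → ℝ := fun r => inner ℝ (E.x r - r • w) ξ with hφ
  have hc : ContinuousOn φ (Icc a b) := by
    have hx : ContinuousOn E.x (Icc a b) := by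
      refine LipschitzOnWith.continuousOn (K := ⟨L, hL0⟩) (LipschitzOnWith.of_dist_le_mul fun s hs t ht => ?_)
      rw [dist_eq_norm, Real.dist_eq]
      exact hL t s ht.2 hs.2
    exact (hx.sub (continuous_id.smul continuous_const).continuousOn).inner continuousOn_const
  have hd : ∀ r ∈ Ioo a b \ N, HasDerivAt φ (inner ℝ (E.V r - w) ξ) r := by
    intro r hr
    have h1 := E.weak_deriv (ha.trans_lt hr.1.1) (hP r hr.2) ξ
    have h2 : HasDerivAt (fun r : ℝ => r * inner ℝ w ξ) (1 * inner ℝ w ξ) r := (hasDerivAt_id r).mul_const _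
    have h3 := h1.sub h2
    refine (h3.congr_deriv ?_).congr_of_eventuallyEq (Eventually.of_forall fun r => ?_)
    · rw [inner_sub_left, one_mul]
    · simp only [hφ, inner_sub_left, real_inner_smul_left, Pi.sub_apply]
  have hbd : ∀ r ∈ Ioo a b \ N, |deriv φ r| ≤ ε * ‖ξ‖ := by
    intro r hr
    rw [(hd r hr).deriv]
    refine (abs_real_inner_le_norm _ _).trans ?_
    gcongr
    exact hw r hr.1.1 hr.1.2
  have hae : ∀ᵐ r ∂(volume : Measure ℝ), r ∈ Ioc a b → r ∈ Ioo a b \ N := by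
    have h1 : ∀ᵐ r ∂(volume : Measure ℝ), r ∉ N := by
      rw [ae_iff]; simpa using hN.measure_zero volume
    have h2 : ∀ᵐ r ∂(volume : Measure ℝ), r ≠ b := by simp [ae_iff]
    filter_upwards [h1, h2] with r h1 h2 h3
    exact ⟨⟨h3.1, lt_of_le_of_ne h3.2 h2⟩, h1⟩
  have hbd' : ∀ᵐ r ∂(volume : Measure ℝ), r ∈ Set.uIoc a b → ‖deriv φ r‖ ≤ ε * ‖ξ‖ := by
    rw [uIoc_of_le hab]
    filter_upwards [hae] with r h1 h2 using hbd r (h1 h2)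
  have hi : IntervalIntegrable (deriv φ) volume a b := by
    refine (intervalIntegrable_const (c := ε * ‖ξ‖)).mono_fun' (measurable_deriv φ).aestronglyMeasurable ?_
    rw [EventuallyLE, ae_restrict_iff' measurableSet_uIoc]
    exact hbd'
  have hint := integral_eq_of_hasDerivAt_off_countable_of_le φ (deriv φ) hab hN hc
    (fun r hr => (hd r hr).differentiableAt.hasDerivAt) hi
  have hle := intervalIntegral.norm_integral_le_of_norm_le_const_ae hbd'
  rw [hint, abs_of_nonneg (by linarith : 0 ≤ b - a)] at hle
  have e : φ b - φ a = ‖ξ‖ ^ 2 := by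
    rw [← real_inner_self_eq_norm_sq, hφ]
    simp only
    rw [← inner_sub_left, hξ]
    congr 1
    rw [sub_smul]; abel
  rw [e, Real.norm_eq_abs, abs_of_nonneg (sq_nonneg _)] at hle
  rcases (norm_nonneg ξ).eq_or_lt with h0 | h0
  · rw [← h0]
    rcases hab.eq_or_lt with h | h
    · rw [h]; simp
    · have := (norm_nonneg _).trans (hw ((a + b) / 2) (by linarith) (by linarith))
      exact mul_nonneg this (by linarith)
  · nlinarith

lemma strong_deriv [CompleteSpace H] {N : Set ℝ} (hN : N.Countable)
    (hP : ∀ t ∉ N, ∀ ξ, ContinuousAt (fun r => E.P r ξ) t) {t : ℝ} (ht : 0 < t) (htN : t ∉ N) :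
    HasDerivAt E.x (E.V t) t := by
  rw [hasDerivAt_iff_isLittleO, Asymptotics.isLittleO_iff]
  intro ε hε
  obtain ⟨δ, hδ, hd⟩ := Metric.continuousAt_iff.1 (E.V_cont (hP t htN)) ε hε
  have : Ioo (max 0 (t - δ)) (t + δ) ∈ 𝓝 t := Ioo_mem_nhds (max_lt ht (by linarith)) (by linarith)
  filter_upwards [this] with r hr
  have hr0 := (le_max_left _ _).trans_lt hr.1
  have hr1 := (le_max_right _ _).trans_lt hr.1
  rw [Real.norm_eq_abs]
  have hV : ∀ σ, t - δ < σ → σ < t + δ → ‖E.V σ - E.V t‖ ≤ ε := by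
    intro σ h1 h2
    rw [← dist_eq_norm]
    exact (hd (x := σ) (by rw [Real.dist_eq]; exact abs_lt.2 ⟨by linarith, by linarith⟩)).le
  rcases le_total t r with htr | htr
  · have := E.int_est hN hP ht.le htr (fun σ h1 h2 => hV σ (by linarith) (by linarith [hr.2]))
    rwa [abs_of_nonneg (by linarith : 0 ≤ r - t)]
  · have := E.int_est hN hP hr0.le htr (fun σ h1 h2 => hV σ (by linarith) (by linarith))
    rw [abs_of_nonpos (by linarith : r - t ≤ 0), ← norm_neg]
    have e : -(E.x r - E.x t - (r - t) • E.V t) = E.x t - E.x r - (t - r) • E.V t := by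
      rw [sub_smul, sub_smul]; abel
    rw [e, neg_sub]; exact this

end HF

namespace HF
variable {H : Type*} [NormedAddCommGroup H] [InnerProductSpace ℝ H] [CompleteSpace H] (E : HF H)

lemma u_sub (a b : ℝ) : E.u b = E.u a - ∫ τ in a..b, E.f τ := by
  unfold u
  rw [← intervalIntegral.integral_add_adjacent_intervals (E.fc.intervalIntegrable 0 a) (E.fc.intervalIntegrable a b)]
  abel

lemma V_le {a b : ℝ} (h : a ≤ b) : ‖E.V b‖ ^ 2 ≤ ‖E.V a - ∫ τ in a..b, E.f τ‖ ^ 2 := by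
  have : E.V b = E.P b (E.V a - ∫ τ in a..b, E.f τ) := by
    rw [V, map_sub, V, E.c1 a b _ h, ← map_sub, ← u_sub]
  rw [this]
  gcongr
  exact E.Pn _ _

lemma energy {N : Set ℝ} (hN : N.Countable)
    (hP : ∀ t ∉ N, ∀ ξ, ContinuousAt (fun r => E.P r ξ) t) {p : ℝ → ℝ} {C : ℝ} (hC : 0 ≤ C)
    (hp : ∀ s t, 0 ≤ s → s ≤ t → p t - p s ≤ inner ℝ (E.f t) (E.x t - E.x s) + C * ‖E.x t - E.x s‖ ^ 2)
    {s t : ℝ} (hs : 0 ≤ s) (hst : s ≤ t) :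
    1 / 2 * ‖E.V t‖ ^ 2 + p t ≤ 1 / 2 * ‖E.V s‖ ^ 2 + p s := by
  obtain ⟨L, hL0, hL⟩ := E.lip t
  obtain ⟨M, hM⟩ := (isCompact_Icc (a := 0) (b := t)).exists_bound_of_continuousOn E.fc.continuousOn
  obtain ⟨B, hB⟩ := (isCompact_Icc (a := 0) (b := t)).exists_bound_of_continuousOn E.u_cont.continuousOn
  have ht : 0 ≤ t := hs.trans hst
  have hM0 : 0 ≤ M := (norm_nonneg _).trans (hM 0 ⟨le_rfl, ht⟩)
  have hB0 : 0 ≤ B := (norm_nonneg _).trans (hB 0 ⟨le_rfl, ht⟩)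
  set e : ℝ → ℝ := fun r => 1 / 2 * ‖E.V r‖ ^ 2 + p r with he
  have h1 : ∀ a b, 0 ≤ a → a ≤ b → e b - e a ≤ -inner ℝ (E.V a) (∫ τ in a..b, E.f τ) +
      inner ℝ (E.f b) (E.x b - E.x a) + 1 / 2 * ‖∫ τ in a..b, E.f τ‖ ^ 2 + C * ‖E.x b - E.x a‖ ^ 2 := by
    intro a b ha hab
    have h2 := E.V_le hab
    rw [norm_sub_sq_real] at h2
    have h3 := hp a b ha hab
    simp only [he]; linarith
  set K := B * M + M * L + 1 / 2 * M ^ 2 * t + C * L ^ 2 * t with hK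
  have h2 : ∀ a b, 0 ≤ a → a ≤ b → b ≤ t → e b - e a ≤ K * (b - a) := by
    intro a b ha hab hbt
    refine (h1 a b ha hab).trans ?_
    have hba : 0 ≤ b - a := by linarith
    have f1 : ‖∫ τ in a..b, E.f τ‖ ≤ M * (b - a) := by
      have := intervalIntegral.norm_integral_le_of_norm_le_const (a := a) (b := b) (C := M) (f := E.f) (fun σ hσ => by
        rw [uIoc_of_le hab] at hσ
        exact hM σ ⟨ha.trans hσ.1.le, hσ.2.trans hbt⟩)
      rwa [abs_of_nonneg hba] at this
    have f2 : ‖E.x b - E.x a‖ ≤ L * (b - a) := by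
      have := hL a b (hab.trans hbt) hbt
      rwa [abs_of_nonneg hba] at this
    have f3 : ‖E.V a‖ ≤ B := (E.Pn _ _).trans (hB a ⟨ha, hab.trans hbt⟩)
    have f4 : ‖E.f b‖ ≤ M := hM b ⟨ha.trans hab, hbt⟩
    have g1 : -inner ℝ (E.V a) (∫ τ in a..b, E.f τ) ≤ B * (M * (b - a)) :=
      (neg_le_abs _).trans ((abs_real_inner_le_norm _ _).trans (by gcongr))
    have g2 : inner ℝ (E.f b) (E.x b - E.x a) ≤ M * (L * (b - a)) :=
      (real_inner_le_norm _ _).trans (by gcongr)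
    have g3 : ‖∫ τ in a..b, E.f τ‖ ^ 2 ≤ (M * (b - a)) * (M * t) := by
      rw [sq]; gcongr
      exact f1.trans (by gcongr; linarith)
    have g4 : ‖E.x b - E.x a‖ ^ 2 ≤ (L * (b - a)) * (L * t) := by
      rw [sq]; gcongr
      exact f2.trans (by gcongr; linarith)
    have g5 := mul_le_mul_of_nonneg_left g4 hC
    rw [hK]; linarith
  set m : ℝ → ℝ := fun r => K * r - e r with hm
  have hmono : MonotoneOn m (Icc s t) := by
    intro a ha b hb hab
    have := h2 a b (hs.trans ha.1) hab hb.2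
    simp only [hm]; linarith
  have hmono' : MonotoneOn m (uIcc s t) := by rwa [uIcc_of_le hst]
  have hae : ∀ᵐ r ∂(volume : Measure ℝ), r ∈ Ioc s t → K ≤ deriv m r := by
    have a1 : ∀ᵐ r ∂(volume : Measure ℝ), r ∉ N := by
      rw [ae_iff]; simpa using hN.measure_zero volume
    have a2 : ∀ᵐ r ∂(volume : Measure ℝ), r ≠ t := by simp [ae_iff]
    filter_upwards [a1, a2, hmono.ae_differentiableWithinAt_of_mem] with r h1' h2' h3 hr
    have hrt : r < t := lt_of_le_of_ne hr.2 h2'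
    have hr0 : 0 < r := hs.trans_lt hr.1
    have hd : HasDerivAt m (deriv m r) r :=
      ((h3 ⟨hr.1.le, hr.2⟩).differentiableAt (Icc_mem_nhds hr.1 hrt)).hasDerivAt
    have hsl := (hasDerivAt_iff_tendsto_slope.1 hd).mono_left (nhdsWithin_mono r (fun b (hb : r < b) => hb.ne'))
    have hx := (hasDerivAt_iff_tendsto_slope.1 (E.strong_deriv hN hP hr0 h1')).mono_left
      (nhdsWithin_mono r (fun b (hb : r < b) => hb.ne'))
    have hF := (hasDerivAt_iff_tendsto_slope.1 (intervalIntegral.integral_hasDerivAt_right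
      (E.fc.intervalIntegrable r r) (E.fc.stronglyMeasurableAtFilter _ _) E.fc.continuousAt)).mono_left
      (nhdsWithin_mono r (fun b (hb : r < b) => hb.ne'))
    have hfb : Tendsto E.f (𝓝[>] r) (𝓝 (E.f r)) := (E.fc.tendsto r).mono_left nhdsWithin_le_nhds
    have hb0 : Tendsto (fun b => b - r) (𝓝[>] r) (𝓝 0) := by
      have : Tendsto (fun b => b - r) (𝓝 r) (𝓝 (r - r)) := (continuous_id.sub continuous_const).tendsto r
      rw [sub_self] at this
      exact this.mono_left nhdsWithin_le_nhds
    have hlim : Tendsto (fun b => K - (-inner ℝ (E.V r) (slope (fun b => ∫ τ in r..b, E.f τ) r b) +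
        inner ℝ (E.f b) (slope E.x r b) + 1 / 2 * (‖slope (fun b => ∫ τ in r..b, E.f τ) r b‖ ^ 2 * (b - r)) +
        C * (‖slope E.x r b‖ ^ 2 * (b - r)))) (𝓝[>] r)
        (𝓝 (K - (-inner ℝ (E.V r) (E.f r) + inner ℝ (E.f r) (E.V r) + 1 / 2 * (‖E.f r‖ ^ 2 * 0) +
          C * (‖E.V r‖ ^ 2 * 0)))) := by
      refine Tendsto.const_sub _ (((Tendsto.neg ?_).add (hfb.inner hx)).add ?_ |>.add ?_)
      · exact tendsto_const_nhds.inner hF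
      · exact ((hF.norm.pow 2).mul hb0).const_mul _
      · exact ((hx.norm.pow 2).mul hb0).const_mul _
    have e0 : K - (-inner ℝ (E.V r) (E.f r) + inner ℝ (E.f r) (E.V r) + 1 / 2 * (‖E.f r‖ ^ 2 * 0) +
          C * (‖E.V r‖ ^ 2 * 0)) = K := by
      rw [real_inner_comm]; ring
    rw [e0] at hlim
    refine le_of_tendsto_of_tendsto hlim hsl ?_
    filter_upwards [self_mem_nhdsWithin] with b hb
    have hb : r < b := hb
    have hbr : 0 < b - r := by linarith
    have := h1 r b hr0.le hb.le
    have e1 : slope (fun b => ∫ τ in r..b, E.f τ) r b = (b - r)⁻¹ • ∫ τ in r..b, E.f τ := by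
      simp [slope_def_module]
    rw [e1, slope_def_module, slope_def_field, norm_smul, norm_smul, inner_smul_right, inner_smul_right,
      le_div_iff₀ hbr, Real.norm_eq_abs, abs_of_pos (inv_pos.2 hbr)]
    simp only [hm]
    have hne := hbr.ne'
    have e2 : (K - (-((b - r)⁻¹ * inner ℝ (E.V r) (∫ τ in r..b, E.f τ)) + (b - r)⁻¹ * inner ℝ (E.f b) (E.x b - E.x r) +
      1 / 2 * (((b - r)⁻¹ * ‖∫ τ in r..b, E.f τ‖) ^ 2 * (b - r)) +
      C * (((b - r)⁻¹ * ‖E.x b - E.x r‖) ^ 2 * (b - r)))) * (b - r) = K * (b - r) -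
      (-inner ℝ (E.V r) (∫ τ in r..b, E.f τ) +
      inner ℝ (E.f b) (E.x b - E.x r) + 1 / 2 * ‖∫ τ in r..b, E.f τ‖ ^ 2 + C * ‖E.x b - E.x r‖ ^ 2) := by
      field_simp
    rw [e2]
    linarith
  have hi := hmono'.intervalIntegrable_deriv
  have hmem := hmono'.intervalIntegral_deriv_mem_uIcc
  have hms : m s ≤ m t := hmono ⟨le_rfl, hst⟩ ⟨hst, le_rfl⟩ hst
  rw [uIcc_of_le (by linarith)] at hmem
  have hlow : ∫ r in s..t, K ≤ ∫ r in s..t, deriv m r := by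
    refine intervalIntegral.integral_mono_ae_restrict hst intervalIntegrable_const hi ?_
    rw [EventuallyLE, ← restrict_Ioc_eq_restrict_Icc, ae_restrict_iff' measurableSet_Ioc]
    exact hae
  rw [intervalIntegral.integral_const, smul_eq_mul] at hlow
  have := hmem.2
  simp only [hm] at this
  show e t ≤ e s
  linarith

end HF

/-- functions of Y -/
def Sg (ρ : Measure ℝ) (Y : ℝ → ℝ) (hY : Measurable Y) : Submodule ℝ (Lp ℝ 2 ρ) :=
  LinearMap.range (Lp.compMeasurePreservingₗᵢ ℝ (E := ℝ) (p := 2) Y (⟨hY, rfl⟩ : MeasurePreserving Y ρ (ρ.map Y))).toLinearMap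

instance Sg_proj (ρ : Measure ℝ) (Y : ℝ → ℝ) (hY : Measurable Y) : (Sg ρ Y hY).HasOrthogonalProjection := by
  have : CompleteSpace (Sg ρ Y hY) := by
    have h : IsComplete (Set.range (Lp.compMeasurePreservingₗᵢ ℝ (E := ℝ) (p := 2) Y (⟨hY, rfl⟩ : MeasurePreserving Y ρ (ρ.map Y)))) :=
      (LinearIsometry.isometry _).isUniformInducing.isComplete_range
    exact h.completeSpace_coe
  infer_instance

lemma Sg_mem_iff {ρ : Measure ℝ} {Y : ℝ → ℝ} {hY : Measurable Y} {ξ : Lp ℝ 2 ρ} :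
    ξ ∈ Sg ρ Y hY ↔ ∃ u : ℝ → ℝ, Measurable u ∧ ξ =ᵐ[ρ] fun y => u (Y y) := by
  constructor
  · rintro ⟨w, rfl⟩
    obtain ⟨u, hu, hwu⟩ := (Lp.aestronglyMeasurable w).aemeasurable
    refine ⟨u, hu, ?_⟩
    have h1 := Lp.coeFn_compMeasurePreserving w (⟨hY, rfl⟩ : MeasurePreserving Y ρ (ρ.map Y))
    have h2 := ae_of_ae_map hY.aemeasurable hwu
    filter_upwards [h1, h2] with y h3 h4
    refine Eq.trans h3 h4
  · rintro ⟨u, hu, h⟩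
    have h1 : MemLp (fun y => u (Y y)) 2 ρ := (memLp_congr_ae h).1 (Lp.memLp ξ)
    have h2 : MemLp u 2 (ρ.map Y) := (memLp_map_measure_iff hu.aestronglyMeasurable hY.aemeasurable).2 h1
    refine ⟨h2.toLp u, ?_⟩
    refine (Lp.toLp_compMeasurePreserving h2 _).trans ?_
    apply Lp.ext
    refine (MemLp.coeFn_toLp _).trans ?_
    exact h.symm

lemma Sg_dense {ρ : Measure ℝ} [IsProbabilityMeasure ρ] {Y : ℝ → ℝ} {hY : Measurable Y} {z : Lp ℝ 2 ρ}
    (hz : ∀ φ : ℝ → ℝ, (∃ L, ∀ a b, |φ a - φ b| ≤ L * |a - b|) → (∃ M, ∀ a, |φ a| ≤ M) →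
      ∫ y, z y * φ (Y y) ∂ρ = 0) {γ : Lp ℝ 2 ρ} (hγ : γ ∈ Sg ρ Y hY) : inner ℝ z γ = 0 := by
  obtain ⟨w, rfl⟩ := hγ
  have : IsProbabilityMeasure (ρ.map Y) := Measure.isProbabilityMeasure_map hY.aemeasurable
  set J := Lp.compMeasurePreservingₗᵢ ℝ (E := ℝ) (p := 2) Y (⟨hY, rfl⟩ : MeasurePreserving Y ρ (ρ.map Y))
  have hd := Lp.dense_hasCompactSupport_contDiff (E := ℝ) (F := ℝ) (μ := ρ.map Y) (p := 2) (by norm_num)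
  have hcl : IsClosed {w : Lp ℝ 2 (ρ.map Y) | inner ℝ z (J w) = 0} :=
    isClosed_eq (continuous_const.inner J.continuous) continuous_const
  have hsub : {f : Lp ℝ 2 (ρ.map Y) | ∃ g : ℝ → ℝ, f =ᵐ[ρ.map Y] g ∧ HasCompactSupport g ∧ ContDiff ℝ ((⊤ : ℕ∞) : WithTop ℕ∞) g} ⊆
      {w : Lp ℝ 2 (ρ.map Y) | inner ℝ z (J w) = 0} := by
    rintro f ⟨g, hfg, hgc, hgs⟩
    show inner ℝ z (J f) = 0
    rw [inner_Lp]
    obtain ⟨C, hC⟩ := hgs.lipschitzWith_of_hasCompactSupport hgc (by simp)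
    obtain ⟨M, hM⟩ := hgs.continuous.bounded_above_of_compact_support hgc
    rw [← hz g ⟨C, fun a b => by simpa [Real.dist_eq] using hC.dist_le_mul a b⟩ ⟨M, fun a => hM a⟩]
    refine integral_congr_ae ?_
    have h1 := Lp.coeFn_compMeasurePreserving f (⟨hY, rfl⟩ : MeasurePreserving Y ρ (ρ.map Y))
    have h2 := ae_of_ae_map hY.aemeasurable hfg
    filter_upwards [h1, h2] with y h3 h4
    have : (J f) y = g (Y y) := Eq.trans h3 h4
    rw [this]
  exact (hcl.closure_subset_iff.2 hsub) (hd w)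

lemma factor {A : Set ℝ} {a b : ℝ → ℝ} {L : ℝ} (hL : 0 ≤ L)
    (h : ∀ y ∈ A, ∀ y' ∈ A, |b y - b y'| ≤ L * |a y - a y'|) :
    ∃ φ : ℝ → ℝ, LipschitzWith L.toNNReal φ ∧ ∀ y ∈ A, b y = φ (a y) := by
  have h1 : LipschitzOnWith L.toNNReal (fun x => b (Function.invFunOn a A x)) (a '' A) := by
    refine LipschitzOnWith.of_dist_le_mul ?_
    intro x hx x' hx'
    rw [Real.dist_eq, Real.dist_eq, Real.coe_toNNReal _ hL]
    have := h _ (Function.invFunOn_mem hx) _ (Function.invFunOn_mem hx')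
    rwa [Function.invFunOn_eq hx, Function.invFunOn_eq hx'] at this
  obtain ⟨φ, hφ, he⟩ := h1.extend_real
  refine ⟨φ, hφ, fun y hy => ?_⟩
  have hm : a y ∈ a '' A := mem_image_of_mem _ hy
  rw [← he hm]
  have := h _ hy _ (Function.invFunOn_mem hm)
  rw [Function.invFunOn_eq hm, sub_self, abs_zero, mul_zero] at this
  have := abs_nonpos_iff.1 this
  linarith

namespace Dat
variable {D : Dat} {A : Set ℝ} {X : ℝ → ℝ → ℝ}

namespace Flow

lemma mX (F : Flow D A X) (t : ℝ) : Measurable (X t) := F.meas.comp (measurable_const.prodMk measurable_id)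

lemma abs_iii (F : Flow D A X) {s t : ℝ} (hs : 0 < s) (hst : s ≤ t) : ∀ y ∈ A, ∀ y' ∈ A,
    |X t y - X t y'| ≤ D.Sp t / D.Sp s * |X s y - X s y'| := by
  have hp := D.Sp_pos hs
  have key : ∀ y ∈ A, ∀ y' ∈ A, y ≤ y' → |X t y - X t y'| ≤ D.Sp t / D.Sp s * |X s y - X s y'| := by
    intro y hy y' hy' h
    have h1 := F.iii s t hs hst hy hy' h
    have h2 := F.mono t (hs.le.trans hst) hy hy' h
    have h3 := F.mono s hs.le hy hy' h
    simp only at h1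
    rw [abs_of_nonpos (by linarith), abs_of_nonpos (by linarith), div_mul_eq_mul_div, le_div_iff₀ hp]
    nlinarith
  intro y hy y' hy'
  rcases le_total y y' with h | h
  · exact key y hy y' hy' h
  · rw [abs_sub_comm, abs_sub_comm (X s y)]; exact key y' hy' y hy h

lemma abs_ii (F : Flow D A X) {t : ℝ} (ht : 0 ≤ t) : ∀ y ∈ A, ∀ y' ∈ A,
    |X t y - X t y'| ≤ 1 * |D.om t y - D.om t y'| := by
  have key : ∀ y ∈ A, ∀ y' ∈ A, y ≤ y' → |X t y - X t y'| ≤ 1 * |D.om t y - D.om t y'| := by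
    intro y hy y' hy' h
    have h1 := F.ii t ht hy hy' h
    have h2 := F.mono t ht hy hy' h
    simp only at h1
    rw [abs_of_nonpos (by linarith), abs_of_nonpos (by linarith)]
    linarith
  intro y hy y' hy'
  rcases le_total y y' with h | h
  · exact key y hy y' hy' h
  · rw [abs_sub_comm, abs_sub_comm (D.om t y)]; exact key y' hy' y hy h

lemma anti (F : Flow D A X) {s t : ℝ} (hs : 0 ≤ s) (hst : s ≤ t) :
    Sg D.ρ (X t) (F.mX t) ≤ Sg D.ρ (X s) (F.mX s) := by
  intro ξ hξ
  rw [Sg_mem_iff] at hξ ⊢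
  obtain ⟨u, hu, he⟩ := hξ
  rcases hs.eq_or_lt with rfl | hs
  · refine ⟨fun y => u (X t y), hu.comp (F.mX t), ?_⟩
    filter_upwards [he, F.Aae] with y h1 h2
    rw [h1, F.init y h2]
  · obtain ⟨φ, hφ, h⟩ := factor (div_nonneg (Sp_nonneg t) (Sp_nonneg s)) (F.abs_iii hs hst)
    refine ⟨fun x => u (φ x), hu.comp hφ.continuous.measurable, ?_⟩
    filter_upwards [he, F.Aae] with y h1 h2
    rw [h1, h y h2]

lemma hx (F : Flow D A X) (t : ℝ) : MemLp (X (max t 0)) 2 D.ρ := F.L2 _ (le_max_right _ _)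

/-- total L2 path -/
def x (F : Flow D A X) (t : ℝ) : Lp ℝ 2 D.ρ := (F.hx t).toLp _
/-- total force path -/
def f (F : Flow D A X) (t : ℝ) : Lp ℝ 2 D.ρ := (ff_L (F.hx t)).toLp _
/-- projections -/
def P (F : Flow D A X) (t : ℝ) : Lp ℝ 2 D.ρ →L[ℝ] Lp ℝ 2 D.ρ :=
  (Sg D.ρ (X (max t 0)) (F.mX _)).starProjection

lemma x_lip (F : Flow D A X) : ∀ T, ∃ L, 0 ≤ L ∧ ∀ s t, s ≤ T → t ≤ T → ‖F.x t - F.x s‖ ≤ L * |t - s| := by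
  intro T
  obtain ⟨L, hL, h⟩ := F.lip (max T 0)
  refine ⟨L, hL, fun s t hs ht => ?_⟩
  refine (h (max s 0) (max t 0) (le_max_right _ _) (le_max_right _ _) (by gcongr) (by gcongr)).trans ?_
  exact mul_le_mul_of_nonneg_left (abs_max_sub_max_le_abs t s 0) hL

lemma xP (F : Flow D A X) (t : ℝ) : F.P t (F.x t) = F.x t := by
  refine Submodule.starProjection_eq_self_iff.2 ?_
  rw [Sg_mem_iff]
  exact ⟨fun y => y, measurable_id, MemLp.coeFn_toLp _⟩

lemma c2 (F : Flow D A X) (s t : ℝ) (a : Lp ℝ 2 D.ρ) (hst : s ≤ t) : F.P s (F.P t a) = F.P t a := by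
  refine Submodule.starProjection_eq_self_iff.2 ?_
  exact F.anti (le_max_right _ _) (max_le_max hst le_rfl) (Submodule.starProjection_apply_mem _ _)

lemma c1 (F : Flow D A X) (s t : ℝ) (a : Lp ℝ 2 D.ρ) (hst : s ≤ t) : F.P t (F.P s a) = F.P t a := by
  have h := Submodule.starProjection_comp_starProjection_of_le (F.anti (le_max_right _ _) (max_le_max hst le_rfl))
  exact congrArg (fun T : Lp ℝ 2 D.ρ →L[ℝ] Lp ℝ 2 D.ρ => T a) h

lemma orthP (F : Flow D A X) {t : ℝ} (ht : 0 ≤ t) {γ : Lp ℝ 2 D.ρ} (hγ : γ ∈ Sg D.ρ (X t) (F.mX t)) :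
    inner ℝ ((F.ZL t ht).toLp _ - (F.L2 t ht).toLp _) γ = 0 := by
  refine Sg_dense (hY := F.mX t) (fun φ hL hM => ?_) hγ
  rw [← F.orth t ht φ hL hM]
  refine integral_congr_ae ?_
  filter_upwards [Lp.coeFn_sub ((F.ZL t ht).toLp _) ((F.L2 t ht).toLp _), (F.ZL t ht).coeFn_toLp, (F.L2 t ht).coeFn_toLp]
    with y h1 h2 h3
  rw [h1, Pi.sub_apply, h2, h3]

end Flow
end Dat

namespace Dat
variable {D : Dat} {A : Set ℝ} {X : ℝ → ℝ → ℝ}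
namespace Flow

lemma x_cont (F : Flow D A X) : Continuous F.x := by
  rw [continuous_iff_continuousAt]
  intro t
  obtain ⟨L, hL, h⟩ := F.x_lip (t + 1)
  rw [ContinuousAt, tendsto_iff_norm_sub_tendsto_zero]
  have h1 : Tendsto (fun s => L * |s - t|) (𝓝 t) (𝓝 0) := by
    have : Continuous (fun s => L * |s - t|) := by fun_prop
    simpa using this.tendsto t
  refine squeeze_zero' (Eventually.of_forall fun s => norm_nonneg _) ?_ h1
  filter_upwards [gt_mem_nhds (show t < t + 1 by linarith)] with s hs
  exact h t s (by linarith) hs.le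

set_option maxHeartbeats 800000 in
lemma f_cont (F : Flow D A X) : Continuous F.f := by
  rw [continuous_iff_continuousAt]
  intro t
  rw [ContinuousAt, tendsto_iff_seq_tendsto]
  intro s hs
  have hK := D.K0
  have hsx : Tendsto (fun n => F.x (s n)) atTop (𝓝 (F.x t)) := (F.x_cont.tendsto t).comp hs
  obtain ⟨R, hR⟩ : ∃ R, ∀ n, ‖F.x (s n)‖ ≤ R := by
    obtain ⟨R, hR⟩ := hsx.norm.bddAbove_range
    exact ⟨R, fun n => hR (mem_range_self n)⟩
  have hR0 : 0 ≤ R := (norm_nonneg _).trans (hR 0)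
  set R1 := R + ‖F.x t‖ with hR1
  have hpt : ∀ y ∈ A, Tendsto (fun n => X (max (s n) 0) y) atTop (𝓝 (X (max t 0) y)) := by
    intro y hy
    have h1 := F.cont y hy (max t 0) (mem_Ici.2 (le_max_right _ _))
    have h2 : Tendsto (fun n => max (s n) 0) atTop (𝓝[Ici 0] (max t 0)) :=
      tendsto_nhdsWithin_iff.2 ⟨hs.max tendsto_const_nhds, Eventually.of_forall fun n => mem_Ici.2 (le_max_right _ _)⟩
    exact h1.tendsto.comp h2
  have hff : ∀ y ∈ A, Tendsto (fun n => D.ff (X (max (s n) 0)) y) atTop (𝓝 (D.ff (X (max t 0)) y)) := by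
    intro y hy
    refine ff_tendsto' (fun n => F.hx (s n)) hR ?_ (hpt y hy)
    filter_upwards [F.Aae] with z hz using hpt z hz
  let h : ℕ → ℝ → ℝ := fun n y => |D.ff (X (max (s n) 0)) y - D.ff (X (max t 0)) y|
  let G : ℝ → ℝ := fun y => 2 * D.K * (1 + |X (max t 0) y| + R1)
  let d : ℕ → ℝ → ℝ := fun n y => X (max (s n) 0) y - X (max t 0) y
  have hhL : ∀ n, MemLp (h n) 2 D.ρ := fun n => ((ff_L (F.hx (s n))).sub (ff_L (F.hx t))).abs
  have hGL : MemLp G 2 D.ρ := by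
    have h1 : MemLp (fun y => |X (max t 0) y|) 2 D.ρ := (F.hx t).abs
    have : MemLp (fun y => (1 + R1) + |X (max t 0) y|) 2 D.ρ := (memLp_const (1 + R1)).add h1
    have := this.const_mul (2 * D.K)
    refine this.ae_eq (Eventually.of_forall fun y => ?_)
    simp only [G]; ring
  have hdL : ∀ n, MemLp (d n) 2 D.ρ := fun n => (F.hx (s n)).sub (F.hx t)
  have hG0 : ∀ y, 0 ≤ G y := fun y => by simp only [G]; positivity
  have hle : ∀ n y, h n y ≤ min (h n y) (G y) + D.K * |d n y| := by
    intro n y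
    have h1 := ff_bd (F.hx (s n)) y
    have h2 := ff_bd (F.hx t) y
    have h3 := abs_sub (D.ff (X (max (s n) 0)) y) (D.ff (X (max t 0)) y)
    have h4 : |X (max (s n) 0) y| ≤ |X (max t 0) y| + |d n y| := by
      have := abs_add_le (X (max t 0) y) (d n y)
      simpa [d] using this
    have h5 := hR n
    have h6 : ‖(F.hx (s n)).toLp _‖ ≤ R := h5
    have h7 : ‖(F.hx t).toLp _‖ = ‖F.x t‖ := rfl
    have h8 : 0 ≤ ‖F.x t‖ := norm_nonneg _
    have hb : h n y ≤ G y + D.K * |d n y| := by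
      calc h n y ≤ D.K * (1 + |X (max (s n) 0) y| + ‖(F.hx (s n)).toLp _‖) + D.K * (1 + |X (max t 0) y| + ‖(F.hx t).toLp _‖) := h3.trans (add_le_add h1 h2)
        _ ≤ D.K * (1 + (|X (max t 0) y| + |d n y|) + R1) + D.K * (1 + |X (max t 0) y| + R1) := by
            gcongr
            · linarith
            · rw [h7]; linarith
        _ = _ := by simp only [G]; ring
    rcases le_total (h n y) (G y) with h9 | h9
    · rw [min_eq_left h9]; have : 0 ≤ D.K * |d n y| := by positivity
      linarith
    · rw [min_eq_right h9]; exact hb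
  have hmL : ∀ n, MemLp (fun y => min (h n y) (G y)) 2 D.ρ := fun n => by
    refine hGL.of_le ((hhL n).1.inf hGL.1) (Eventually.of_forall fun y => ?_)
    rw [Real.norm_eq_abs, Real.norm_eq_abs, abs_of_nonneg (hG0 y), abs_of_nonneg (le_min (abs_nonneg _) (hG0 y))]
    exact min_le_right _ _
  have hm : Tendsto (fun n => ∫ y, (min (h n y) (G y)) ^ 2 ∂D.ρ) atTop (𝓝 0) := by
    have := tendsto_integral_of_dominated_convergence (F := fun n y => (min (h n y) (G y)) ^ 2) (f := fun _ => 0)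
      (μ := D.ρ) (fun y => (G y) ^ 2) (fun n => (hmL n).integrable_sq.1) hGL.integrable_sq
      (fun n => Eventually.of_forall fun y => ?_) ?_
    · simpa using this
    · have h0 : 0 ≤ min (h n y) (G y) := le_min (abs_nonneg _) (hG0 y)
      have h1 := min_le_right (h n y) (G y)
      rw [Real.norm_eq_abs, abs_of_nonneg (sq_nonneg _)]
      gcongr
    · filter_upwards [F.Aae] with y hy
      have h1 : Tendsto (fun n => h n y) atTop (𝓝 0) := by
        have := ((hff y hy).sub_const (D.ff (X (max t 0)) y)).abs
        simpa [h] using this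
      have h2 := (h1.min (tendsto_const_nhds (x := G y))).pow 2
      rw [min_eq_left (hG0 y)] at h2
      simpa using h2
  have hd : Tendsto (fun n => ‖F.x (s n) - F.x t‖ ^ 2) atTop (𝓝 0) := by
    have := (tendsto_iff_norm_sub_tendsto_zero.1 hsx).pow 2
    simpa using this
  have key : ∀ n, ‖F.f (s n) - F.f t‖ ^ 2 ≤ 2 * (∫ y, (min (h n y) (G y)) ^ 2 ∂D.ρ) + 2 * D.K ^ 2 * ‖F.x (s n) - F.x t‖ ^ 2 := by
    intro n
    have e1 : F.f (s n) - F.f t = ((ff_L (F.hx (s n))).sub (ff_L (F.hx t))).toLp _ := (MemLp.toLp_sub _ _).symm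
    have e2 : F.x (s n) - F.x t = (hdL n).toLp _ := (MemLp.toLp_sub _ _).symm
    rw [e1, e2, normsq_toLp, normsq_toLp, ← integral_const_mul, ← integral_const_mul,
      ← integral_add ((hmL n).integrable_sq.const_mul _) ((hdL n).integrable_sq.const_mul _)]
    refine integral_mono ((ff_L (F.hx (s n))).sub (ff_L (F.hx t))).integrable_sq
      (((hmL n).integrable_sq.const_mul _).add ((hdL n).integrable_sq.const_mul _)) fun y => ?_
    have h1 := hle n y
    have h0 : 0 ≤ h n y := abs_nonneg _
    have h2 : (D.ff (X (max (s n) 0)) y - D.ff (X (max t 0)) y) ^ 2 = (h n y) ^ 2 := (sq_abs _).symm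
    simp only [Pi.sub_apply]
    rw [h2, ← sq_abs (d n y)]
    nlinarith [sq_nonneg (min (h n y) (G y) - D.K * |d n y|)]
  have hlim : Tendsto (fun n => ‖F.f (s n) - F.f t‖ ^ 2) atTop (𝓝 0) := by
    refine squeeze_zero (fun n => by positivity) key ?_
    have := (hm.const_mul 2).add (hd.const_mul (2 * D.K ^ 2))
    simpa using this
  rw [tendsto_iff_norm_sub_tendsto_zero]
  have := hlim.sqrt
  simpa using this

end Flow
end Dat

lemma fub {ρ : Measure ℝ} [IsProbabilityMeasure ρ] {h : ℝ → ℝ → ℝ} (hm : Measurable (fun p : ℝ × ℝ => h p.1 p.2))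
    {t : ℝ} (ht : 0 ≤ t) {C : ℝ} (hL : ∀ τ, 0 ≤ τ → τ ≤ t → MemLp (h τ) 2 ρ)
    (hC : ∀ τ, 0 ≤ τ → τ ≤ t → ∫ y, (h τ y) ^ 2 ∂ρ ≤ C) (γ : Lp ℝ 2 ρ) :
    Integrable (fun y => (∫ τ in (0:ℝ)..t, h τ y) * γ y) ρ ∧
    ∫ y, (∫ τ in (0:ℝ)..t, h τ y) * γ y ∂ρ = ∫ τ in (0:ℝ)..t, ∫ y, h τ y * γ y ∂ρ := by
  have hγm : Measurable (γ : ℝ → ℝ) := (Lp.stronglyMeasurable γ).measurable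
  have hΦ : Measurable (fun p : ℝ × ℝ => h p.1 p.2 * γ p.2) := hm.mul (hγm.comp measurable_snd)
  have hi : ∀ τ, 0 ≤ τ → τ ≤ t → Integrable (fun y => h τ y * γ y) ρ := fun τ h1 h2 =>
    (hL τ h1 h2).integrable_mul (Lp.memLp γ)
  have hI : Integrable (fun p : ℝ × ℝ => h p.1 p.2 * γ p.2) ((volume.restrict (Ioc 0 t)).prod ρ) := by
    rw [integrable_prod_iff hΦ.aestronglyMeasurable]
    constructor
    · filter_upwards [ae_restrict_mem measurableSet_Ioc] with τ hτ
      exact hi τ hτ.1.le hτ.2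
    · refine Integrable.of_bound (C := 1/2 * (C + ∫ y, (γ y) ^ 2 ∂ρ))
        (hΦ.stronglyMeasurable.norm.integral_prod_right' (ν := ρ)).aestronglyMeasurable ?_
      filter_upwards [ae_restrict_mem measurableSet_Ioc] with τ hτ
      rw [Real.norm_eq_abs, abs_of_nonneg (integral_nonneg fun y => norm_nonneg _)]
      have i1 : Integrable (fun y => (h τ y) ^ 2) ρ := (hL τ hτ.1.le hτ.2).integrable_sq
      have i2 : Integrable (fun y => (γ y) ^ 2) ρ := (Lp.memLp γ).integrable_sq
      have : ∫ y, ‖h τ y * γ y‖ ∂ρ ≤ ∫ y, 1/2 * ((h τ y) ^ 2 + (γ y) ^ 2) ∂ρ := by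
        refine integral_mono (hi τ hτ.1.le hτ.2).norm ((i1.add i2).const_mul _) fun y => ?_
        simp only [norm_mul, Real.norm_eq_abs]
        rw [← sq_abs (h τ y), ← sq_abs (γ y)]
        nlinarith [sq_nonneg (|h τ y| - |γ y|)]
      refine this.trans ?_
      rw [integral_const_mul, integral_add i1 i2]
      have := hC τ hτ.1.le hτ.2
      linarith
  have e : ∀ y, (∫ τ in (0:ℝ)..t, h τ y) * γ y = ∫ τ in Ioc 0 t, h τ y * γ y := by
    intro y
    rw [intervalIntegral.integral_of_le ht, ← integral_mul_const]
  simp_rw [e]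
  refine ⟨hI.integral_prod_right, ?_⟩
  rw [intervalIntegral.integral_of_le ht]
  exact (integral_integral_swap (f := fun τ y => h τ y * γ y) hI).symm

namespace Dat
variable {D : Dat} {A : Set ℝ} {X : ℝ → ℝ → ℝ}
namespace Flow

lemma ff_meas (F : Flow D A X) : Measurable (fun p : ℝ × ℝ => D.ff (X p.1) p.2) := by
  have h1 : Measurable (fun q : (ℝ × ℝ) × ℝ => D.g (X q.1.1 q.1.2 - X q.1.1 q.2)) := by
    refine D.gc.measurable.comp (Measurable.sub ?_ ?_)
    · exact F.meas.comp measurable_fst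
    · exact F.meas.comp ((measurable_fst.comp measurable_fst).prodMk measurable_snd)
  exact (h1.stronglyMeasurable.integral_prod_right' (ν := D.ρ)).measurable

lemma x_eq (F : Flow D A X) {t : ℝ} (ht : 0 ≤ t) : F.x t = (F.L2 t ht).toLp _ := by
  unfold x
  congr 1
  rw [max_eq_left ht]

lemma f_eq (F : Flow D A X) {t : ℝ} (ht : 0 ≤ t) : F.f t = (ff_L (F.L2 t ht)).toLp _ := by
  unfold f
  congr 1
  rw [max_eq_left ht]

lemma P_eq (F : Flow D A X) {t : ℝ} (ht : 0 ≤ t) : F.P t = (Sg D.ρ (X t) (F.mX t)).starProjection := by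
  unfold P
  congr 1
  simp only [max_eq_left ht]

lemma x_ae (F : Flow D A X) {t : ℝ} (ht : 0 ≤ t) : F.x t =ᵐ[D.ρ] X t := by
  rw [F.x_eq ht]; exact MemLp.coeFn_toLp _

lemma f_ae (F : Flow D A X) {t : ℝ} (ht : 0 ≤ t) : F.f t =ᵐ[D.ρ] D.ff (X t) := by
  rw [F.f_eq ht]; exact MemLp.coeFn_toLp _

lemma ipf (F : Flow D A X) {t : ℝ} (ht : 0 ≤ t) (γ : Lp ℝ 2 D.ρ) :
    Integrable (fun y => (∫ τ in (0:ℝ)..t, D.ff (X τ) y) * γ y) D.ρ ∧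
    ∫ y, (∫ τ in (0:ℝ)..t, D.ff (X τ) y) * γ y ∂D.ρ = ∫ τ in (0:ℝ)..t, inner ℝ (F.f τ) γ := by
  obtain ⟨R, hR0, hR⟩ := F.bd t
  have hK := D.K0
  have := fub (ρ := D.ρ) F.ff_meas ht (C := (3 * D.K * (1 + R)) ^ 2) (fun τ h1 h2 => ff_L (F.L2 τ h1)) (fun τ h1 h2 => by
    rw [← normsq_toLp (ff_L (F.L2 τ h1))]
    have h3 := ff_norm (F.L2 τ h1)
    have h4 := hR τ h1 h2
    gcongr
    exact h3.trans (by gcongr)) γ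
  refine ⟨this.1, this.2.trans ?_⟩
  refine intervalIntegral.integral_congr fun τ hτ => ?_
  rw [uIcc_of_le ht] at hτ
  rw [inner_Lp]
  refine integral_congr_ae ?_
  filter_upwards [F.f_ae hτ.1] with y hy
  rw [hy]

lemma ipZ (F : Flow D A X) {t : ℝ} (ht : 0 ≤ t) (γ : Lp ℝ 2 D.ρ) :
    inner ℝ ((F.ZL t ht).toLp _) γ = D.Ch t * inner ℝ D.iL γ + D.Sp t * inner ℝ D.wL γ -
      ∫ τ in (0:ℝ)..t, D.Sp (t - τ) * (inner ℝ (F.f τ) γ + D.c * inner ℝ (F.x τ) γ) := by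
  obtain ⟨R, hR0, hR⟩ := F.bd t
  have hK := D.K0
  have hc := D.hc
  have hhL : ∀ τ, 0 ≤ τ → MemLp (fun y => D.ff (X τ) y + D.c * X τ y) 2 D.ρ := fun τ h =>
    (ff_L (F.L2 τ h)).add ((F.L2 τ h).const_mul D.c)
  have hm : Measurable (fun p : ℝ × ℝ => D.Sp (t - p.1) * (D.ff (X p.1) p.2 + D.c * X p.1 p.2)) := by
    refine Measurable.mul ?_ (F.ff_meas.add (F.meas.const_mul _))
    exact D.Sp_cont.measurable.comp (measurable_const.sub measurable_fst)
  have := fub (ρ := D.ρ) (h := fun τ y => D.Sp (t - τ) * (D.ff (X τ) y + D.c * X τ y)) hm ht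
    (C := (D.Sp t) ^ 2 * (3 * D.K * (1 + R) + D.c * R) ^ 2) (fun τ h1 h2 => (hhL τ h1).const_mul _) (fun τ h1 h2 => by
    simp_rw [mul_pow]
    rw [integral_const_mul]
    have h5 : D.Sp (t - τ) ≤ D.Sp t := Sp_mono (by linarith)
    have h6 := D.Sp_nonneg (t - τ)
    have h7 : ∫ y, (D.ff (X τ) y + D.c * X τ y) ^ 2 ∂D.ρ ≤ (3 * D.K * (1 + R) + D.c * R) ^ 2 := by
      have e : (hhL τ h1).toLp _ = (ff_L (F.L2 τ h1)).toLp _ + D.c • (F.L2 τ h1).toLp _ := rfl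
      rw [← normsq_toLp (hhL τ h1)]
      have h3 := ff_norm (F.L2 τ h1)
      have h4 := hR τ h1 h2
      gcongr
      rw [e]
      refine (norm_add_le _ _).trans ?_
      rw [norm_smul, Real.norm_eq_abs, abs_of_pos hc]
      gcongr
      exact h3.trans (by gcongr)
    gcongr) γ
  have eZ : inner ℝ ((F.ZL t ht).toLp _) γ = ∫ y, D.ZZ X t y * γ y ∂D.ρ := by
    rw [inner_Lp]
    refine integral_congr_ae ?_
    filter_upwards [(F.ZL t ht).coeFn_toLp] with y hy
    rw [hy]
  have ei : inner ℝ D.iL γ = ∫ y, y * γ y ∂D.ρ := by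
    rw [inner_Lp]
    refine integral_congr_ae ?_
    filter_upwards [D.idL.coeFn_toLp] with y hy
    simp only [iL]
    rw [hy]
  have ew : inner ℝ D.wL γ = ∫ y, D.v y * γ y ∂D.ρ := by
    rw [inner_Lp]
    refine integral_congr_ae ?_
    filter_upwards [D.vL.coeFn_toLp] with y hy
    simp only [wL]
    rw [hy]
  have i1 : Integrable (fun y => y * γ y) D.ρ := D.idL.integrable_mul (Lp.memLp γ)
  have i2 : Integrable (fun y => D.v y * γ y) D.ρ := D.vL.integrable_mul (Lp.memLp γ)
  rw [eZ, ei, ew, ← integral_const_mul, ← integral_const_mul, ← integral_add (i1.const_mul _) (i2.const_mul _)]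
  have e3 : ∫ τ in (0:ℝ)..t, D.Sp (t - τ) * (inner ℝ (F.f τ) γ + D.c * inner ℝ (F.x τ) γ) =
      ∫ τ in (0:ℝ)..t, ∫ y, (D.Sp (t - τ) * (D.ff (X τ) y + D.c * X τ y)) * γ y ∂D.ρ := by
    refine intervalIntegral.integral_congr fun τ hτ => ?_
    rw [uIcc_of_le ht] at hτ
    have j1 : Integrable (fun y => F.f τ y * γ y) D.ρ := (Lp.memLp (F.f τ)).integrable_mul (Lp.memLp γ)
    have j2 : Integrable (fun y => F.x τ y * γ y) D.ρ := (Lp.memLp (F.x τ)).integrable_mul (Lp.memLp γ)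
    rw [inner_Lp, inner_Lp, ← integral_const_mul,
      ← integral_add j1 (j2.const_mul _),
      ← integral_const_mul]
    refine integral_congr_ae ?_
    filter_upwards [F.f_ae hτ.1, F.x_ae hτ.1] with y h1 h2
    rw [h1, h2]; ring
  have i3 : Integrable (fun y => D.Ch t * (y * γ y) + D.Sp t * (D.v y * γ y)) D.ρ := (i1.const_mul _).add (i2.const_mul _)
  rw [e3, ← this.2, ← integral_sub i3 this.1]
  refine integral_congr_ae (Eventually.of_forall fun y => ?_)
  simp only [ZZ]
  ring

end Flow
end Dat

lemma volterra {k i w r : ℝ} (hk : 0 < k) {a φ : ℝ → ℝ} (ha : Continuous a) (hφ : Continuous φ)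
    (h : ∀ s, 0 ≤ s → s ≤ r → a s = Real.cosh (k * s) * i + Real.sinh (k * s) / k * w -
      ∫ τ in (0:ℝ)..s, Real.sinh (k * (s - τ)) / k * (φ τ + k ^ 2 * a τ))
    {s : ℝ} (hs : 0 ≤ s) (hsr : s ≤ r) :
    a r - a s = ∫ σ in s..r, (w - ∫ τ in (0:ℝ)..σ, φ τ) := by
  let q : ℝ → ℝ := fun τ => φ τ + k ^ 2 * a τ
  have hq : Continuous q := by fun_prop
  let C : ℝ → ℝ := fun s => ∫ τ in (0:ℝ)..s, Real.cosh (k * τ) * q τ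
  let S : ℝ → ℝ := fun s => ∫ τ in (0:ℝ)..s, Real.sinh (k * τ) * q τ
  have cc : Continuous fun τ => Real.cosh (k * τ) * q τ := (Real.continuous_cosh.comp (by fun_prop)).mul hq
  have cs : Continuous fun τ => Real.sinh (k * τ) * q τ := (Real.continuous_sinh.comp (by fun_prop)).mul hq
  have dC : ∀ s, HasDerivAt C (Real.cosh (k * s) * q s) s := fun s => intervalIntegral.integral_hasDerivAt_right (cc.intervalIntegrable _ _) cc.stronglyMeasurable.stronglyMeasurableAtFilter cc.continuousAt
  have dS : ∀ s, HasDerivAt S (Real.sinh (k * s) * q s) s := fun s => intervalIntegral.integral_hasDerivAt_right (cs.intervalIntegrable _ _) cs.stronglyMeasurable.stronglyMeasurableAtFilter cs.continuousAt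
  have dk : ∀ s, HasDerivAt (fun s : ℝ => k * s) k s := fun s => by simpa using (hasDerivAt_id s).const_mul k
  have dch : ∀ s, HasDerivAt (fun s : ℝ => Real.cosh (k * s)) (Real.sinh (k * s) * k) s := fun s => (dk s).cosh
  have dsh : ∀ s, HasDerivAt (fun s : ℝ => Real.sinh (k * s)) (Real.cosh (k * s) * k) s := fun s => (dk s).sinh
  let A : ℝ → ℝ := fun s => Real.cosh (k * s) * i + Real.sinh (k * s) * (w / k) - (Real.sinh (k * s) * C s - Real.cosh (k * s) * S s) / k
  let B : ℝ → ℝ := fun s => Real.sinh (k * s) * (k * i) + Real.cosh (k * s) * w - (Real.cosh (k * s) * C s - Real.sinh (k * s) * S s)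
  have dA : ∀ s, HasDerivAt A (B s) s := by
    intro s
    have := (((dch s).mul_const i).add ((dsh s).mul_const (w / k))).sub ((((dsh s).mul (dC s)).sub ((dch s).mul (dS s))).div_const k)
    refine this.congr_deriv ?_
    simp only [B]
    field_simp
    ring
  have dB : ∀ s, HasDerivAt B (k ^ 2 * A s - q s) s := by
    intro s
    have := (((dsh s).mul_const (k * i)).add ((dch s).mul_const w)).sub (((dch s).mul (dC s)).sub ((dsh s).mul (dS s)))
    refine this.congr_deriv ?_
    simp only [A]
    have hcs := Real.cosh_sq (k * s)
    field_simp
    linear_combination (-(q s)) * hcs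
  have hA : ∀ s, 0 ≤ s → s ≤ r → a s = A s := by
    intro s h0 h1
    rw [h s h0 h1]
    simp only [A]
    have e : ∫ τ in (0:ℝ)..s, Real.sinh (k * (s - τ)) / k * (φ τ + k ^ 2 * a τ) = (Real.sinh (k * s) * C s - Real.cosh (k * s) * S s) / k := by
      simp only [C, S]
      rw [← intervalIntegral.integral_const_mul, ← intervalIntegral.integral_const_mul,
        ← intervalIntegral.integral_sub ((cc.const_mul _).intervalIntegrable _ _) ((cs.const_mul _).intervalIntegrable _ _),
        ← intervalIntegral.integral_div]
      refine intervalIntegral.integral_congr fun τ _ => ?_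
      simp only [q]
      rw [mul_sub, Real.sinh_sub]
      ring
    rw [e]
    ring
  have hB : ∀ σ, 0 ≤ σ → σ ≤ r → B σ = w - ∫ τ in (0:ℝ)..σ, φ τ := by
    intro σ h0 h1
    have e := intervalIntegral.integral_eq_sub_of_hasDerivAt (a := 0) (b := σ) (f := B) (f' := fun τ => - φ τ) (fun τ hτ => by
      rw [uIcc_of_le h0] at hτ
      refine (dB τ).congr_deriv ?_
      simp only [q]
      rw [hA τ hτ.1 (hτ.2.trans h1)]; ring) (hφ.neg.intervalIntegrable _ _)
    have e0 : B 0 = w := by simp [B, C, S]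
    rw [intervalIntegral.integral_neg, e0] at e
    linarith
  rw [hA r (hs.trans hsr) le_rfl, hA s hs hsr]
  have cB : Continuous B := continuous_iff_continuousAt.2 fun s => (dB s).continuousAt
  rw [← intervalIntegral.integral_eq_sub_of_hasDerivAt (fun τ _ => dA τ) (cB.intervalIntegrable _ _)]
  refine intervalIntegral.integral_congr fun τ hτ => ?_
  rw [uIcc_of_le hsr] at hτ
  exact hB τ (hs.trans hτ.1) hτ.2

namespace Dat
variable {D : Dat} {A : Set ℝ} {X : ℝ → ℝ → ℝ}
namespace Flow

lemma inner_u (F : Flow D A X) (σ : ℝ) (γ : Lp ℝ 2 D.ρ) : inner ℝ (D.wL - ∫ τ in (0:ℝ)..σ, F.f τ) γ =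
    inner ℝ D.wL γ - ∫ τ in (0:ℝ)..σ, inner ℝ (F.f τ) γ := by
  rw [inner_sub_left]
  congr 1
  have h := (innerSL ℝ γ).intervalIntegral_comp_comm (F.f_cont.intervalIntegrable (μ := volume) 0 σ)
  simp only [innerSL_apply_apply] at h
  rw [real_inner_comm, ← h]
  refine intervalIntegral.integral_congr fun τ _ => real_inner_comm _ _

lemma star (F : Flow D A X) (s r : ℝ) (γ : Lp ℝ 2 D.ρ) (hs : 0 ≤ s) (hsr : s ≤ r) :
    inner ℝ (F.x r - F.x s) (F.P r γ) = ∫ σ in s..r, inner ℝ (D.wL - ∫ τ in (0:ℝ)..σ, F.f τ) (F.P r γ) := by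
  have hr := hs.trans hsr
  have hmem : F.P r γ ∈ Sg D.ρ (X r) (F.mX r) := by
    rw [F.P_eq hr]; exact Submodule.starProjection_apply_mem _ _
  generalize F.P r γ = ξ at hmem
  simp_rw [inner_u]
  rw [inner_sub_left]
  have hk := D.k0
  have hk2 : (√D.c) ^ 2 = D.c := Real.sq_sqrt D.hc.le
  refine volterra (i := inner ℝ D.iL ξ) hk (a := fun τ => inner ℝ (F.x τ) ξ) (φ := fun τ => inner ℝ (F.f τ) ξ)
    (F.x_cont.inner continuous_const) (F.f_cont.inner continuous_const) (fun τ h0 h1 => ?_) hs hsr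
  have h2 := F.orthP h0 (F.anti h0 h1 hmem)
  rw [← F.x_eq h0, inner_sub_left, sub_eq_zero] at h2
  rw [← h2, F.ipZ h0, D.Sp_of_nonneg h0]
  congr 1
  refine intervalIntegral.integral_congr fun σ hσ => ?_
  rw [uIcc_of_le h0] at hσ
  rw [D.Sp_of_nonneg (by linarith [hσ.2]), hk2]

/-- the Hilbert flow -/
def hf (F : Flow D A X) : HF (Lp ℝ 2 D.ρ) where
  P := F.P
  x := F.x
  f := F.f
  v := D.wL
  Pn := fun _ a => Submodule.norm_starProjection_apply_le _ a
  sym := fun _ a b => Submodule.inner_starProjection_left_eq_right _ a b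
  c1 := F.c1
  c2 := F.c2
  xP := F.xP
  lip := F.x_lip
  fc := F.f_cont
  star := F.star

end Flow
end Dat

namespace Dat
variable {D : Dat} {A : Set ℝ} {X : ℝ → ℝ → ℝ}

lemma W_ineq (a b : ℝ) : D.W b - D.W a ≤ D.g b * (b - a) + D.c / 2 * (b - a) ^ 2 := by
  let h : ℝ → ℝ := fun x => D.W x + D.c / 2 * x ^ 2
  have dh : ∀ x, HasDerivAt h (D.g x + D.c * x) x := fun x => by
    have := (D.hW x).add (((hasDerivAt_id x).pow 2).const_mul (D.c / 2))
    refine this.congr_deriv ?_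
    simp; ring
  have ch : Continuous h := continuous_iff_continuousAt.2 fun x => (dh x).continuousAt
  have key : h b - h a ≤ (D.g b + D.c * b) * (b - a) := by
    rcases lt_trichotomy a b with hab | hab | hab
    · obtain ⟨ξ, hξ, e⟩ := exists_hasDerivAt_eq_slope h (fun x => D.g x + D.c * x) hab ch.continuousOn (fun x _ => dh x)
      have hm := D.gm hξ.2.le
      simp only at hm e
      rw [eq_div_iff (by linarith)] at e
      rw [← e]
      exact mul_le_mul_of_nonneg_right hm (by linarith)
    · subst hab; simp
    · obtain ⟨ξ, hξ, e⟩ := exists_hasDerivAt_eq_slope h (fun x => D.g x + D.c * x) hab ch.continuousOn (fun x _ => dh x)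
      have hm := D.gm hξ.1.le
      simp only at hm e
      rw [eq_div_iff (by linarith)] at e
      have : (D.g b + D.c * b) * (a - b) ≤ h a - h b := by
        rw [← e]; exact mul_le_mul_of_nonneg_right hm (by linarith)
      linarith
  simp only [h] at key
  nlinarith

lemma W_bd (x : ℝ) : |D.W x| ≤ |D.W 0| + D.K * (1 + 2 * x ^ 2) := by
  have hK := D.K0
  have h := (convex_Icc (-|x|) |x|).norm_image_sub_le_of_norm_hasDerivWithin_le (f := D.W) (f' := D.g) (C := D.K * (1 + |x|))
    (fun y _ => (D.hW y).hasDerivWithinAt) (fun y hy => by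
      refine (D.gK y).trans ?_
      have : |y| ≤ |x| := abs_le.2 hy
      gcongr) (x := 0) (y := x) (by constructor <;> simp) (by constructor <;> [exact neg_abs_le x; exact le_abs_self x])
  rw [Real.norm_eq_abs, Real.norm_eq_abs, sub_zero] at h
  have h2 := abs_sub_abs_le_abs_sub (D.W x) (D.W 0)
  have h3 : D.K * (1 + |x|) * |x| ≤ D.K * (1 + 2 * x ^ 2) := by
    rw [mul_assoc, ← sq_abs x]
    gcongr
    nlinarith [sq_nonneg (|x| - 1)]
  linarith

lemma W_cont : Continuous D.W := continuous_iff_continuousAt.2 fun x => (D.hW x).continuousAt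

/-- potential energy -/
def pot (D : Dat) (Y : ℝ → ℝ) : ℝ := ∫ y, ∫ z, (1/2) * D.W (Y y - Y z) ∂D.ρ ∂D.ρ

lemma q1 {Y : ℝ → ℝ} (hY : MemLp Y 2 D.ρ) : Integrable (fun p : ℝ × ℝ => (Y p.1) ^ 2) (D.ρ.prod D.ρ) :=
  hY.integrable_sq.comp_fst D.ρ
lemma q2 {Y : ℝ → ℝ} (hY : MemLp Y 2 D.ρ) : Integrable (fun p : ℝ × ℝ => (Y p.2) ^ 2) (D.ρ.prod D.ρ) :=
  hY.integrable_sq.comp_snd D.ρ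
lemma q3 {Y : ℝ → ℝ} (hY : MemLp Y 2 D.ρ) : AEStronglyMeasurable (fun p : ℝ × ℝ => Y p.1 - Y p.2) (D.ρ.prod D.ρ) :=
  hY.1.comp_fst.sub hY.1.comp_snd

lemma W_int {Y : ℝ → ℝ} (hY : MemLp Y 2 D.ρ) : Integrable (fun p : ℝ × ℝ => (1/2) * D.W (Y p.1 - Y p.2)) (D.ρ.prod D.ρ) := by
  refine Integrable.const_mul ?_ _
  have hb : Integrable (fun p : ℝ × ℝ => |D.W 0| + D.K * (1 + 4 * ((Y p.1) ^ 2 + (Y p.2) ^ 2))) (D.ρ.prod D.ρ) :=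
    (integrable_const _).add (((integrable_const _).add (((q1 hY).add (q2 hY)).const_mul _)).const_mul _)
  refine hb.mono' (D.W_cont.comp_aestronglyMeasurable (q3 hY)) (Eventually.of_forall fun p => ?_)
  refine (W_bd _).trans ?_
  have := D.K0
  have h2 : 2 * (Y p.1 - Y p.2) ^ 2 ≤ 4 * ((Y p.1) ^ 2 + (Y p.2) ^ 2) := by nlinarith [sq_nonneg (Y p.1 + Y p.2)]
  have h3 := mul_le_mul_of_nonneg_left (add_le_add_right h2 1) this
  linarith

lemma gd_int {Z d : ℝ → ℝ} (hZ : MemLp Z 2 D.ρ) (hd : MemLp d 2 D.ρ) :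
    Integrable (fun p : ℝ × ℝ => D.g (Z p.1 - Z p.2) * d p.1) (D.ρ.prod D.ρ) := by
  have hb : Integrable (fun p : ℝ × ℝ => D.K * (3 * (1 + (Z p.1) ^ 2 + (Z p.2) ^ 2) + (d p.1) ^ 2)) (D.ρ.prod D.ρ) :=
    (((((integrable_const _).add (q1 hZ)).add (q2 hZ)).const_mul _).add (q1 hd)).const_mul _
  refine hb.mono' ((D.gc.comp_aestronglyMeasurable (q3 hZ)).mul hd.1.comp_fst) (Eventually.of_forall fun p => ?_)
  rw [norm_mul, Real.norm_eq_abs, Real.norm_eq_abs]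
  have h := g_bd (D := D) (Z p.1) (Z p.2)
  have hK := D.K0
  calc _ ≤ D.K * (1 + |Z p.1| + |Z p.2|) * |d p.1| := by gcongr
    _ ≤ _ := by
      rw [mul_assoc, ← sq_abs (Z p.1), ← sq_abs (Z p.2), ← sq_abs (d p.1)]
      gcongr
      nlinarith [sq_nonneg (1 + |Z p.1| + |Z p.2| - |d p.1|), sq_nonneg (1 - |Z p.1|), sq_nonneg (1 - |Z p.2|),
        sq_nonneg (|Z p.1| - |Z p.2|), sq_nonneg (1 + |Z p.1| + |Z p.2|), sq_nonneg (|d p.1|)]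

lemma gd_eq {Z d : ℝ → ℝ} (hZ : MemLp Z 2 D.ρ) (hd : MemLp d 2 D.ρ) :
    ∫ p : ℝ × ℝ, D.g (Z p.1 - Z p.2) * d p.1 ∂(D.ρ.prod D.ρ) = ∫ y, D.ff Z y * d y ∂D.ρ := by
  rw [integral_prod _ (gd_int hZ hd)]
  refine integral_congr_ae (Eventually.of_forall fun y => ?_)
  simp only
  rw [integral_mul_const]; rfl

lemma gd_swap {Z d : ℝ → ℝ} (hZ : MemLp Z 2 D.ρ) (hd : MemLp d 2 D.ρ) :
    Integrable (fun p : ℝ × ℝ => D.g (Z p.1 - Z p.2) * d p.2) (D.ρ.prod D.ρ) ∧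
    ∫ p : ℝ × ℝ, D.g (Z p.1 - Z p.2) * d p.2 ∂(D.ρ.prod D.ρ) = - ∫ y, D.ff Z y * d y ∂D.ρ := by
  have e : (fun p : ℝ × ℝ => D.g (Z p.1 - Z p.2) * d p.2) = fun p => - ((fun p : ℝ × ℝ => D.g (Z p.1 - Z p.2) * d p.1) p.swap) := by
    funext p
    simp only [Prod.fst_swap, Prod.snd_swap]
    rw [show Z p.1 - Z p.2 = -(Z p.2 - Z p.1) by ring, D.godd]; ring
  constructor
  · rw [e]; exact (gd_int hZ hd).swap.neg
  · rw [e, integral_neg, ← gd_eq hZ hd]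
    exact congrArg Neg.neg (integral_prod_swap (μ := D.ρ) (ν := D.ρ) (fun p : ℝ × ℝ => D.g (Z p.1 - Z p.2) * d p.1))

lemma pot_ineq {Y Z : ℝ → ℝ} (hY : MemLp Y 2 D.ρ) (hZ : MemLp Z 2 D.ρ) :
    D.pot Z - D.pot Y ≤ (∫ y, D.ff Z y * (Z y - Y y) ∂D.ρ) + D.c * ∫ y, (Z y - Y y) ^ 2 ∂D.ρ := by
  have hd : MemLp (fun y => Z y - Y y) 2 D.ρ := hZ.sub hY
  have hc := D.hc
  have eP : ∀ {Y : ℝ → ℝ}, MemLp Y 2 D.ρ → D.pot Y = ∫ p : ℝ × ℝ, (1/2) * D.W (Y p.1 - Y p.2) ∂(D.ρ.prod D.ρ) :=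
    fun h => (integral_prod _ (W_int h)).symm
  rw [eP hY, eP hZ, ← integral_sub (W_int hZ) (W_int hY)]
  have j1 := gd_int hZ hd
  have j2 := (gd_swap hZ hd).1
  have j3 := q1 hd
  have j4 := q2 hd
  have key : ∀ p : ℝ × ℝ, (1/2) * D.W (Z p.1 - Z p.2) - (1/2) * D.W (Y p.1 - Y p.2) ≤
      (1/2) * (D.g (Z p.1 - Z p.2) * (Z p.1 - Y p.1)) - (1/2) * (D.g (Z p.1 - Z p.2) * (Z p.2 - Y p.2)) +
      (D.c / 2 * (Z p.1 - Y p.1) ^ 2 + D.c / 2 * (Z p.2 - Y p.2) ^ 2) := by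
    intro p
    have h1 := W_ineq (D := D) (Y p.1 - Y p.2) (Z p.1 - Z p.2)
    have h2 : (Z p.1 - Z p.2 - (Y p.1 - Y p.2)) ^ 2 ≤ 2 * ((Z p.1 - Y p.1) ^ 2 + (Z p.2 - Y p.2) ^ 2) := by
      nlinarith [sq_nonneg ((Z p.1 - Y p.1) + (Z p.2 - Y p.2))]
    nlinarith [mul_le_mul_of_nonneg_left h2 hc.le]
  refine (integral_mono ((W_int hZ).sub (W_int hY)) (((j1.const_mul (1/2)).sub (j2.const_mul (1/2))).add
    ((j3.const_mul (D.c / 2)).add (j4.const_mul (D.c / 2)))) key).trans (le_of_eq ?_)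
  have e1 : ∫ p : ℝ × ℝ, (Z p.1 - Y p.1) ^ 2 ∂(D.ρ.prod D.ρ) = ∫ y, (Z y - Y y) ^ 2 ∂D.ρ := by
    rw [integral_prod _ j3]; simp
  have e2 : ∫ p : ℝ × ℝ, (Z p.2 - Y p.2) ^ 2 ∂(D.ρ.prod D.ρ) = ∫ y, (Z y - Y y) ^ 2 ∂D.ρ := by
    rw [integral_prod _ j4]; simp
  have s1 := integral_add ((j1.const_mul (1/2)).sub (j2.const_mul (1/2))) ((j3.const_mul (D.c / 2)).add (j4.const_mul (D.c / 2)))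
  have s2 := integral_sub (j1.const_mul (1/2)) (j2.const_mul (1/2))
  have s3 := integral_add (j3.const_mul (D.c / 2)) (j4.const_mul (D.c / 2))
  simp only [Pi.sub_apply, Pi.add_apply] at s1 s2 s3 ⊢
  rw [s1, s2, s3, integral_const_mul, integral_const_mul, integral_const_mul, integral_const_mul, e1, e2,
    gd_eq hZ hd, (gd_swap hZ hd).2]
  ring

namespace Flow

lemma pot_hp (F : Flow D A X) (s t : ℝ) (hs : 0 ≤ s) (hst : s ≤ t) :
    D.pot (X t) - D.pot (X s) ≤ inner ℝ (F.f t) (F.x t - F.x s) + D.c * ‖F.x t - F.x s‖ ^ 2 := by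
  have ht := hs.trans hst
  have := pot_ineq (F.L2 s hs) (F.L2 t ht)
  have e : F.x t - F.x s = ((F.L2 t ht).sub (F.L2 s hs)).toLp _ := by
    rw [F.x_eq ht, F.x_eq hs]; exact (MemLp.toLp_sub _ _).symm
  rw [e, normsq_toLp, F.f_eq ht, inner_toLp]
  exact this

lemma energy (F : Flow D A X) {s t : ℝ} (hs : 0 ≤ s) (hst : s ≤ t) :
    1 / 2 * ‖F.hf.V t‖ ^ 2 + D.pot (X t) ≤ 1 / 2 * ‖F.hf.V s‖ ^ 2 + D.pot (X s) := by
  have : Fact ((2 : ENNReal) ≠ ⊤) := ⟨by norm_num⟩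
  obtain ⟨N, hN, hP⟩ := F.hf.Pcont
  exact F.hf.energy hN hP (p := fun t => D.pot (X t)) D.hc.le (fun s t hs hst => F.pot_hp s t hs hst) hs hst

end Flow
end Dat

lemma ext2 {A : Set ℝ} {C : Set (ℝ × ℝ)} (hC : IsClosed C) (h : ∀ y ∈ A, ∀ z ∈ A, (y, z) ∈ C) :
    ∀ y ∈ closure A, ∀ z ∈ closure A, (y, z) ∈ C := by
  intro y hy z hz
  have h1 : closure (A ×ˢ A) ⊆ C := closure_minimal (fun p hp => h p.1 hp.1 p.2 hp.2) hC
  rw [closure_prod_eq] at h1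
  exact h1 ⟨hy, hz⟩

namespace Dat
variable {D : Dat} {A : Set ℝ} {X : ℝ → ℝ → ℝ}

lemma pot_congr {Y Z : ℝ → ℝ} (h : Y =ᵐ[D.ρ] Z) : D.pot Y = D.pot Z := by
  unfold pot
  refine integral_congr_ae ?_
  filter_upwards [h] with y hy
  refine integral_congr_ae ?_
  filter_upwards [h] with z hz
  rw [hy, hz]

namespace Flow

lemma msupp_sub (F : Flow D A X) : msupp D.ρ ⊆ closure A := by
  intro y hy
  rw [Metric.mem_closure_iff]
  intro ε hε
  have h1 := hy ε hε
  by_contra! hcon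
  have : D.ρ (Ioo (y - ε) (y + ε)) = 0 := by
    refine measure_mono_null ?_ (ae_iff.1 F.Aae)
    intro z hz hzA
    have := hcon z hzA
    rw [Real.dist_eq] at this
    have h2 : |y - z| < ε := abs_lt.2 ⟨by linarith [hz.1, hz.2], by linarith [hz.1, hz.2]⟩
    linarith
  exact absurd this h1.ne'

lemma exXc (F : Flow D A X) : ∃ Y : ℝ → ℝ → ℝ, ∀ t, 0 ≤ t → Continuous (Y t) ∧ ∀ y ∈ A, Y t y = X t y := by
  have : ∀ t, ∃ Y : ℝ → ℝ, 0 ≤ t → Continuous Y ∧ ∀ y ∈ A, Y y = X t y := by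
    intro t
    by_cases ht : 0 ≤ t
    · obtain ⟨φ, hφ, h⟩ := factor zero_le_one (F.abs_ii ht)
      exact ⟨fun y => φ (D.om t y), fun _ => ⟨hφ.continuous.comp (D.om_cont t), fun y hy => (h y hy).symm⟩⟩
    · exact ⟨fun _ => 0, fun h => absurd h ht⟩
  choose Y hY using this
  exact ⟨Y, hY⟩

lemma V_mem (F : Flow D A X) {t : ℝ} (ht : 0 ≤ t) : F.hf.V t ∈ Sg D.ρ (X t) (F.mX t) := by
  show F.P t _ ∈ _
  rw [F.P_eq ht]; exact Submodule.starProjection_apply_mem _ _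

lemma V_eq (F : Flow D A X) {t : ℝ} (ht : 0 ≤ t) {γ : Lp ℝ 2 D.ρ} (hγ : γ ∈ Sg D.ρ (X t) (F.mX t)) :
    inner ℝ (F.hf.V t) γ = ∫ y, D.v y * γ y ∂D.ρ - ∫ y, (∫ τ in (0:ℝ)..t, D.ff (X τ) y) * γ y ∂D.ρ := by
  have h1 : inner ℝ (F.hf.V t) γ = inner ℝ (F.hf.u t) γ := by
    have h2 := F.hf.sym t (F.hf.u t) γ
    have h3 : F.hf.P t γ = γ := by
      show F.P t γ = γ
      rw [F.P_eq ht]; exact Submodule.starProjection_eq_self_iff.2 hγ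
    rw [h3] at h2; exact h2
  rw [h1, (F.ipf ht γ).2]
  refine (F.inner_u t γ).trans ?_
  congr 1
  rw [inner_Lp]
  refine integral_congr_ae ?_
  filter_upwards [D.vL.coeFn_toLp] with y hy
  simp only [wL]
  rw [hy]

lemma eqA (F : Flow D A X) {Y : ℝ → ℝ → ℝ} (hY : ∀ t, 0 ≤ t → Continuous (Y t) ∧ ∀ y ∈ A, Y t y = X t y) {t : ℝ} (ht : 0 ≤ t) :
    Y t =ᵐ[D.ρ] X t := by
  filter_upwards [F.Aae] with y hy using (hY t ht).2 y hy

lemma deriv_fin (F : Flow D A X) {Y : ℝ → ℝ → ℝ} (hY : ∀ t, 0 ≤ t → Continuous (Y t) ∧ ∀ y ∈ A, Y t y = X t y) {t : ℝ} (ht : 0 < t)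
    (h : HasDerivAt F.x (F.hf.V t) t) : HasL2DerivAt D.ρ Y (F.hf.V t) t := by
  rw [hasDerivAt_iff_tendsto_slope_zero, tendsto_iff_norm_sub_tendsto_zero] at h
  have h2 := h.pow 2
  rw [zero_pow two_ne_zero] at h2
  refine h2.congr' ?_
  have he : ∀ᶠ τ in 𝓝[≠] (0:ℝ), -t < τ := nhdsWithin_le_nhds (lt_mem_nhds (by linarith))
  filter_upwards [he] with τ hτ
  have ht' : 0 ≤ t + τ := by linarith
  rw [normsq_Lp]
  refine integral_congr_ae ?_
  filter_upwards [Lp.coeFn_sub (τ⁻¹ • (F.x (t + τ) - F.x t)) (F.hf.V t), Lp.coeFn_smul τ⁻¹ (F.x (t + τ) - F.x t),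
    Lp.coeFn_sub (F.x (t + τ)) (F.x t), F.x_ae ht', F.x_ae ht.le, F.eqA hY ht', F.eqA hY ht.le] with y h1 h2 h3 h4 h5 h6 h7
  rw [h1, Pi.sub_apply, h2, Pi.smul_apply, h3, Pi.sub_apply, h4, h5, h6, h7, smul_eq_mul, div_eq_inv_mul]

lemma a_fin (F : Flow D A X) {Y : ℝ → ℝ → ℝ} (hY : ∀ t, 0 ≤ t → Continuous (Y t) ∧ ∀ y ∈ A, Y t y = X t y) {t : ℝ} (ht : 0 ≤ t)
    (g : ℝ → ℝ) (hg : Continuous g) (hM : ∃ M, ∀ x, |g x| ≤ M) :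
    ∫ y, g (Y t y) * F.hf.V t y ∂D.ρ = ∫ y, g (Y t y) *
      (D.v y - ∫ τ in (0:ℝ)..t, ∫ z, D.g (Y τ y - Y τ z) ∂D.ρ) ∂D.ρ := by
  obtain ⟨M, hM⟩ := hM
  have hγL : MemLp (fun y => g (X t y)) 2 D.ρ := MemLp.of_bound
    (hg.measurable.comp (F.mX t)).aestronglyMeasurable M (Eventually.of_forall fun y => hM _)
  have hγ : hγL.toLp _ ∈ Sg D.ρ (X t) (F.mX t) := Sg_mem_iff.2 ⟨g, hg.measurable, hγL.coeFn_toLp⟩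
  have key := F.V_eq ht hγ
  have i1 : Integrable (fun y => D.v y * (hγL.toLp _ : Lp ℝ 2 D.ρ) y) D.ρ := D.vL.integrable_mul (Lp.memLp _)
  have i2 := (F.ipf ht (hγL.toLp _)).1
  rw [← integral_sub i1 i2, inner_Lp] at key
  have l1 : ∫ y, g (Y t y) * F.hf.V t y ∂D.ρ = ∫ y, F.hf.V t y * (hγL.toLp _ : Lp ℝ 2 D.ρ) y ∂D.ρ := by
    refine integral_congr_ae ?_
    filter_upwards [hγL.coeFn_toLp, F.Aae] with y h1 h2
    rw [h1, (hY t ht).2 y h2, mul_comm]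
  rw [l1, key]
  refine integral_congr_ae ?_
  filter_upwards [hγL.coeFn_toLp, F.Aae] with y h1 h2
  have e : ∫ τ in (0:ℝ)..t, ∫ z, D.g (Y τ y - Y τ z) ∂D.ρ = ∫ τ in (0:ℝ)..t, D.ff (X τ) y := by
    refine intervalIntegral.integral_congr fun τ hτ => ?_
    rw [uIcc_of_le ht] at hτ
    refine integral_congr_ae ?_
    filter_upwards [F.Aae] with z hz
    rw [(hY τ hτ.1).2 y h2, (hY τ hτ.1).2 z hz]
  rw [h1, (hY t ht).2 y h2, e]
  ring

end Flow

theorem fin (D : Dat) :  ∃ X V : ℝ → ℝ → ℝ,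
      (∀ t, 0 ≤ t → Continuous (X t)) ∧
      (∀ t, 0 ≤ t → Integrable (fun y => (X t y) ^ 2) D.ρ) ∧
      (∀ T > 0, ∃ L : ℝ, ∀ s ∈ Icc (0:ℝ) T, ∀ t ∈ Icc (0:ℝ) T,
        ∫ y, (X t y - X s y) ^ 2 ∂D.ρ ≤ L * (t - s) ^ 2) ∧
      (∀ᵐ y ∂D.ρ, X 0 y = y) ∧
      (∀ᵐ t ∂(volume.restrict (Ici (0:ℝ))),
        HasL2DerivAt D.ρ X (V t) t ∧
        (∀ g : ℝ → ℝ, Continuous g → (∃ M, ∀ x, |g x| ≤ M) →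
          ∫ y, g (X t y) * V t y ∂D.ρ =
            ∫ y, g (X t y) *
              (D.v y - ∫ τ in (0:ℝ)..t, ∫ z, D.g (X τ y - X τ z) ∂D.ρ) ∂D.ρ) ∧
        (∃ u : ℝ → ℝ, Measurable u ∧ ∀ᵐ y ∂D.ρ, V t y = u (X t y))) ∧
      (∃ N : Set ℝ, volume N = 0 ∧ ∀ s ∉ N, ∀ t ∉ N, 0 ≤ s → s ≤ t →
        (∫ y, (1/2) * (V t y) ^ 2 ∂D.ρ) +
          (∫ y, ∫ z, (1/2) * D.W (X t y - X t z) ∂D.ρ ∂D.ρ) ≤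
        (∫ y, (1/2) * (V s y) ^ 2 ∂D.ρ) +
          (∫ y, ∫ z, (1/2) * D.W (X s y - X s z) ∂D.ρ ∂D.ρ)) ∧
      (∀ t, 0 ≤ t → ∀ y ∈ msupp D.ρ, ∀ z ∈ msupp D.ρ, z ≤ y →
        0 ≤ X t y - X t z ∧
        X t y - X t z ≤ Real.cosh (Real.sqrt D.c * t) * (y - z) +
          (1 / Real.sqrt D.c) * Real.sinh (Real.sqrt D.c * t) * ∫ x in z..y, |D.v' x|) ∧
      (∀ s t : ℝ, 0 < s → s ≤ t → ∀ y ∈ msupp D.ρ, ∀ z ∈ msupp D.ρ,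
        |X t y - X t z| / Real.sinh (Real.sqrt D.c * t) ≤
          |X s y - X s z| / Real.sinh (Real.sqrt D.c * s)) := by
  obtain ⟨A, X, F⟩ := D.exists_flow
  obtain ⟨Y, hY⟩ := F.exXc
  have : Fact ((2 : ENNReal) ≠ ⊤) := ⟨by norm_num⟩
  obtain ⟨N, hN, hP⟩ := F.hf.Pcont
  refine ⟨Y, fun t => F.hf.V t, fun t ht => (hY t ht).1, fun t ht => ?_, fun T hT => ?_, ?_, ?_, ?_, ?_, ?_⟩
  · exact ((memLp_congr_ae (F.eqA hY ht)).2 (F.L2 t ht)).integrable_sq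
  · obtain ⟨L, hL, h⟩ := F.x_lip T
    refine ⟨L ^ 2, fun s hs t ht => ?_⟩
    have h1 := h s t hs.2 ht.2
    have h2 : ‖F.x t - F.x s‖ ^ 2 ≤ (L * |t - s|) ^ 2 := by gcongr
    rw [mul_pow, sq_abs, normsq_Lp] at h2
    refine le_trans (le_of_eq ?_) h2
    refine integral_congr_ae ?_
    filter_upwards [Lp.coeFn_sub (F.x t) (F.x s), F.x_ae ht.1, F.x_ae hs.1, F.eqA hY ht.1, F.eqA hY hs.1] with y h1 h2 h3 h4 h5
    rw [h1, Pi.sub_apply, h2, h3, h4, h5]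
  · filter_upwards [F.Aae] with y hy
    rw [(hY 0 le_rfl).2 y hy, F.init y hy]
  · have hnull : volume (N ∪ {0}) = 0 := (hN.union (countable_singleton 0)).measure_zero _
    have hae : ∀ᵐ t ∂(volume.restrict (Ici (0:ℝ))), t ∉ N ∪ {0} := ae_restrict_of_ae (compl_mem_ae_iff.2 hnull)
    filter_upwards [hae, ae_restrict_mem measurableSet_Ici] with t h1 h2
    have htN : t ∉ N := fun h => h1 (Or.inl h)
    have ht0 : t ≠ 0 := fun h => h1 (Or.inr h)
    have ht : 0 < t := lt_of_le_of_ne h2 ht0.symm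
    refine ⟨F.deriv_fin hY ht (F.hf.strong_deriv hN hP ht htN), fun g hg hM => F.a_fin hY ht.le g hg hM, ?_⟩
    obtain ⟨u, hu, he⟩ := Sg_mem_iff.1 (F.V_mem ht.le)
    refine ⟨u, hu, ?_⟩
    filter_upwards [he, F.eqA hY ht.le] with y h3 h4
    rw [h3, h4]
  · refine ⟨∅, measure_empty, fun s _ t _ hs hst => ?_⟩
    have h := F.energy hs hst
    rw [← pot_congr (F.eqA hY hs), ← pot_congr (F.eqA hY (hs.trans hst)), normsq_Lp, normsq_Lp,
      ← integral_const_mul, ← integral_const_mul] at h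
    exact h
  · intro t ht y hy z hz hzy
    have c := (hY t ht).1
    have co := D.om_cont t
    have h1 : |Y t y - Y t z| ≤ |D.om t y - D.om t z| := by
      refine ext2 (A := A) (C := {p : ℝ × ℝ | |Y t p.1 - Y t p.2| ≤ |D.om t p.1 - D.om t p.2|})
        (isClosed_le (by fun_prop) (by fun_prop)) (fun y hy z hz => ?_) y (F.msupp_sub hy) z (F.msupp_sub hz)
      have := F.abs_ii ht y hy z hz
      rw [one_mul] at this
      simp only [mem_ofPred_eq]
      rwa [(hY t ht).2 y hy, (hY t ht).2 z hz]
    have h2 : 0 ≤ (Y t y - Y t z) * (y - z) := by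
      refine ext2 (A := A) (C := {p : ℝ × ℝ | 0 ≤ (Y t p.1 - Y t p.2) * (p.1 - p.2)})
        (isClosed_le (by fun_prop) (by fun_prop)) (fun y hy z hz => ?_) y (F.msupp_sub hy) z (F.msupp_sub hz)
      simp only [mem_ofPred_eq]
      rw [(hY t ht).2 y hy, (hY t ht).2 z hz]
      rcases le_total y z with h | h
      · exact mul_nonneg_of_nonpos_of_nonpos (by linarith [F.mono t ht hy hz h]) (by linarith)
      · exact mul_nonneg (by linarith [F.mono t ht hz hy h]) (by linarith)
    constructor
    · rcases hzy.eq_or_lt with h | h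
      · rw [h, sub_self]
      · exact nonneg_of_mul_nonneg_left h2 (by linarith)
    · have h3 : D.om t z ≤ D.om t y := D.om_mono t hzy
      rw [abs_of_nonneg (sub_nonneg.2 h3)] at h1
      refine (le_abs_self _).trans (h1.trans (le_of_eq ?_))
      rw [← D.tv_sub z y]
      simp only [om, Ch]
      rw [D.Sp_of_nonneg ht]
      ring
  · intro s t hs hst y hy z hz
    have ht := hs.le.trans hst
    have c := (hY t ht).1
    have c' := (hY s hs.le).1
    have h1 : |Y t y - Y t z| ≤ D.Sp t / D.Sp s * |Y s y - Y s z| := by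
      refine ext2 (A := A) (C := {p : ℝ × ℝ | |Y t p.1 - Y t p.2| ≤ D.Sp t / D.Sp s * |Y s p.1 - Y s p.2|})
        (isClosed_le (by fun_prop) (by fun_prop)) (fun y hy z hz => ?_) y (F.msupp_sub hy) z (F.msupp_sub hz)
      have := F.abs_iii hs hst y hy z hz
      simp only [mem_ofPred_eq]
      rwa [(hY t ht).2 y hy, (hY t ht).2 z hz, (hY s hs.le).2 y hy, (hY s hs.le).2 z hz]
    rw [D.Sp_of_nonneg ht, D.Sp_of_nonneg hs.le] at h1
    have hk := D.k0
    have p1 : 0 < Real.sinh (√D.c * s) := Real.sinh_pos_iff.2 (by positivity)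
    have p2 : 0 < Real.sinh (√D.c * t) := Real.sinh_pos_iff.2 (mul_pos hk (hs.trans_le hst))
    rw [div_le_iff₀ p2]
    refine h1.trans (le_of_eq ?_)
    field_simp

end Dat

lemma fin_triv
    (ρ₀ : Measure ℝ) [IsProbabilityMeasure ρ₀]
    (v₀ v₀' : ℝ → ℝ)
    (hv₀'loc : LocallyIntegrable v₀' volume)
    (hv₀ : ∀ a b : ℝ, v₀ b - v₀ a = ∫ x in a..b, v₀' x)
    (W : ℝ → ℝ) (c : ℝ) (hc : 0 < c) (hid : MemLp (fun y : ℝ => y) 2 ρ₀)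
    (ψ : ℝ → ℝ) (hψ : ψ = fun y => ∫ z, deriv W (y - z) ∂ρ₀)
    (hψc : Continuous ψ) (hψL : MemLp ψ 2 ρ₀) (hnv : ¬ MemLp v₀ 2 ρ₀) :
    ∃ X V : ℝ → ℝ → ℝ,
      (∀ t, 0 ≤ t → Continuous (X t)) ∧
      (∀ t, 0 ≤ t → Integrable (fun y => (X t y) ^ 2) ρ₀) ∧
      (∀ T > 0, ∃ L : ℝ, ∀ s ∈ Icc (0:ℝ) T, ∀ t ∈ Icc (0:ℝ) T,
        ∫ y, (X t y - X s y) ^ 2 ∂ρ₀ ≤ L * (t - s) ^ 2) ∧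
      (∀ᵐ y ∂ρ₀, X 0 y = y) ∧
      (∀ᵐ t ∂(volume.restrict (Ici (0:ℝ))),
        HasL2DerivAt ρ₀ X (V t) t ∧
        (∀ g : ℝ → ℝ, Continuous g → (∃ M, ∀ x, |g x| ≤ M) →
          ∫ y, g (X t y) * V t y ∂ρ₀ =
            ∫ y, g (X t y) *
              (v₀ y - ∫ τ in (0:ℝ)..t, ∫ z, deriv W (X τ y - X τ z) ∂ρ₀) ∂ρ₀) ∧
        (∃ u : ℝ → ℝ, Measurable u ∧ ∀ᵐ y ∂ρ₀, V t y = u (X t y))) ∧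
      (∃ N : Set ℝ, volume N = 0 ∧ ∀ s ∉ N, ∀ t ∉ N, 0 ≤ s → s ≤ t →
        (∫ y, (1/2) * (V t y) ^ 2 ∂ρ₀) +
          (∫ y, ∫ z, (1/2) * W (X t y - X t z) ∂ρ₀ ∂ρ₀) ≤
        (∫ y, (1/2) * (V s y) ^ 2 ∂ρ₀) +
          (∫ y, ∫ z, (1/2) * W (X s y - X s z) ∂ρ₀ ∂ρ₀)) ∧
      (∀ t, 0 ≤ t → ∀ y ∈ msupp ρ₀, ∀ z ∈ msupp ρ₀, z ≤ y →
        0 ≤ X t y - X t z ∧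
        X t y - X t z ≤ Real.cosh (Real.sqrt c * t) * (y - z) +
          (1 / Real.sqrt c) * Real.sinh (Real.sqrt c * t) * ∫ x in z..y, |v₀' x|) ∧
      (∀ s t : ℝ, 0 < s → s ≤ t → ∀ y ∈ msupp ρ₀, ∀ z ∈ msupp ρ₀,
        |X t y - X t z| / Real.sinh (Real.sqrt c * t) ≤
          |X s y - X s z| / Real.sinh (Real.sqrt c * s)) := by
  have hvc : Continuous v₀ := by
    have e : v₀ = fun b => v₀ 0 + ∫ x in (0:ℝ)..b, v₀' x := by
      funext b; rw [← hv₀ 0 b]; ring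
    rw [e]
    exact continuous_const.add (intervalIntegral.continuous_primitive
      (fun a b => (hv₀'loc.integrableOn_isCompact isCompact_uIcc).intervalIntegrable) 0)
  have hVc : ∀ t : ℝ, Continuous (fun y => v₀ y - t * ψ y) := fun t =>
    hvc.sub (continuous_const.mul hψc)
  have hVn : ∀ t : ℝ, ¬ Integrable (fun y => (v₀ y - t * ψ y) ^ 2) ρ₀ := by
    intro t h
    rw [← memLp_two_iff_integrable_sq (hVc t).aestronglyMeasurable] at h
    apply hnv
    have := h.add (hψL.const_mul t)
    convert this using 1
    funext y; simp
  have hsc : 0 < Real.sqrt c := Real.sqrt_pos.2 hc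
  refine ⟨fun _ y => y, fun t y => v₀ y - t * ψ y, fun t _ => continuous_id,
    fun t _ => hid.integrable_sq, ?_, ?_, ?_, ?_, ?_, ?_⟩
  · intro T hT
    exact ⟨0, fun s _ t _ => by simp⟩
  · exact Eventually.of_forall fun y => rfl
  · refine Eventually.of_forall fun t => ⟨?_, ?_, ?_⟩
    · unfold HasL2DerivAt
      have e : ∀ τ : ℝ, ∫ y, ((y - y) / τ - (v₀ y - t * ψ y)) ^ 2 ∂ρ₀ = 0 := by
        intro τ
        apply integral_undef
        intro h
        apply hVn t
        convert h using 2
        ring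
      simp only [e]
      exact tendsto_const_nhds
    · intro g _ _
      refine integral_congr_ae (Eventually.of_forall fun y => ?_)
      simp [hψ]
    · exact ⟨_, (hVc t).measurable, Eventually.of_forall fun y => rfl⟩
  · refine ⟨∅, by simp, fun s _ t _ _ _ => ?_⟩
    have e : ∀ t : ℝ, ∫ y, (1/2) * (v₀ y - t * ψ y) ^ 2 ∂ρ₀ = 0 := by
      intro t
      rw [integral_const_mul, integral_undef (hVn t), mul_zero]
    rw [e, e]
  · intro t ht y _ z _ hzy
    refine ⟨by linarith, ?_⟩
    have h1 := Real.one_le_cosh (Real.sqrt c * t)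
    have h2 : 0 ≤ Real.sinh (Real.sqrt c * t) := Real.sinh_nonneg_iff.2 (by positivity)
    have h3 : 0 ≤ ∫ x in z..y, |v₀' x| :=
      intervalIntegral.integral_nonneg hzy fun x _ => abs_nonneg _
    have h4 : 0 ≤ (1 / Real.sqrt c) * Real.sinh (Real.sqrt c * t) * ∫ x in z..y, |v₀' x| := by
      positivity
    have h5 : 0 ≤ y - z := by linarith
    nlinarith
  · intro s t hs hst y _ z _
    have h1 : 0 < Real.sinh (Real.sqrt c * s) := Real.sinh_pos_iff.2 (by positivity)
    have h2 : Real.sinh (Real.sqrt c * s) ≤ Real.sinh (Real.sqrt c * t) :=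
      Real.sinh_le_sinh.2 (by gcongr)
    gcongr

/-- Theorem 1.1: existence of a trajectory map solving the pressureless Euler
flow equation, together with its energy-monotonicity, stability and quantitative
stickiness properties. -/
theorem pressureless_euler_flow_existence
    (ρ₀ : Measure ℝ) [IsProbabilityMeasure ρ₀]
    (hmom : Integrable (fun x => x ^ 2) ρ₀)
    (v₀ v₀' : ℝ → ℝ)
    (hv₀'loc : LocallyIntegrable v₀' volume)
    (hv₀ : ∀ a b : ℝ, v₀ b - v₀ a = ∫ x in a..b, v₀' x)
    (W : ℝ → ℝ) (c : ℝ)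
    (hW₁ : ContDiff ℝ 1 W)
    (hW₂ : ∀ x, W x = W (-x))
    (hW₃ : ∃ K, ∀ x, |deriv W x| ≤ K * (1 + |x|))
    (hc : 0 < c)
    (hW₄ : ConvexOn ℝ Set.univ fun x => W x + c / 2 * x ^ 2) :
    ∃ X V : ℝ → ℝ → ℝ,
      -- continuous representative at each time
      (∀ t, 0 ≤ t → Continuous (X t)) ∧
      -- X(t) ∈ L²(ρ₀)
      (∀ t, 0 ≤ t → Integrable (fun y => (X t y) ^ 2) ρ₀) ∧
      -- X : [0,∞) → L²(ρ₀) is locally Lipschitz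
      (∀ T > 0, ∃ L : ℝ, ∀ s ∈ Icc (0:ℝ) T, ∀ t ∈ Icc (0:ℝ) T,
        ∫ y, (X t y - X s y) ^ 2 ∂ρ₀ ≤ L * (t - s) ^ 2) ∧
      -- initial condition X(0) = id ρ₀-a.e.
      (∀ᵐ y ∂ρ₀, X 0 y = y) ∧
      -- pressureless Euler flow equation for a.e. t ≥ 0:
      (∀ᵐ t ∂(volume.restrict (Ici (0:ℝ))),
        HasL2DerivAt ρ₀ X (V t) t ∧
        (∀ g : ℝ → ℝ, Continuous g → (∃ M, ∀ x, |g x| ≤ M) →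
          ∫ y, g (X t y) * V t y ∂ρ₀ =
            ∫ y, g (X t y) *
              (v₀ y - ∫ τ in (0:ℝ)..t, ∫ z, deriv W (X τ y - X τ z) ∂ρ₀) ∂ρ₀) ∧
        (∃ u : ℝ → ℝ, Measurable u ∧ ∀ᵐ y ∂ρ₀, V t y = u (X t y))) ∧
      -- (i) energy nonincreasing for a.e. s ≤ t
      (∃ N : Set ℝ, volume N = 0 ∧ ∀ s ∉ N, ∀ t ∉ N, 0 ≤ s → s ≤ t →
        (∫ y, (1/2) * (V t y) ^ 2 ∂ρ₀) +
          (∫ y, ∫ z, (1/2) * W (X t y - X t z) ∂ρ₀ ∂ρ₀) ≤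
        (∫ y, (1/2) * (V s y) ^ 2 ∂ρ₀) +
          (∫ y, ∫ z, (1/2) * W (X s y - X s z) ∂ρ₀ ∂ρ₀)) ∧
      -- (ii) monotonicity and stability estimate on supp(ρ₀)
      (∀ t, 0 ≤ t → ∀ y ∈ msupp ρ₀, ∀ z ∈ msupp ρ₀, z ≤ y →
        0 ≤ X t y - X t z ∧
        X t y - X t z ≤ Real.cosh (Real.sqrt c * t) * (y - z) +
          (1 / Real.sqrt c) * Real.sinh (Real.sqrt c * t) * ∫ x in z..y, |v₀' x|) ∧
      -- (iii) quantitative stickiness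
      (∀ s t : ℝ, 0 < s → s ≤ t → ∀ y ∈ msupp ρ₀, ∀ z ∈ msupp ρ₀,
        |X t y - X t z| / Real.sinh (Real.sqrt c * t) ≤
          |X s y - X s z| / Real.sinh (Real.sqrt c * s)) := by
  have hid : MemLp (fun y : ℝ => y) 2 ρ₀ :=
    (memLp_two_iff_integrable_sq continuous_id.aestronglyMeasurable).2 hmom
  obtain ⟨K, hK⟩ := hW₃
  have hWd : Differentiable ℝ W := hW₁.differentiable (by norm_num)
  have hWc : Continuous (deriv W) := hW₁.continuous_deriv (by norm_num)
  have hodd : ∀ x, deriv W (-x) = - deriv W x := by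
    intro x
    have e : W = fun x => W (-x) := funext hW₂
    have h1 : HasDerivAt (fun x => W (-x)) (deriv W (-x) * (-1)) x :=
      (hWd (-x)).hasDerivAt.comp x (hasDerivAt_neg x)
    rw [← e] at h1
    have := h1.deriv
    linarith
  have hD : ∀ x, HasDerivAt (fun x => W x + c / 2 * x ^ 2) (deriv W x + c * x) x := by
    intro x
    have h2 : HasDerivAt (fun x : ℝ => c / 2 * x ^ 2) (c / 2 * (2 * x)) x := by
      simpa using (hasDerivAt_pow 2 x).const_mul (c / 2)
    exact ((hWd x).hasDerivAt.add h2).congr_deriv (by ring)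
  have hmo : Monotone (fun x => deriv W x + c * x) := by
    have h := hW₄.monotoneOn_deriv (fun x _ => (hD x).differentiableAt)
    intro a b hab
    have := h (mem_univ a) (mem_univ b) hab
    rwa [(hD a).deriv, (hD b).deriv] at this
  by_cases hv : MemLp v₀ 2 ρ₀
  · let D : Dat :=
      { ρ := ρ₀, prob := inferInstance, idL := hid, v := v₀, vL := hv, v' := v₀'
        v'loc := hv₀'loc, hv := hv₀, W := W, g := deriv W
        hW := fun x => (hWd x).hasDerivAt, gc := hWc, godd := hodd, K := K, gK := hK
        c := c, hc := hc, gm := hmo }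
    exact D.fin
  · let D : Dat :=
      { ρ := ρ₀, prob := inferInstance, idL := hid, v := fun _ => 0, vL := MemLp.zero
        v' := fun _ => 0
        v'loc := locallyIntegrable_const 0, hv := by simp, W := W, g := deriv W
        hW := fun x => (hWd x).hasDerivAt, gc := hWc, godd := hodd, K := K, gK := hK
        c := c, hc := hc, gm := hmo }
    exact fin_triv ρ₀ v₀ v₀' hv₀'loc hv₀ W c hc hid (D.psi fun y => y) rfl
      (Dat.psi_cont (D := D) (hid.integrable (by norm_num)))
      (Dat.ff_L (D := D) hid) hv

end
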